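/- There exists a group homomorphism φ̃ : Z_W(c) → ℂˣ with φ̃(c_i) = e^{−2πi/n_i} for every 1 ≤ i ≤ p such that, setting f̃ = (1/|Z_W(c)|) ∑_{z ∈ Z_W(c)} φ̃(z) z⁻¹ ∈ ℂW (so that the right ℂW-module f̃ ℂW affords the induced character Ind_{Z_W(c)}^W(φ̃)), the right ℂW-modules E_λ = e_λ ℂW and f̃ ℂW are isomorphic; that is, E_λ ≅ Ind_{Z_W(c)}^W(φ̃). (This is the group-algebra half of the relative theorem for pairs (W, W_L) with W_L a parabolic subgroup all of whose irreducible factors are of type A.) -/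

import Mathlib

open scoped Classical
open MonoidAlgebra Finset

noncomputable section

namespace DPR

variable {B : Type} {W : Type} [Group W] [Fintype W] [DecidableEq W]
  {M : CoxeterMatrix B}

/-- The set `S` of simple reflections of the Coxeter system, as a finset of `W`. -/
def Simples (cs : CoxeterSystem M W) : Finset W :=
  Finset.univ.filter (fun w => ∃ i, cs.simple i = w)

/-- The set `W^I` of minimal length left coset representatives of `W_I`,
computed inside the subset `H` of `W` (take `H = Set.univ` for the absolute case). -/
def minCoset (cs : CoxeterSystem M W) (H : Set W) (I : Finset W) : Finset W :=
  Finset.univ.filter (fun w => w ∈ H ∧ ∀ s ∈ I, cs.length w < cs.length (w * s))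

/-- The element `x_I = ∑_{w ∈ W^I} w` of the group algebra `ℂ W`, relative to `H`. -/
def xRel (cs : CoxeterSystem M W) (H : Set W) (I : Finset W) : MonoidAlgebra ℂ W :=
  ∑ w ∈ minCoset cs H I, of ℂ W w

/-- `w(Δ_J) ⊆ Δ_D`:  for every `s ∈ J`, `wsw⁻¹ ∈ D` and `ℓ(ws) = ℓ(w) + 1`. -/
def Takes (cs : CoxeterSystem M W) (D : Finset W) (w : W) (J : Finset W) : Prop :=
  ∀ s ∈ J, w * s * w⁻¹ ∈ D ∧ cs.length (w * s) = cs.length w + 1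

/-- `ᵂJ = wJw⁻¹`. -/
def conjF (w : W) (J : Finset W) : Finset W := J.image (fun s => w * s * w⁻¹)

/-- The coefficient `m^σ_{JK}`, computed relative to the pair `(H, D)`
(`H = Set.univ`, `D = S` in the absolute case). -/
def mC (cs : CoxeterSystem M W) (H : Set W) (D : Finset W) (σ : Finset W → ℝ)
    (J K : Finset W) : ℝ :=
  if J ⊆ K then
    ∑ w ∈ (minCoset cs H K).filter (fun w => Takes cs D w J), σ (conjF w J)
  else 0

/-- The family `(e_J)` is a family of BBHT quasi-idempotents, relative to `(H, D, σ)`: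
it solves the defining triangular system `x_K = ∑_{J ⊆ K} m^σ_{JK} e_J` for all `K ⊆ D`. -/
def IsBBHT (cs : CoxeterSystem M W) (H : Set W) (D : Finset W) (σ : Finset W → ℝ)
    (e : Finset W → MonoidAlgebra ℂ W) : Prop :=
  ∀ K ∈ D.powerset, xRel cs H K = ∑ J ∈ K.powerset, (mC cs H D σ J K : ℂ) • e J

/-- `σ` takes positive values (on subsets of `D`). -/
def PosOn (D : Finset W) (σ : Finset W → ℝ) : Prop := ∀ I ∈ D.powerset, 0 < σ I

/-- Two subsets of `S` have the same shape if the parabolic subgroups they generate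
are conjugate in `W`. -/
def ShapeEq (I J : Finset W) : Prop :=
  ∃ w : W, Subgroup.closure (J : Set W) =
    Subgroup.map (MulAut.conj w).toMonoidHom (Subgroup.closure (I : Set W))

/-- Solomon's descent algebra, as a subspace of the group algebra: the span of the `x_I`. -/
def descAlg (cs : CoxeterSystem M W) : Submodule ℂ (MonoidAlgebra ℂ W) :=
  Submodule.span ℂ {a | ∃ I ∈ (Simples cs).powerset, a = xRel cs Set.univ I}

/-! ### The exchange condition -/

/-- The action of a simple reflection on `W × ℤ/2` used to prove the exchange condition. -/
def signFun (cs : CoxeterSystem M W) (i : B) : Function.End (W × ZMod 2) :=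
  fun x => (cs.simple i * x.1 * cs.simple i, x.2 + if x.1 = cs.simple i then 1 else 0)

theorem end_mul_app {α : Type*} (f g : Function.End α) (x : α) : (f * g) x = f (g x) := rfl

theorem end_one_app {α : Type*} (x : α) : (1 : Function.End α) x = x := rfl

theorem signFun_mul_pow (cs : CoxeterSystem M W) (i j : B) (k : ℕ) (t : W) (ε : ZMod 2) :
    ((signFun cs i * signFun cs j) ^ k) (t, ε) =
      ((cs.simple i * cs.simple j) ^ k * t * ((cs.simple i * cs.simple j) ^ k)⁻¹,
        ε + ∑ q ∈ range (2 * k), if t = cs.simple j * (cs.simple i * cs.simple j) ^ q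
          then 1 else 0) := by
  set a := cs.simple i with ha
  set b := cs.simple j with hb
  have ha2 : a⁻¹ = a := cs.inv_simple i
  have hb2 : b⁻¹ = b := cs.inv_simple j
  have haa : a * a = 1 := cs.simple_mul_simple_self i
  have hbb : b * b = 1 := cs.simple_mul_simple_self j
  have hconj : ∀ k : ℕ, b * (a * b) ^ k = ((a * b) ^ k)⁻¹ * b := by
    intro k
    have h1 : b * (a * b) * b⁻¹ = (a * b)⁻¹ := by
      rw [mul_inv_rev, ha2, hb2]; simp [mul_assoc, hbb]
    have h2 := congrArg (· ^ k) h1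
    simp only [conj_pow, inv_pow] at h2
    rw [← h2]; group
  induction k with
  | zero => simp [end_one_app]
  | succ k ih =>
    rw [pow_succ', end_mul_app, ih]
    simp only [end_mul_app, signFun, ← ha, ← hb]
    refine Prod.ext ?_ ?_
    · simp only [pow_succ', mul_inv_rev, ha2, hb2]; group
    · have e1 : (a * b) ^ k * t * ((a * b) ^ k)⁻¹ = b ↔ t = b * (a * b) ^ (2 * k) := by
        rw [two_mul, pow_add, ← mul_assoc, hconj]
        constructor
        · intro h
          rw [mul_inv_eq_iff_eq_mul] at h
          rw [mul_assoc, ← h]; group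
        · rintro rfl; group
      have e2 : b * ((a * b) ^ k * t * ((a * b) ^ k)⁻¹) * b = a ↔
          t = b * (a * b) ^ (2 * k + 1) := by
        have : b * (a * b) ^ (2 * k + 1) = ((a * b) ^ k)⁻¹ * (b * a * b) * (a * b) ^ k := by
          rw [show 2 * k + 1 = k + (1 + k) by ring, pow_add, ← mul_assoc, hconj, pow_add, pow_one]
          simp only [mul_assoc]
        rw [this]
        generalize (a * b) ^ k = x
        have hbb' : ∀ y, b * (b * y) = y := fun y => by rw [← mul_assoc, hbb, one_mul]
        constructor
        · intro h
          rw [← h]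
          simp [mul_assoc, hbb']
        · rintro rfl
          simp [mul_assoc, hbb', hbb]
      simp only [e1, e2]
      rw [show 2 * (k + 1) = 2 * k + 1 + 1 by ring, sum_range_succ, sum_range_succ]
      ring

theorem signFun_liftable (cs : CoxeterSystem M W) : M.IsLiftable (signFun cs) := by
  intro i j
  funext ⟨t, ε⟩
  rw [signFun_mul_pow, cs.simple_mul_simple_pow]
  refine Prod.ext (by simp [end_one_app]) ?_
  have : ∀ m : ℕ, (cs.simple i * cs.simple j) ^ m = 1 →
      ∑ q ∈ range (2 * m), (if t = cs.simple j * (cs.simple i * cs.simple j) ^ q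
          then (1 : ZMod 2) else 0) = 0 := by
    intro m hm
    rw [two_mul, sum_range_add]
    simp only [pow_add, hm, one_mul]
    exact CharTwo.add_self_eq_zero _
  simp [this _ (cs.simple_mul_simple_pow i j), end_one_app]

/-- The sign representation of `W` on `W × ℤ/2`. -/
def signRep (cs : CoxeterSystem M W) : W →* Function.End (W × ZMod 2) :=
  cs.lift ⟨signFun cs, signFun_liftable cs⟩

theorem signRep_wordProd (cs : CoxeterSystem M W) (ω : List B) (t : W) (ε : ZMod 2) :
    signRep cs (cs.wordProd ω) (t, ε) =
      (cs.wordProd ω * t * (cs.wordProd ω)⁻¹, ε + ((cs.rightInvSeq ω).count t : ZMod 2)) := by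
  induction ω with
  | nil => simp [end_one_app]
  | cons i ω ih =>
    rw [cs.wordProd_cons, map_mul, end_mul_app, ih, signRep,
      cs.lift_apply_simple]
    simp only [signFun, CoxeterSystem.rightInvSeq, List.count_cons]
    refine Prod.ext ?_ ?_
    · simp [mul_assoc]
    · have : cs.wordProd ω * t * (cs.wordProd ω)⁻¹ = cs.simple i ↔
          ((cs.wordProd ω)⁻¹ * cs.simple i * cs.wordProd ω == t) = true := by
        rw [beq_iff_eq]
        constructor
        · intro h; rw [← h]; group
        · rintro rfl; group
      simp only [this]
      push_cast
      ring

theorem exchange_word (cs : CoxeterSystem M W) (ω : List B) (i : B)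
    (h : cs.length (cs.wordProd ω * cs.simple i) < cs.length (cs.wordProd ω)) :
    ∃ j < ω.length, cs.wordProd ω * cs.simple i = cs.wordProd (ω.eraseIdx j) := by
  obtain ⟨ω', hr, hω'⟩ := cs.exists_isReduced (cs.wordProd ω * cs.simple i)
  have h1 : cs.simple i ∉ cs.rightInvSeq ω' := by
    intro hm
    have := (cs.isRightInversion_of_mem_rightInvSeq hr hm).2
    rw [← hω', cs.simple_mul_simple_cancel_right] at this
    omega
  have h2 : cs.wordProd ω = cs.wordProd (ω' ++ [i]) := by
    rw [cs.wordProd_append, ← hω']; simp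
  have h3 := congrArg Prod.snd (signRep_wordProd cs ω (cs.simple i) 0)
  rw [h2, signRep_wordProd] at h3
  have h4 : cs.rightInvSeq (ω' ++ [i]) =
      (cs.rightInvSeq ω').map (MulAut.conj (cs.simple i)) ++ [cs.simple i] := by
    have := cs.rightInvSeq_concat ω' i
    simpa using this
  have h5 : (cs.rightInvSeq (ω' ++ [i])).count (cs.simple i) = 1 := by
    rw [h4, List.count_append]
    have : List.count (cs.simple i) ((cs.rightInvSeq ω').map (MulAut.conj (cs.simple i))) = 0 := by
      rw [List.count_eq_zero]
      intro hm
      obtain ⟨t, ht, h⟩ := List.mem_map.1 hm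
      apply h1
      have : t = cs.simple i := by
        simp only [MulAut.conj_apply] at h
        rw [mul_inv_eq_iff_eq_mul, mul_right_inj] at h
        exact h
      rwa [← this]
    simp [this]
  rw [h5] at h3
  have h6 : cs.simple i ∈ cs.rightInvSeq ω := by
    rw [← List.count_pos_iff, Nat.pos_iff_ne_zero]
    intro h0
    simp [h0] at h3
  obtain ⟨j, hj, hji⟩ := List.getElem_of_mem h6
  rw [cs.length_rightInvSeq] at hj
  refine ⟨j, hj, ?_⟩
  rw [← cs.wordProd_mul_getD_rightInvSeq, List.getD_eq_getElem _ _ (by simpa using hj), hji]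

/-- Every simple reflection descends to the set `Simples`. -/
theorem mem_Simples (cs : CoxeterSystem M W) {s : W} :
    s ∈ Simples cs ↔ ∃ i, cs.simple i = s := by simp [Simples]

theorem mul_self_of_mem {cs : CoxeterSystem M W} {s : W} (hs : s ∈ Simples cs) : s * s = 1 := by
  obtain ⟨i, rfl⟩ := (mem_Simples cs).1 hs
  exact cs.simple_mul_simple_self i

theorem inv_of_mem {cs : CoxeterSystem M W} {s : W} (hs : s ∈ Simples cs) : s⁻¹ = s :=
  inv_eq_of_mul_eq_one_right (mul_self_of_mem hs)

theorem length_of_mem {cs : CoxeterSystem M W} {s : W} (hs : s ∈ Simples cs) :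
    cs.length s = 1 := by
  obtain ⟨i, rfl⟩ := (mem_Simples cs).1 hs
  exact cs.length_simple i

theorem mem_Simples_of_length {cs : CoxeterSystem M W} {s : W} (hs : cs.length s = 1) :
    s ∈ Simples cs := by
  obtain ⟨i, rfl⟩ := cs.length_eq_one_iff.1 hs
  exact (mem_Simples cs).2 ⟨i, rfl⟩

theorem length_mul_mem {cs : CoxeterSystem M W} {s : W} (hs : s ∈ Simples cs) (w : W) :
    cs.length (w * s) = cs.length w + 1 ∨ cs.length (w * s) + 1 = cs.length w := by
  obtain ⟨i, rfl⟩ := (mem_Simples cs).1 hs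
  exact cs.length_mul_simple w i

theorem length_mem_mul {cs : CoxeterSystem M W} {s : W} (hs : s ∈ Simples cs) (w : W) :
    cs.length (s * w) = cs.length w + 1 ∨ cs.length (s * w) + 1 = cs.length w := by
  obtain ⟨i, rfl⟩ := (mem_Simples cs).1 hs
  exact cs.length_simple_mul w i

/-- The exchange condition for words in `W` with letters in `Simples`. -/
theorem exchange {cs : CoxeterSystem M W} {s : W} (hs : s ∈ Simples cs) (ω : List W)
    (hω : ∀ x ∈ ω, x ∈ Simples cs) (h : cs.length (ω.prod * s) < cs.length ω.prod) :
    ∃ j < ω.length, ω.prod * s = (ω.eraseIdx j).prod := by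
  obtain ⟨i, rfl⟩ := (mem_Simples cs).1 hs
  obtain ⟨ω', rfl⟩ : ∃ ω' : List B, ω'.map cs.simple = ω := by
    have : ω ∈ Set.range (List.map cs.simple) := by
      rw [Set.range_list_map]
      exact fun x hx => by simpa using (mem_Simples cs).1 (hω x hx)
    exact this
  obtain ⟨j, hj, he⟩ := exchange_word cs ω' i h
  refine ⟨j, by simpa using hj, ?_⟩
  rw [List.eraseIdx_map]
  exact he

/-! ### The reflection cocycle -/

/-- The `ℤ/2`-valued reflection cocycle: on reflections `t` it detects `ℓ (w * t) < ℓ w`. -/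
def refl01 (cs : CoxeterSystem M W) (w t : W) : ZMod 2 := (signRep cs w (t, 0)).2

theorem signRep_apply (cs : CoxeterSystem M W) (w t : W) (ε : ZMod 2) :
    signRep cs w (t, ε) = (w * t * w⁻¹, ε + refl01 cs w t) := by
  obtain ⟨ω, rfl⟩ := cs.wordProd_surjective w
  simp [refl01, signRep_wordProd]

theorem refl01_mul (cs : CoxeterSystem M W) (x y t : W) :
    refl01 cs (x * y) t = refl01 cs y t + refl01 cs x (y * t * y⁻¹) := by
  rw [refl01, map_mul, end_mul_app, signRep_apply, signRep_apply]
  simp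

theorem refl01_one (cs : CoxeterSystem M W) (t : W) : refl01 cs 1 t = 0 := by
  simp [refl01, end_one_app]

theorem refl01_inv (cs : CoxeterSystem M W) (y t : W) :
    refl01 cs y⁻¹ (y * t * y⁻¹) = refl01 cs y t := by
  have h := refl01_mul cs y⁻¹ y t
  rw [inv_mul_cancel, refl01_one] at h
  have h2 := congrArg (· + refl01 cs y⁻¹ (y * t * y⁻¹)) h
  simp only [zero_add, add_assoc, CharTwo.add_self_eq_zero, add_zero] at h2
  exact h2

theorem refl01_self {cs : CoxeterSystem M W} {t : W} (ht : cs.IsReflection t) :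
    refl01 cs t t = 1 := by
  obtain ⟨y, i, rfl⟩ := ht
  have h1 : refl01 cs (cs.simple i) (cs.simple i) = 1 := by
    rw [refl01, signRep, cs.lift_apply_simple]; simp [signFun]
  rw [refl01_mul, refl01_mul, refl01_inv]
  have e : y⁻¹ * (y * cs.simple i * y⁻¹) * y⁻¹⁻¹ = cs.simple i := by group
  rw [e, h1, mul_inv_cancel_right, add_comm, add_assoc, CharTwo.add_self_eq_zero, add_zero]

theorem length_lt_of_refl01 {cs : CoxeterSystem M W} {w t : W} (h : refl01 cs w t = 1) :
    cs.length (w * t) < cs.length w := by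
  obtain ⟨ω, hr, rfl⟩ := cs.exists_isReduced w
  rw [refl01, signRep_wordProd] at h
  have h6 : t ∈ cs.rightInvSeq ω := by
    rw [← List.count_pos_iff, Nat.pos_iff_ne_zero]
    intro h0
    simp [h0] at h
  exact (cs.isRightInversion_of_mem_rightInvSeq hr h6).2

theorem zmod2_cases (a : ZMod 2) : a = 0 ∨ a = 1 := by
  revert a; decide

theorem refl01_eq_one_iff {cs : CoxeterSystem M W} {w t : W} (ht : cs.IsReflection t) :
    refl01 cs w t = 1 ↔ cs.length (w * t) < cs.length w := by
  refine ⟨length_lt_of_refl01, fun h => ?_⟩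
  rcases zmod2_cases (refl01 cs w t) with h0 | h0
  · exfalso
    have h1 : refl01 cs (w * t) t = 1 := by
      rw [refl01_mul, refl01_self ht, mul_inv_cancel_right, h0, add_zero]
    have := length_lt_of_refl01 h1
    rw [mul_assoc, ht.mul_self, mul_one] at this
    omega
  · exact h0

theorem refl01_eq_zero_iff {cs : CoxeterSystem M W} {w t : W} (ht : cs.IsReflection t) :
    refl01 cs w t = 0 ↔ cs.length w < cs.length (w * t) := by
  have h := refl01_eq_one_iff (w := w) ht
  have h2 := ht.length_mul_left_ne w
  rcases zmod2_cases (refl01 cs w t) with h0 | h0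
  · rw [h0] at h ⊢; simp at h; simp; omega
  · rw [h0] at h ⊢; simp at h; simp; omega

theorem isReflection_of_mem {cs : CoxeterSystem M W} {s : W} (hs : s ∈ Simples cs) :
    cs.IsReflection s := by
  obtain ⟨i, rfl⟩ := (mem_Simples cs).1 hs
  exact cs.isReflection_simple i

/-! ### Parabolic subgroups and minimal coset representatives -/

/-- The standard parabolic subgroup generated by `I`. -/
abbrev Par (I : Finset W) : Subgroup W := Subgroup.closure (I : Set W)

/-- `w` is of minimal length in `w W_I`. -/
def RMin (cs : CoxeterSystem M W) (I : Finset W) (w : W) : Prop :=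
  ∀ s ∈ I, cs.length w < cs.length (w * s)

/-- `w` is of minimal length in `W_I w`. -/
def LMin (cs : CoxeterSystem M W) (I : Finset W) (w : W) : Prop :=
  ∀ s ∈ I, cs.length w < cs.length (s * w)

theorem mem_Par {I : Finset W} {s : W} (hs : s ∈ I) : s ∈ Par I :=
  Subgroup.subset_closure hs

theorem Par_mono {I J : Finset W} (h : I ⊆ J) : Par I ≤ Par J :=
  Subgroup.closure_mono (by exact_mod_cast h)

theorem prod_mem_Par {I : Finset W} {ω : List W} (h : ∀ x ∈ ω, x ∈ I) : ω.prod ∈ Par I :=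
  Subgroup.list_prod_mem _ fun x hx => mem_Par (h x hx)

theorem length_prod_le {cs : CoxeterSystem M W} {ω : List W}
    (hω : ∀ x ∈ ω, x ∈ Simples cs) : cs.length ω.prod ≤ ω.length := by
  induction ω with
  | nil => simp
  | cons x ω ih =>
    have h1 := cs.length_mul_le x ω.prod
    rw [length_of_mem (hω x (by simp))] at h1
    have := ih fun y hy => hω y (by simp [hy])
    simp only [List.prod_cons, List.length_cons]
    omega

theorem exists_reduced {cs : CoxeterSystem M W} {I : Finset W} (hI : I ⊆ Simples cs) {v : W}
    (hv : v ∈ Par I) : ∃ ω : List W, (∀ x ∈ ω, x ∈ I) ∧ ω.prod = v ∧ ω.length = cs.length v := by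
  have key : ∀ v s, (∃ ω : List W, (∀ x ∈ ω, x ∈ I) ∧ ω.prod = v ∧ ω.length = cs.length v) →
      s ∈ I → (∃ ω : List W, (∀ x ∈ ω, x ∈ I) ∧ ω.prod = v * s ∧
        ω.length = cs.length (v * s)) := by
    rintro v s ⟨ω, h1, rfl, h3⟩ hs
    rcases length_mul_mem (hI hs) ω.prod with h | h
    · refine ⟨ω ++ [s], ?_, by simp, by simp [h, h3]⟩
      intro x hx
      rcases List.mem_append.1 hx with hx | hx
      · exact h1 x hx
      · rwa [List.mem_singleton.1 hx]
    · obtain ⟨j, hj, h4⟩ := exchange (hI hs) ω (fun x hx => hI (h1 x hx)) (by omega)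
      refine ⟨ω.eraseIdx j, fun x hx => h1 x (List.mem_of_mem_eraseIdx hx), h4.symm, ?_⟩
      rw [List.length_eraseIdx_of_lt hj]; omega
  refine Subgroup.closure_induction_right (p := fun v _ => ∃ ω : List W, (∀ x ∈ ω, x ∈ I) ∧
    ω.prod = v ∧ ω.length = cs.length v) ⟨[], by simp⟩ ?_ ?_ hv
  · exact fun v _ s hs ih => key v s ih hs
  · intro v _ s hs ih
    rw [inv_of_mem (hI hs)]
    exact key v s ih hs

theorem exists_reduced_univ (cs : CoxeterSystem M W) (v : W) :
    ∃ ω : List W, (∀ x ∈ ω, x ∈ Simples cs) ∧ ω.prod = v ∧ ω.length = cs.length v := by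
  apply exists_reduced (Subset.refl _)
  have h : (Simples cs : Set W) = Set.range cs.simple := by
    ext x; simp [Simples]
  rw [Par, h, cs.subgroup_closure_range_simple]
  trivial

/-- Nontrivial elements of a parabolic subgroup have a right descent there. -/
theorem exists_right_factor {cs : CoxeterSystem M W} {I : Finset W} (hI : I ⊆ Simples cs) {v : W}
    (hv : v ∈ Par I) (h1 : v ≠ 1) :
    ∃ v' ∈ Par I, ∃ s ∈ I, v = v' * s ∧ cs.length v = cs.length v' + 1 := by
  obtain ⟨ω, h, rfl, h3⟩ := exists_reduced hI hv
  rcases List.eq_nil_or_concat ω with rfl | ⟨ω', s, rfl⟩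
  · simp at h1
  · rw [List.concat_eq_append] at *
    have hs : s ∈ I := h s (by simp)
    have hω' : ∀ x ∈ ω', x ∈ I := fun x hx => h x (by simp [hx])
    refine ⟨ω'.prod, prod_mem_Par hω', s, hs, by simp, ?_⟩
    have h4 := length_prod_le (fun x hx => hI (hω' x hx))
    have h5 := cs.length_mul_le ω'.prod s
    rw [length_of_mem (hI hs)] at h5
    simp only [List.prod_append, List.prod_singleton, List.length_append, List.length_singleton]
      at h3 ⊢
    omega

theorem exists_left_factor {cs : CoxeterSystem M W} {I : Finset W} (hI : I ⊆ Simples cs) {v : W}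
    (hv : v ∈ Par I) (h1 : v ≠ 1) :
    ∃ v' ∈ Par I, ∃ s ∈ I, v = s * v' ∧ cs.length v = cs.length v' + 1 := by
  obtain ⟨v', hv', s, hs, h, hl⟩ := exists_right_factor hI (inv_mem hv) (inv_ne_one.2 h1)
  refine ⟨v'⁻¹, inv_mem hv', s, hs, ?_, by simpa using hl⟩
  rw [← inv_inv v, h, mul_inv_rev, inv_of_mem (hI hs)]

theorem length_mul_of_min {cs : CoxeterSystem M W} {I : Finset W} (hI : I ⊆ Simples cs) {u : W}
    (hu : ∀ v ∈ Par I, cs.length u ≤ cs.length (u * v)) {v : W} (hv : v ∈ Par I) :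
    cs.length (u * v) = cs.length u + cs.length v := by
  induction hn : cs.length v using Nat.strong_induction_on generalizing v with
  | _ n ih =>
  by_cases h1 : v = 1
  · subst h1; simp at hn; simp [← hn]
  obtain ⟨v', hv', s, hs, rfl, hl⟩ := exists_right_factor hI hv h1
  have ih' := ih _ (by omega) hv' rfl
  rw [← mul_assoc]
  rcases length_mul_mem (hI hs) (u * v') with h | h
  · omega
  · exfalso
    obtain ⟨ω, hω, rfl, hωl⟩ := exists_reduced_univ cs u
    obtain ⟨ω', hω', rfl, hωl'⟩ := exists_reduced hI hv'
    obtain ⟨j, hj, he⟩ := exchange (hI hs) (ω ++ ω') (fun x hx => by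
      rcases List.mem_append.1 hx with hx | hx
      · exact hω x hx
      · exact hI (hω' x hx)) (by simp only [List.prod_append]; omega)
    rcases lt_or_ge j ω.length with hjl | hjl
    · rw [List.eraseIdx_append_of_lt_length hjl, List.prod_append, List.prod_append] at he
      have e : (ω.eraseIdx j).prod = ω.prod * (ω'.prod * s * ω'.prod⁻¹) := by
        rw [← mul_assoc, ← mul_assoc, he]; group
      have h2 := hu _ (mul_mem hv (inv_mem hv'))
      rw [← e] at h2
      have h3 := length_prod_le (cs := cs) (ω := ω.eraseIdx j)
        fun x hx => hω x (List.mem_of_mem_eraseIdx hx)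
      rw [List.length_eraseIdx_of_lt hjl] at h3
      omega
    · rw [List.eraseIdx_append_of_length_le hjl, List.prod_append, List.prod_append, mul_assoc]
        at he
      have e := mul_left_cancel he
      have h3 := length_prod_le (cs := cs) (ω := ω'.eraseIdx (j - ω.length))
        fun x hx => hI (hω' x (List.mem_of_mem_eraseIdx hx))
      rw [← e, List.length_eraseIdx_of_lt (by simp at hj; omega)] at h3
      omega

theorem exists_min_factor {cs : CoxeterSystem M W} {I : Finset W} (w : W) :
    ∃ u, ∃ v ∈ Par I, w = u * v ∧ ∀ v ∈ Par I, cs.length u ≤ cs.length (u * v) := by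
  obtain ⟨v, hv, hmin⟩ := Finset.exists_min_image (Finset.univ.filter fun v => v ∈ Par I)
    (fun v => cs.length (w * v)) ⟨1, by simp [one_mem]⟩
  refine ⟨w * v, v⁻¹, inv_mem (by simpa using hv), by simp, fun x hx => ?_⟩
  rw [mul_assoc]
  exact hmin _ (by simpa using mul_mem (by simpa using hv) hx)

theorem RMin.min {cs : CoxeterSystem M W} {I : Finset W} (hI : I ⊆ Simples cs) {u : W}
    (hu : RMin cs I u) : ∀ v ∈ Par I, cs.length u ≤ cs.length (u * v) := by
  obtain ⟨u0, v, hv, rfl, h0⟩ := exists_min_factor (cs := cs) (I := I) u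
  by_cases h1 : v = 1
  · subst h1; simpa using h0
  · exfalso
    obtain ⟨v', hv', s, hs, rfl, hl⟩ := exists_right_factor hI hv h1
    have := hu s hs
    rw [← mul_assoc, mul_assoc _ s s, mul_self_of_mem (hI hs), mul_one, mul_assoc,
      length_mul_of_min hI h0 hv, length_mul_of_min hI h0 hv'] at this
    omega

theorem RMin.length_mul {cs : CoxeterSystem M W} {I : Finset W} (hI : I ⊆ Simples cs) {u : W}
    (hu : RMin cs I u) {v : W} (hv : v ∈ Par I) :
    cs.length (u * v) = cs.length u + cs.length v :=
  length_mul_of_min hI (hu.min hI) hv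

theorem exists_RMin {cs : CoxeterSystem M W} {I : Finset W} (hI : I ⊆ Simples cs) (w : W) :
    ∃ u, ∃ v ∈ Par I, w = u * v ∧ RMin cs I u := by
  obtain ⟨u0, v, hv, rfl, h0⟩ := exists_min_factor (cs := cs) (I := I) w
  refine ⟨u0, v, hv, rfl, fun s hs => ?_⟩
  rw [length_mul_of_min hI h0 (mem_Par hs), length_of_mem (hI hs)]
  omega

theorem RMin.eq_one {cs : CoxeterSystem M W} {I : Finset W} (hI : I ⊆ Simples cs) {u : W}
    (hu : RMin cs I u) (h : u ∈ Par I) : u = 1 := by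
  have := hu.length_mul hI (inv_mem h)
  rw [mul_inv_cancel, cs.length_one] at this
  exact cs.length_eq_zero_iff.1 (by omega)

theorem RMin.unique {cs : CoxeterSystem M W} {I : Finset W} (hI : I ⊆ Simples cs) {u u' v v' : W}
    (hu : RMin cs I u) (hu' : RMin cs I u') (hv : v ∈ Par I) (hv' : v' ∈ Par I)
    (h : u * v = u' * v') : u = u' ∧ v = v' := by
  have e : u = u' * (v' * v⁻¹) := by rw [← mul_assoc, ← h]; group
  have e' : u' = u * (v * v'⁻¹) := by rw [← mul_assoc, h]; group
  have h1 := hu'.length_mul hI (mul_mem hv' (inv_mem hv))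
  have h2 := hu.length_mul hI (mul_mem hv (inv_mem hv'))
  rw [← e] at h1
  rw [← e'] at h2
  have h3 : v' * v⁻¹ = 1 := cs.length_eq_zero_iff.1 (by omega)
  have h4 : u = u' := by rw [e, h3, mul_one]
  exact ⟨h4, (mul_inv_eq_one.1 h3).symm⟩

theorem LMin_iff_inv {cs : CoxeterSystem M W} {I : Finset W} (hI : I ⊆ Simples cs) {u : W} :
    LMin cs I u ↔ RMin cs I u⁻¹ := by
  refine forall₂_congr fun s hs => ?_
  rw [← cs.length_inv (s * u), mul_inv_rev, inv_of_mem (hI hs), cs.length_inv u]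

theorem LMin.length_mul {cs : CoxeterSystem M W} {I : Finset W} (hI : I ⊆ Simples cs) {u : W}
    (hu : LMin cs I u) {v : W} (hv : v ∈ Par I) :
    cs.length (v * u) = cs.length v + cs.length u := by
  have := ((LMin_iff_inv hI).1 hu).length_mul hI (inv_mem hv)
  rw [← mul_inv_rev, cs.length_inv, cs.length_inv, cs.length_inv] at this
  omega

theorem exists_LMin {cs : CoxeterSystem M W} {I : Finset W} (hI : I ⊆ Simples cs) (w : W) :
    ∃ u, ∃ v ∈ Par I, w = v * u ∧ LMin cs I u := by
  obtain ⟨u, v, hv, h, hu⟩ := exists_RMin hI w⁻¹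
  exact ⟨u⁻¹, v⁻¹, inv_mem hv, by rw [← mul_inv_rev, ← h, inv_inv],
    (LMin_iff_inv hI).2 (by simpa)⟩

theorem LMin.unique {cs : CoxeterSystem M W} {I : Finset W} (hI : I ⊆ Simples cs) {u u' v v' : W}
    (hu : LMin cs I u) (hu' : LMin cs I u') (hv : v ∈ Par I) (hv' : v' ∈ Par I)
    (h : v * u = v' * u') : v = v' ∧ u = u' := by
  have := ((LMin_iff_inv hI).1 hu).unique hI ((LMin_iff_inv hI).1 hu') (inv_mem hv) (inv_mem hv')
    (by rw [← mul_inv_rev, h, mul_inv_rev])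
  exact ⟨inv_injective this.2, inv_injective this.1⟩

/-- The only simple reflections in `W_J` are the elements of `J`. -/
theorem mem_of_mem_Par {cs : CoxeterSystem M W} {J : Finset W} (hJ : J ⊆ Simples cs) {s : W}
    (hs : s ∈ Simples cs) (h : s ∈ Par J) : s ∈ J := by
  have h1 : s ≠ 1 := by
    rintro rfl
    simpa using length_of_mem hs
  obtain ⟨v', hv', t, ht, rfl, hl⟩ := exists_right_factor hJ h h1
  rw [length_of_mem hs] at hl
  have : v' = 1 := cs.length_eq_zero_iff.1 (by omega)
  simpa [this] using ht

theorem mem_Par_of_length {cs : CoxeterSystem M W} {J : Finset W} (hJ : J ⊆ Simples cs) {s : W}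
    (h : s ∈ Par J) (hl : cs.length s = 1) : s ∈ J :=
  mem_of_mem_Par hJ (mem_Simples_of_length hl) h

/-! ### Parabolic subgroups and the reflection cocycle -/

theorem eq_of_refl01_mem {cs : CoxeterSystem M W} {s r : W} (hs : s ∈ Simples cs)
    (h : refl01 cs s r = 1) : r = s := by
  have h1 := length_lt_of_refl01 h
  rw [length_of_mem hs] at h1
  have h2 : s * r = 1 := cs.length_eq_zero_iff.1 (by omega)
  rw [← inv_of_mem hs]
  exact (inv_eq_of_mul_eq_one_right h2).symm

theorem refl01_mem_self {cs : CoxeterSystem M W} {s : W} (hs : s ∈ Simples cs) :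
    refl01 cs s s = 1 := refl01_self (isReflection_of_mem hs)

/-- All inversions of an element of `W_J` lie in `W_J`. -/
theorem mem_Par_of_refl01 {cs : CoxeterSystem M W} {J : Finset W} (hJ : J ⊆ Simples cs) {a r : W}
    (ha : a ∈ Par J) (h : refl01 cs a r = 1) : r ∈ Par J := by
  have key : ∀ a s, (∀ r, refl01 cs a r = 1 → r ∈ Par J) → s ∈ J →
      ∀ r, refl01 cs (a * s) r = 1 → r ∈ Par J := by
    intro a s ih hs r hr
    rw [refl01_mul] at hr
    rcases zmod2_cases (refl01 cs s r) with h0 | h0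
    · rw [h0, zero_add] at hr
      have h2 := mul_mem (mul_mem (inv_mem (mem_Par hs)) (ih _ hr)) (mem_Par hs)
      have e : s⁻¹ * (s * r * s⁻¹) * s = r := by group
      rwa [e] at h2
    · rw [eq_of_refl01_mem (hJ hs) h0]
      exact mem_Par hs
  refine Subgroup.closure_induction_right (p := fun a _ => ∀ r, refl01 cs a r = 1 → r ∈ Par J)
    ?_ ?_ ?_ ha r h
  · intro r hr
    simp [refl01_one] at hr
  · exact fun v _ s hs ih => key v s ih hs
  · intro v _ s hs ih
    rw [inv_of_mem (hJ hs)]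
    exact key v s ih hs

theorem refl01_eq_zero_of_not_mem {cs : CoxeterSystem M W} {J : Finset W} (hJ : J ⊆ Simples cs)
    {a r : W} (ha : a ∈ Par J) (h : r ∉ Par J) : refl01 cs a r = 0 :=
  (zmod2_cases _).resolve_right fun h1 => h (mem_Par_of_refl01 hJ ha h1)

theorem RMin.refl01_eq_zero {cs : CoxeterSystem M W} {K : Finset W} (hK : K ⊆ Simples cs) {d r : W}
    (hd : RMin cs K d) (hr : cs.IsReflection r) (h : r ∈ Par K) : refl01 cs d r = 0 := by
  rw [refl01_eq_zero_iff hr, hd.length_mul hK h]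
  have : r ≠ 1 := by
    rintro rfl
    simpa using hr.odd_length
  have : cs.length r ≠ 0 := fun h0 => this (cs.length_eq_zero_iff.1 h0)
  omega

theorem RMin_iff {cs : CoxeterSystem M W} {K : Finset W} (hK : K ⊆ Simples cs) {w : W} :
    RMin cs K w ↔ ∀ s ∈ K, refl01 cs w s = 0 :=
  forall₂_congr fun _ hs => (refl01_eq_zero_iff (isReflection_of_mem (hK hs))).symm

theorem LMin_iff {cs : CoxeterSystem M W} {K : Finset W} (hK : K ⊆ Simples cs) {w : W} :
    LMin cs K w ↔ ∀ s ∈ K, refl01 cs w⁻¹ s = 0 := by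
  rw [LMin_iff_inv hK, RMin_iff hK]

theorem Par_Simples (cs : CoxeterSystem M W) (w : W) : w ∈ Par (Simples cs) := by
  obtain ⟨ω, h, rfl, -⟩ := exists_reduced_univ cs w
  exact prod_mem_Par h

theorem isReflection_conj {cs : CoxeterSystem M W} {t : W} (ht : cs.IsReflection t) (w : W) :
    cs.IsReflection (w * t * w⁻¹) := ht.conj w

/-- If `d t d⁻¹ ∈ W_J` for a minimal `d` then `d t d⁻¹ ∈ J`. -/
theorem conj_mem_of_mem_Par {cs : CoxeterSystem M W} {J : Finset W} (hJ : J ⊆ Simples cs) {d t : W}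
    (hd : LMin cs J d) (ht : t ∈ Simples cs) (h : d * t * d⁻¹ ∈ Par J) : d * t * d⁻¹ ∈ J := by
  apply mem_Par_of_length hJ h
  have h1 := hd.length_mul hJ h
  rw [inv_mul_cancel_right] at h1
  have h2 := length_mul_mem ht d
  omega

theorem refl01_eq_zero_of_conj_mem_Par {cs : CoxeterSystem M W} {J : Finset W}
    (hJ : J ⊆ Simples cs) {d t : W}
    (hd : LMin cs J d) (ht : t ∈ Simples cs) (h : d * t * d⁻¹ ∈ Par J) : refl01 cs d t = 0 := by
  rw [refl01_eq_zero_iff (isReflection_of_mem ht)]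
  have h1 := hd.length_mul hJ h
  rw [inv_mul_cancel_right] at h1
  have h2 := length_mul_mem ht d
  omega

/-- Kilmoyer's theorem: `W_K ∩ d⁻¹ W_J d` is a standard parabolic subgroup for `d` a minimal
double coset representative. -/
theorem kilmoyer {cs : CoxeterSystem M W} {J K : Finset W} (hJ : J ⊆ Simples cs)
    (hK : K ⊆ Simples cs) {d : W} (hdJ : LMin cs J d) (hdK : RMin cs K d) {b : W} (hb : b ∈ Par K)
    (h : d * b * d⁻¹ ∈ Par J) : b ∈ Par (K.filter fun t => d * t * d⁻¹ ∈ J) := by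
  induction hn : cs.length b using Nat.strong_induction_on generalizing b with
  | _ n ih =>
  by_cases h1 : b = 1
  · rw [h1]; exact one_mem _
  obtain ⟨b', hb', t, ht, rfl, hl⟩ := exists_left_factor hK hb h1
  have htS := hK ht
  have h2 : refl01 cs (t * b')⁻¹ t = 1 := by
    rw [refl01_eq_one_iff (isReflection_of_mem htS), mul_inv_rev, inv_of_mem htS, mul_assoc,
      mul_self_of_mem htS, mul_one, cs.length_inv, ← cs.length_inv (b'⁻¹ * t), mul_inv_rev, inv_inv,
      inv_of_mem htS]
    omega
  have h3 : refl01 cs ((t * b')⁻¹ * d⁻¹) (d * t * d⁻¹) = 1 := by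
    rw [refl01_mul, refl01_inv, (RMin_iff hK).1 hdK t ht, zero_add]
    rw [← h2]; congr 1; group
  have h4 : (t * b')⁻¹ * d⁻¹ = d⁻¹ * (d * (t * b') * d⁻¹)⁻¹ := by group
  have h5 : refl01 cs (d * (t * b') * d⁻¹)⁻¹ (d * t * d⁻¹) = 1 := by
    rw [h4, refl01_mul] at h3
    have e : (d * (t * b') * d⁻¹)⁻¹ * (d * t * d⁻¹) * (d * (t * b') * d⁻¹)⁻¹⁻¹ =
      d * ((t * b')⁻¹ * t * (t * b')⁻¹⁻¹) * d⁻¹ := by group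
    rw [e, refl01_inv, hdK.refl01_eq_zero hK (isReflection_conj (isReflection_of_mem htS) _)
      (mul_mem (mul_mem (inv_mem hb) (mem_Par ht)) (inv_mem (inv_mem hb))), add_zero] at h3
    exact h3
  have h6 := mem_Par_of_refl01 hJ (inv_mem h) h5
  have h7 := conj_mem_of_mem_Par hJ hdJ htS h6
  refine mul_mem (mem_Par (mem_filter.2 ⟨ht, h7⟩)) (ih _ (by omega) hb' ?_ rfl)
  have e : d * b' * d⁻¹ = (d * t * d⁻¹)⁻¹ * (d * (t * b') * d⁻¹) := by group
  rw [e]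
  exact mul_mem (inv_mem h6) h

/-- `W^I = W^K ⬝ (W_K ∩ W^I)`. -/
theorem RMin_mul_iff {cs : CoxeterSystem M W} {I K : Finset W} (hK : K ⊆ Simples cs)
    (hI : I ⊆ K) {u d : W} (hu : RMin cs K u) (hd : d ∈ Par K) :
    RMin cs I (u * d) ↔ RMin cs I d := by
  rw [RMin_iff (hI.trans hK), RMin_iff (hI.trans hK)]
  refine forall₂_congr fun s hs => ?_
  rw [refl01_mul, hu.refl01_eq_zero hK (isReflection_conj (isReflection_of_mem (hK (hI hs))) _)
    (mul_mem (mul_mem hd (mem_Par (hI hs))) (inv_mem hd)), add_zero]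

/-- Mackey decomposition of `W^K`. -/
theorem RMin_mackey {cs : CoxeterSystem M W} {J K : Finset W} (hJ : J ⊆ Simples cs)
    (hK : K ⊆ Simples cs) {a d : W} (ha : a ∈ Par J) (hd : LMin cs J d) :
    RMin cs K (a * d) ↔ RMin cs K d ∧ RMin cs (J.filter fun s => d⁻¹ * s * d ∈ K) a := by
  rw [RMin_iff hK, RMin_iff hK, RMin_iff ((filter_subset _ _).trans hJ)]
  have hc : ∀ s, d * (d⁻¹ * s * d) * d⁻¹ = s := fun s => by group
  constructor
  · intro h
    have h1 : ∀ t ∈ K, refl01 cs d t = 0 ∧ refl01 cs a (d * t * d⁻¹) = 0 := by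
      intro t ht
      have := h t ht
      rw [refl01_mul] at this
      rcases zmod2_cases (refl01 cs a (d * t * d⁻¹)) with h0 | h0
      · rw [h0] at this ⊢
        simpa using this
      · have h2 := mem_Par_of_refl01 hJ ha h0
        rw [h0, refl01_eq_zero_of_conj_mem_Par hJ hd (hK ht) h2] at this
        simp at this
    refine ⟨fun t ht => (h1 t ht).1, fun s hs => ?_⟩
    have := (h1 _ (mem_filter.1 hs).2).2
    rwa [hc] at this
  · rintro ⟨h1, h2⟩ t ht
    rw [refl01_mul, h1 t ht, zero_add]
    refine (zmod2_cases _).resolve_right fun h0 => ?_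
    have h3 := conj_mem_of_mem_Par hJ hd (hK ht) (mem_Par_of_refl01 hJ ha h0)
    have h4 := h2 _ (mem_filter.2 ⟨h3, by
      have e : d⁻¹ * (d * t * d⁻¹) * d = t := by group
      rwa [e]⟩)
    simp [h4] at h0

/-! ### Conjugation taking simple reflections to simple reflections -/

theorem conj_list_prod (x : W) (ω : List W) :
    (ω.map fun s => x * s * x⁻¹).prod = x * ω.prod * x⁻¹ := by
  induction ω with
  | nil => simp
  | cons a ω ih => rw [List.map_cons, List.prod_cons, ih, List.prod_cons]; group

theorem conj_mem_Par {x : W} {L J : Finset W} (h : ∀ s ∈ L, x * s * x⁻¹ ∈ J) {w : W}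
    (hw : w ∈ Par L) : x * w * x⁻¹ ∈ Par J := by
  have : Par L ≤ (Par J).comap (MulAut.conj x).toMonoidHom := by
    rw [Par, Subgroup.closure_le]
    intro s hs
    exact mem_Par (by simpa using h s hs)
  simpa using this hw

theorem length_conj_le {cs : CoxeterSystem M W} {x : W} {L : Finset W} (hL : L ⊆ Simples cs)
    (h : ∀ s ∈ L, x * s * x⁻¹ ∈ Simples cs) {w : W} (hw : w ∈ Par L) :
    cs.length (x * w * x⁻¹) ≤ cs.length w := by
  obtain ⟨ω, hω, rfl, hl⟩ := exists_reduced hL hw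
  rw [← conj_list_prod, ← hl]
  have := length_prod_le (cs := cs) (ω := ω.map fun s => x * s * x⁻¹) (by
    intro y hy
    obtain ⟨s, hs, rfl⟩ := List.mem_map.1 hy
    exact h s (hω s hs))
  simpa using this

theorem length_conj {cs : CoxeterSystem M W} {x : W} {L : Finset W} (hL : L ⊆ Simples cs)
    (h : ∀ s ∈ L, x * s * x⁻¹ ∈ Simples cs) {w : W} (hw : w ∈ Par L) :
    cs.length (x * w * x⁻¹) = cs.length w := by
  refine le_antisymm (length_conj_le hL h hw) ?_
  have h1 : ∀ s ∈ conjF x L, x⁻¹ * s * x⁻¹⁻¹ ∈ Simples cs := by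
    intro s hs
    obtain ⟨t, ht, rfl⟩ := mem_image.1 hs
    have e : x⁻¹ * (x * t * x⁻¹) * x⁻¹⁻¹ = t := by group
    rw [e]; exact hL ht
  have := length_conj_le (cs := cs) (x := x⁻¹) (L := conjF x L) (w := x * w * x⁻¹) (by
    intro s hs
    obtain ⟨t, ht, rfl⟩ := mem_image.1 hs
    exact h t ht) h1 (conj_mem_Par (fun s hs => mem_image_of_mem _ hs) hw)
  have e : x⁻¹ * (x * w * x⁻¹) * x⁻¹⁻¹ = w := by group
  rwa [e] at this

theorem refl01_conj {cs : CoxeterSystem M W} {x : W} {L : Finset W} (hL : L ⊆ Simples cs)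
    (h : ∀ s ∈ L, x * s * x⁻¹ ∈ Simples cs) {w s : W} (hw : w ∈ Par L) (hs : s ∈ L) :
    refl01 cs (x * w * x⁻¹) (x * s * x⁻¹) = refl01 cs w s := by
  have h1 := refl01_eq_zero_iff (w := x * w * x⁻¹) (isReflection_of_mem (h s hs))
  have e : x * w * x⁻¹ * (x * s * x⁻¹) = x * (w * s) * x⁻¹ := by group
  rw [e, length_conj hL h hw, length_conj hL h (mul_mem hw (mem_Par hs)),
    ← refl01_eq_zero_iff (isReflection_of_mem (hL hs))] at h1
  rcases zmod2_cases (refl01 cs w s) with h0 | h0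
  · rw [h0] at h1 ⊢; simpa using h1
  · rw [h0] at h1 ⊢; exact (zmod2_cases _).resolve_left (by simpa using h1)

/-! ### Longest elements -/

theorem exists_longest {cs : CoxeterSystem M W} {K : Finset W} (hK : K ⊆ Simples cs) :
    ∃ w ∈ Par K, (∀ r ∈ Par K, cs.IsReflection r → refl01 cs w r = 1) ∧
      ∀ r, r ∉ Par K → refl01 cs w r = 0 := by
  obtain ⟨w, hw, hmax⟩ := Finset.exists_max_image (Finset.univ.filter fun v => v ∈ Par K)
    (fun v => cs.length v) ⟨1, by simp [one_mem]⟩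
  have hw' : w ∈ Par K := by simpa using hw
  refine ⟨w, hw', fun r hr hrr => ?_, fun r h => refl01_eq_zero_of_not_mem hK hw' h⟩
  have h1 := hmax (w * r) (by simpa using mul_mem hw' hr)
  exact (zmod2_cases _).resolve_left fun h0 => by
    rw [refl01_eq_zero_iff hrr] at h0
    omega

theorem conj_longest_mem {cs : CoxeterSystem M W} {K : Finset W} (hK : K ⊆ Simples cs) {w : W}
    (hw : w ∈ Par K) (h : ∀ r ∈ Par K, cs.IsReflection r → refl01 cs w r = 1) {s : W}
    (hs : s ∈ K) : w * s * w⁻¹ ∈ K := by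
  have key : ∀ v, v ∈ Par K → cs.length (w * v) + cs.length v = cs.length w := by
    intro v hv
    induction hn : cs.length v using Nat.strong_induction_on generalizing v with
    | _ n ih =>
    by_cases h1 : v = 1
    · subst h1; simp at hn; simp [← hn]
    obtain ⟨v', hv', t, ht, rfl, hl⟩ := exists_right_factor hK hv h1
    have h2 := ih _ (by omega) v' hv' rfl
    have htr := isReflection_of_mem (hK ht)
    have h3 : refl01 cs v' t = 0 := by rw [refl01_eq_zero_iff htr]; omega
    have h4 : refl01 cs (w * v') t = 1 := by
      rw [refl01_mul, h3, zero_add]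
      exact h _ (mul_mem (mul_mem hv' (mem_Par ht)) (inv_mem hv')) (isReflection_conj htr _)
    rw [refl01_eq_one_iff htr, mul_assoc] at h4
    have h5 := length_mul_mem (hK ht) (w * v')
    rw [mul_assoc] at h5
    omega
  have hsr := isReflection_of_mem (hK hs)
  have h1 := key (s * w⁻¹) (mul_mem (mem_Par hs) (inv_mem hw))
  have h2 : cs.length (s * w⁻¹) = cs.length (w * s) := by
    rw [← cs.length_inv, mul_inv_rev, inv_inv, inv_of_mem (hK hs)]
  have h3 := (refl01_eq_one_iff hsr).1 (h s (mem_Par hs) hsr)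
  have h4 := length_mul_mem (hK hs) w
  rw [← mul_assoc] at h1
  exact mem_Par_of_length hK (mul_mem (mul_mem hw (mem_Par hs)) (inv_mem hw)) (by omega)

/-! ### The elements `x_J` of the group algebra of a parabolic subgroup -/

/-- `∑ w`, over the minimal coset representatives of `W_J` in `W_K`. -/
def X (cs : CoxeterSystem M W) (K J : Finset W) : MonoidAlgebra ℂ W :=
  ∑ w ∈ univ.filter (fun w => w ∈ Par K ∧ RMin cs J w), of ℂ W w

theorem xRel_eq (cs : CoxeterSystem M W) (K : Finset W) :
    xRel cs Set.univ K = X cs (Simples cs) K := by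
  unfold xRel X minCoset
  congr 1
  ext w
  simp [Par_Simples, RMin]

theorem X_self {cs : CoxeterSystem M W} {K : Finset W} (hK : K ⊆ Simples cs) : X cs K K = 1 := by
  have : univ.filter (fun w => w ∈ Par K ∧ RMin cs K w) = {1} := by
    ext w
    simp only [mem_filter, mem_univ, true_and, mem_singleton]
    refine ⟨fun h => h.2.eq_one hK h.1, ?_⟩
    rintro rfl
    exact ⟨one_mem _, (RMin_iff hK).2 fun s _ => refl01_one cs s⟩
  rw [X, this, sum_singleton, map_one]

theorem X_mul {cs : CoxeterSystem M W} {D K J : Finset W} (hD : D ⊆ Simples cs) (hK : K ⊆ D)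
    (hJ : J ⊆ K) : X cs D K * X cs K J = X cs D J := by
  have hKS := hK.trans hD
  rw [X, X, X, sum_mul_sum, ← sum_product']
  refine sum_bij (fun z _ => z.1 * z.2) ?_ ?_ ?_ ?_
  · rintro ⟨u, v⟩ h
    simp only [mem_product, mem_filter, mem_univ, true_and] at h ⊢
    exact ⟨mul_mem h.1.1 (Par_mono hK h.2.1), (RMin_mul_iff hKS hJ h.1.2 h.2.1).2 h.2.2⟩
  · rintro ⟨u, v⟩ h ⟨u', v'⟩ h' e
    simp only [mem_product, mem_filter, mem_univ, true_and] at h h'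
    have := h.1.2.unique hKS h'.1.2 h.2.1 h'.2.1 e
    rw [this.1, this.2]
  · intro w h
    simp only [mem_filter, mem_univ, true_and] at h
    obtain ⟨u, v, hv, rfl, hu⟩ := exists_RMin hKS w
    refine ⟨(u, v), ?_, rfl⟩
    simp only [mem_product, mem_filter, mem_univ, true_and]
    refine ⟨⟨?_, hu⟩, hv, (RMin_mul_iff hKS hJ hu hv).1 h.2⟩
    simpa using mul_mem h.1 (inv_mem (Par_mono hK hv))
  · rintro ⟨u, v⟩ h
    simp

theorem RMin_mul_conj_iff {cs : CoxeterSystem M W} {I : Finset W} {w : W}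
    (hI : I ⊆ Simples cs) (hJ : conjF w I ⊆ Simples cs) (hw : RMin cs I w) (v : W) :
    RMin cs I (v * w) ↔ RMin cs (conjF w I) v := by
  rw [RMin_iff hI, RMin_iff hJ, conjF, forall_mem_image]
  refine forall₂_congr fun s hs => ?_
  rw [refl01_mul, (RMin_iff hI).1 hw s hs, zero_add]

theorem X_mul_of {cs : CoxeterSystem M W} {D I : Finset W} {w : W} (hD : D ⊆ Simples cs)
    (hI : I ⊆ Simples cs) (hJ : conjF w I ⊆ D) (hwD : w ∈ Par D) (hw : RMin cs I w) :
    X cs D (conjF w I) * of ℂ W w = X cs D I := by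
  rw [X, X, sum_mul]
  refine sum_bij (fun z _ => z * w) ?_ ?_ ?_ ?_
  · intro v h
    simp only [mem_filter, mem_univ, true_and] at h ⊢
    exact ⟨mul_mem h.1 hwD, (RMin_mul_conj_iff hI (hJ.trans hD) hw v).2 h.2⟩
  · intro v _ v' _ e
    simpa using e
  · intro v h
    simp only [mem_filter, mem_univ, true_and] at h
    refine ⟨v * w⁻¹, ?_, by simp⟩
    simp only [mem_filter, mem_univ, true_and]
    refine ⟨mul_mem h.1 (inv_mem hwD), ?_⟩
    rw [← RMin_mul_conj_iff hI (hJ.trans hD) hw]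
    simpa using h.2
  · intro v _
    simp

theorem conjF_conjF_inv (w : W) (I : Finset W) : conjF w⁻¹ (conjF w I) = I := by
  ext s
  simp only [conjF, mem_image]
  constructor
  · rintro ⟨_, ⟨t, ht, rfl⟩, rfl⟩
    convert ht using 1; group
  · intro h
    exact ⟨_, ⟨s, h, rfl⟩, by group⟩

theorem conjF_inv_conjF (w : W) (I : Finset W) : conjF w (conjF w⁻¹ I) = I := by
  simpa using conjF_conjF_inv w⁻¹ I

theorem card_conjF (w : W) (I : Finset W) : (conjF w I).card = I.card := by
  apply card_image_of_injective
  intro s t h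
  simpa using h

theorem conjF_mono (w : W) {I K : Finset W} (h : I ⊆ K) : conjF w I ⊆ conjF w K :=
  image_subset_image h

theorem mem_conjF_self {w s : W} {I : Finset W} : w * s * w⁻¹ ∈ conjF w I ↔ s ∈ I := by
  simp [conjF]

theorem mem_conjF {w t : W} {I : Finset W} : t ∈ conjF w I ↔ w⁻¹ * t * w ∈ I := by
  rw [← mem_conjF_self (w := w) (s := w⁻¹ * t * w)]
  have e : w * (w⁻¹ * t * w) * w⁻¹ = t := by group
  rw [e]

theorem conj_mem_Par_iff {w v : W} {I : Finset W} :
    w * v * w⁻¹ ∈ Par (conjF w I) ↔ v ∈ Par I := by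
  refine ⟨fun h => ?_, conj_mem_Par fun s hs => mem_conjF_self.2 hs⟩
  have := conj_mem_Par (x := w⁻¹) (J := I) (fun s hs => by
    rw [inv_inv]; exact mem_conjF.1 hs) h
  have e : w⁻¹ * (w * v * w⁻¹) * w⁻¹⁻¹ = v := by group
  rwa [e] at this

theorem of_mul_X {cs : CoxeterSystem M W} {I K : Finset W} {w : W} (hI : I ⊆ Simples cs)
    (hJ : conjF w I ⊆ Simples cs) (hK : K ⊆ I) :
    of ℂ W w * X cs I K = X cs (conjF w I) (conjF w K) * of ℂ W w := by
  rw [X, X, sum_mul, mul_sum]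
  have hc : ∀ s ∈ I, w * s * w⁻¹ ∈ Simples cs := fun s hs => hJ (mem_conjF_self.2 hs)
  have key : ∀ v ∈ Par I, (RMin cs (conjF w K) (w * v * w⁻¹) ↔ RMin cs K v) := by
    intro v hv
    rw [RMin_iff ((conjF_mono w hK).trans hJ), RMin_iff (hK.trans hI), conjF, forall_mem_image]
    exact forall₂_congr fun s hs => by rw [refl01_conj hI hc hv (hK hs)]
  refine sum_bij (fun v _ => w * v * w⁻¹) ?_ ?_ ?_ ?_
  · intro v h
    simp only [mem_filter, mem_univ, true_and] at h ⊢
    exact ⟨conj_mem_Par_iff.2 h.1, (key v h.1).2 h.2⟩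
  · intro v _ v' _ e
    simpa using e
  · intro v h
    simp only [mem_filter, mem_univ, true_and] at h
    have e : w * (w⁻¹ * v * w) * w⁻¹ = v := by group
    refine ⟨w⁻¹ * v * w, ?_, e⟩
    have h1 : w⁻¹ * v * w ∈ Par I := by
      rw [← conj_mem_Par_iff (w := w), e]; exact h.1
    simp only [mem_filter, mem_univ, true_and]
    exact ⟨h1, (key _ h1).1 (by rw [e]; exact h.2)⟩
  · intro v _
    simp [← map_mul, -of_apply]

/-- Minimal double coset representatives of `W_J`, `W_K` in `W_D`. -/
def DC (cs : CoxeterSystem M W) (D J K : Finset W) : Finset W :=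
  univ.filter fun d => d ∈ Par D ∧ LMin cs J d ∧ RMin cs K d

theorem X_mackey {cs : CoxeterSystem M W} {D J K : Finset W} (hD : D ⊆ Simples cs) (hJ : J ⊆ D)
    (hK : K ⊆ D) :
    X cs D K = ∑ d ∈ DC cs D J K, X cs J (J.filter fun s => d⁻¹ * s * d ∈ K) * of ℂ W d := by
  have hJS := hJ.trans hD
  have hKS := hK.trans hD
  simp only [X, sum_mul]
  rw [sum_sigma']
  symm
  refine sum_bij (fun z _ => z.2 * z.1) ?_ ?_ ?_ ?_
  · rintro ⟨d, a⟩ h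
    simp only [mem_sigma, DC, mem_filter, mem_univ, true_and] at h ⊢
    exact ⟨mul_mem (Par_mono hJ h.2.1) h.1.1, (RMin_mackey hJS hKS h.2.1 h.1.2.1).2
      ⟨h.1.2.2, h.2.2⟩⟩
  · rintro ⟨d, a⟩ h ⟨d', a'⟩ h' e
    simp only [mem_sigma, DC, mem_filter, mem_univ, true_and] at h h'
    have := h.1.2.1.unique hJS h'.1.2.1 h.2.1 h'.2.1 e
    rw [this.1, this.2]
  · intro w h
    simp only [mem_filter, mem_univ, true_and] at h
    obtain ⟨d, a, ha, rfl, hd⟩ := exists_LMin hJS w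
    have := (RMin_mackey hJS hKS ha hd).1 h.2
    refine ⟨⟨d, a⟩, ?_, rfl⟩
    simp only [mem_sigma, DC, mem_filter, mem_univ, true_and]
    refine ⟨⟨?_, hd, this.1⟩, ha, this.2⟩
    simpa using mul_mem (inv_mem (Par_mono hJ ha)) h.1
  · rintro ⟨d, a⟩ _
    simp

theorem filter_conj_eq (J K : Finset W) (d : W) :
    (J.filter fun s => d⁻¹ * s * d ∈ K) = conjF d (K.filter fun t => d * t * d⁻¹ ∈ J) := by
  ext s
  rw [mem_conjF, mem_filter, mem_filter]
  have e : d * (d⁻¹ * s * d) * d⁻¹ = s := by group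
  rw [e, and_comm]

theorem RMin.mono {cs : CoxeterSystem M W} {I K : Finset W} {w : W} (h : RMin cs K w)
    (hI : I ⊆ K) : RMin cs I w := fun s hs => h s (hI hs)

/-- Solomon's product formula. -/
theorem X_mul_X {cs : CoxeterSystem M W} {D J K : Finset W} (hD : D ⊆ Simples cs) (hJ : J ⊆ D)
    (hK : K ⊆ D) :
    X cs D J * X cs D K = ∑ d ∈ DC cs D J K, X cs D (K.filter fun t => d * t * d⁻¹ ∈ J) := by
  rw [X_mackey hD hJ hK, mul_sum]
  refine sum_congr rfl fun d hd => ?_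
  simp only [DC, mem_filter, mem_univ, true_and] at hd
  have h1 : (J.filter fun s => d⁻¹ * s * d ∈ K) ⊆ J := filter_subset _ _
  rw [← mul_assoc, X_mul hD hJ h1, filter_conj_eq]
  rw [filter_conj_eq] at h1
  exact X_mul_of hD ((filter_subset _ _).trans (hK.trans hD)) (h1.trans hJ) hd.1
    (hd.2.2.mono (filter_subset _ _))

/-! ### The quasi-idempotents -/

/-- The coefficient `m_{JK}` for `σ = 1`. -/
def mS (cs : CoxeterSystem M W) (J K : Finset W) : ℂ :=
  (univ.filter fun w => RMin cs K w ∧ ∀ s ∈ J, w * s * w⁻¹ ∈ Simples cs).card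

theorem mC_eq {cs : CoxeterSystem M W} {J K : Finset W} (hJ : J ⊆ K) (hK : K ⊆ Simples cs) :
    (mC cs Set.univ (Simples cs) (fun _ => (1 : ℝ)) J K : ℂ) = mS cs J K := by
  rw [mC, if_pos hJ, mS, sum_const, nsmul_one, minCoset, filter_filter, Complex.ofReal_natCast]
  congr 2
  ext w
  simp only [mem_filter, mem_univ, true_and, Set.mem_univ]
  simp only [Takes, RMin]
  refine and_congr_right fun h => forall₂_congr fun s hs => ?_
  rw [and_iff_left_iff_imp]
  intro _
  have := h s (hJ hs)
  have := length_mul_mem (hK (hJ hs)) w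
  omega

theorem mS_self_ne_zero {cs : CoxeterSystem M W} {K : Finset W} (hK : K ⊆ Simples cs) :
    mS cs K K ≠ 0 := by
  rw [mS, Nat.cast_ne_zero, ← Nat.pos_iff_ne_zero, card_pos]
  refine ⟨1, ?_⟩
  simp only [mem_filter, mem_univ, true_and]
  exact ⟨(RMin_iff hK).2 fun s _ => refl01_one cs s, fun s hs => by simpa using hK hs⟩

theorem conj_mem_of_RMin {cs : CoxeterSystem M W} {K : Finset W} (hK : K ⊆ Simples cs) {u t : W}
    (hu : RMin cs K u) (ht : t ∈ Par K) (h : u * t * u⁻¹ ∈ Simples cs) : t ∈ K := by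
  have h1 := hu.length_mul hK ht
  have h2 := length_mem_mul h u
  rw [inv_mul_cancel_right] at h2
  have h3 : cs.length t ≠ 0 := by
    intro h0
    have := cs.length_eq_zero_iff.1 h0
    subst this
    have := length_of_mem h
    simp at this
  exact mem_Par_of_length hK ht (by omega)

theorem mS_factor {cs : CoxeterSystem M W} {J I K : Finset W} (hK : K ⊆ Simples cs) (hI : I ⊆ K)
    (hJ : J ⊆ I) :
    mS cs J I = ∑ d ∈ univ.filter (fun d => d ∈ Par K ∧ RMin cs I d ∧ ∀ s ∈ J, d * s * d⁻¹ ∈ K),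
      mS cs (conjF d J) K := by
  simp only [mS]
  rw [← Nat.cast_sum, ← card_sigma]
  congr 1
  symm
  refine card_bij (fun z _ => z.2 * z.1) ?_ ?_ ?_
  · rintro ⟨d, u⟩ h
    simp only [mem_sigma, mem_filter, mem_univ, true_and] at h ⊢
    refine ⟨(RMin_mul_iff hK hI h.2.1 h.1.1).2 h.1.2.1, fun s hs => ?_⟩
    have := h.2.2 (d * s * d⁻¹) (mem_conjF_self.2 hs)
    convert this using 1; group
  · rintro ⟨d, u⟩ h ⟨d', u'⟩ h' e
    simp only [mem_sigma, mem_filter, mem_univ, true_and] at h h'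
    have := h.2.1.unique hK h'.2.1 h.1.1 h'.1.1 e
    rw [this.1, this.2]
  · intro w h
    simp only [mem_filter, mem_univ, true_and] at h
    obtain ⟨u, d, hd, rfl, hu⟩ := exists_RMin hK w
    have h2 : ∀ s ∈ J, u * (d * s * d⁻¹) * u⁻¹ ∈ Simples cs := by
      intro s hs
      convert h.2 s hs using 1; group
    refine ⟨⟨d, u⟩, ?_, rfl⟩
    simp only [mem_sigma, mem_filter, mem_univ, true_and]
    refine ⟨⟨hd, (RMin_mul_iff hK hI hu hd).1 h.1, fun s hs => ?_⟩, hu, ?_⟩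
    · exact conj_mem_of_RMin hK hu
        (mul_mem (mul_mem hd (mem_Par (hI (hJ hs)))) (inv_mem hd)) (h2 s hs)
    · rw [conjF, forall_mem_image]
      exact h2

theorem mS_conjF {cs : CoxeterSystem M W} {J K : Finset W} {w : W} (hK : K ⊆ Simples cs)
    (hK' : conjF w K ⊆ Simples cs) (hw : RMin cs K w) :
    mS cs (conjF w J) (conjF w K) = mS cs J K := by
  simp only [mS]
  congr 1
  refine card_bij (fun v _ => v * w) ?_ ?_ ?_
  · intro v h
    simp only [mem_filter, mem_univ, true_and] at h ⊢
    refine ⟨(RMin_mul_conj_iff hK hK' hw v).2 h.1, fun s hs => ?_⟩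
    convert h.2 _ (mem_conjF_self.2 hs) using 1; group
  · intro v _ v' _ e
    simpa using e
  · intro v h
    simp only [mem_filter, mem_univ, true_and] at h
    refine ⟨v * w⁻¹, ?_, by simp⟩
    simp only [mem_filter, mem_univ, true_and]
    refine ⟨?_, ?_⟩
    · rw [← RMin_mul_conj_iff hK hK' hw]
      simpa using h.1
    · rw [conjF, forall_mem_image]
      intro s hs
      convert h.2 s hs using 1; group

/-- The element `η_K ∈ ℂ W_K` with `e_K = x_K η_K`. -/
def eta (cs : CoxeterSystem M W) (K : Finset W) : MonoidAlgebra ℂ W :=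
  (mS cs K K)⁻¹ • (1 - ∑ J ∈ K.ssubsets.attach, mS cs J.1 K • (X cs K J.1 * eta cs J.1))
termination_by K.card
decreasing_by exact card_lt_card (mem_ssubsets.1 J.2)

theorem mS_smul_eta {cs : CoxeterSystem M W} {K : Finset W} (hK : K ⊆ Simples cs) :
    mS cs K K • eta cs K = 1 - ∑ J ∈ K.ssubsets, mS cs J K • (X cs K J * eta cs J) := by
  rw [eta, smul_inv_smul₀ (mS_self_ne_zero hK),
    sum_attach K.ssubsets fun J => mS cs J K • (X cs K J * eta cs J)]

theorem sum_powerset_eq (K : Finset W) (f : Finset W → MonoidAlgebra ℂ W) :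
    ∑ J ∈ K.powerset, f J = f K + ∑ J ∈ K.ssubsets, f J := by
  rw [ssubsets, add_sum_erase _ _ (mem_powerset_self K)]

theorem sum_eta {cs : CoxeterSystem M W} {K : Finset W} (hK : K ⊆ Simples cs) :
    ∑ J ∈ K.powerset, mS cs J K • (X cs K J * eta cs J) = 1 := by
  rw [sum_powerset_eq, X_self hK, one_mul, mS_smul_eta hK, sub_add_cancel]

theorem IsBBHT.eq {cs : CoxeterSystem M W} {e : Finset W → MonoidAlgebra ℂ W}
    (he : IsBBHT cs Set.univ (Simples cs) (fun _ => (1 : ℝ)) e) {K : Finset W}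
    (hK : K ⊆ Simples cs) : e K = X cs (Simples cs) K * eta cs K := by
  induction hn : K.card using Nat.strong_induction_on generalizing K with
  | _ n ih =>
  have h1 := he K (mem_powerset.2 hK)
  rw [xRel_eq, sum_congr rfl fun J hJ => by rw [mC_eq (mem_powerset.1 hJ) hK],
    sum_powerset_eq] at h1
  have h2 : ∑ J ∈ K.ssubsets, mS cs J K • e J =
      X cs (Simples cs) K * ∑ J ∈ K.ssubsets, mS cs J K • (X cs K J * eta cs J) := by
    rw [mul_sum]
    refine sum_congr rfl fun J hJ => ?_
    have hJK := mem_ssubsets.1 hJ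
    rw [ih _ (hn ▸ card_lt_card hJK) (hJK.subset.trans hK) rfl, mul_smul_comm, ← mul_assoc,
      X_mul (Subset.refl _) hK hJK.subset]
  have h3 : mS cs K K • e K = mS cs K K • (X cs (Simples cs) K * eta cs K) := by
    rw [← mul_smul_comm, mS_smul_eta hK, mul_sub, mul_one, ← h2, h1, add_sub_cancel_right]
  exact (smul_right_injective _ (mS_self_ne_zero hK)) h3

theorem mul_X_mem_span {cs : CoxeterSystem M W} {D K : Finset W} (hD : D ⊆ Simples cs)
    (hK : K ⊆ D) {P : Finset W → Prop} {y : MonoidAlgebra ℂ W}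
    (hy : y ∈ Submodule.span ℂ {x | ∃ I, I ⊆ K ∧ x = X cs K I}) (hP : ∀ I ⊆ K, P I) :
    X cs D K * y ∈ Submodule.span ℂ {x | ∃ I, P I ∧ x = X cs D I} := by
  induction hy using Submodule.span_induction with
  | mem x hx =>
    obtain ⟨I, hI, rfl⟩ := hx
    rw [X_mul hD hK hI]
    exact Submodule.subset_span ⟨I, hP I hI, rfl⟩
  | zero => rw [mul_zero]; exact zero_mem _
  | add x y _ _ hx hy => rw [mul_add]; exact add_mem hx hy
  | smul a x _ hx => rw [mul_smul_comm]; exact Submodule.smul_mem _ _ hx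

theorem eta_sub_mem_span {cs : CoxeterSystem M W} {K : Finset W} (hK : K ⊆ Simples cs) :
    mS cs K K • eta cs K - 1 ∈ Submodule.span ℂ {x | ∃ I, I ⊂ K ∧ x = X cs K I} := by
  induction hn : K.card using Nat.strong_induction_on generalizing K with
  | _ n ih =>
  rw [mS_smul_eta hK, sub_sub_cancel_left]
  refine neg_mem (sum_mem fun J hJ => Submodule.smul_mem _ _ ?_)
  have hJK := mem_ssubsets.1 hJ
  have hJS := hJK.subset.trans hK
  refine mul_X_mem_span (K := J) hK hJK.subset ?_ fun I hI => lt_of_le_of_lt hI hJK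
  have h1 := ih _ (hn ▸ card_lt_card hJK) hJS rfl
  have h2 : mS cs J J • eta cs J ∈ Submodule.span ℂ {x | ∃ I, I ⊆ J ∧ x = X cs J I} := by
    rw [← sub_add_cancel (mS cs J J • eta cs J) 1]
    refine add_mem (Submodule.span_mono ?_ h1) (Submodule.subset_span ⟨J, Subset.refl _,
      (X_self hJS).symm⟩)
    rintro x ⟨I, hI, rfl⟩
    exact ⟨I, hI.subset, rfl⟩
  have h3 := Submodule.smul_mem _ (mS cs J J)⁻¹ h2
  rwa [inv_smul_smul₀ (mS_self_ne_zero hJS)] at h3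

theorem of_mul_eta {cs : CoxeterSystem M W} {K : Finset W} {w : W} (hK : K ⊆ Simples cs)
    (hK' : conjF w K ⊆ Simples cs) (hw : RMin cs K w) :
    of ℂ W w * eta cs K = eta cs (conjF w K) * of ℂ W w := by
  induction hn : K.card using Nat.strong_induction_on generalizing K with
  | _ n ih =>
  have h3 : ∑ J ∈ (conjF w K).ssubsets, mS cs J (conjF w K) • (X cs (conjF w K) J * eta cs J) =
      ∑ J ∈ K.ssubsets, mS cs J K • (X cs (conjF w K) (conjF w J) * eta cs (conjF w J)) := by
    symm
    refine sum_bij (fun J _ => conjF w J) ?_ ?_ ?_ ?_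
    · intro J hJ
      rw [mem_ssubsets] at hJ ⊢
      rw [ssubset_iff_subset_ne]
      refine ⟨conjF_mono w hJ.subset, fun h => hJ.ne ?_⟩
      rw [← conjF_conjF_inv w J, h, conjF_conjF_inv]
    · intro J _ J' _ h
      rw [← conjF_conjF_inv w J, h, conjF_conjF_inv]
    · intro J hJ
      rw [mem_ssubsets] at hJ
      refine ⟨conjF w⁻¹ J, ?_, conjF_inv_conjF w J⟩
      rw [mem_ssubsets, ssubset_iff_subset_ne]
      refine ⟨?_, fun h => hJ.ne ?_⟩
      · simpa [conjF_conjF_inv] using conjF_mono w⁻¹ hJ.subset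
      · rw [← h, conjF_inv_conjF]
    · intro J _
      rw [mS_conjF hK hK' hw]
  have h4 : mS cs K K • (of ℂ W w * eta cs K) = mS cs K K • (eta cs (conjF w K) * of ℂ W w) := by
    rw [← mul_smul_comm, mS_smul_eta hK, ← smul_mul_assoc, ← mS_conjF hK hK' hw, mS_smul_eta hK',
      h3, mul_sub, sub_mul, mul_sum, sum_mul, mul_one, one_mul]
    congr 1
    refine sum_congr rfl fun J hJ => ?_
    have hJK := mem_ssubsets.1 hJ
    rw [mul_smul_comm, smul_mul_assoc, ← mul_assoc, of_mul_X hK hK' hJK.subset, mul_assoc,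
      mul_assoc, ih _ (hn ▸ card_lt_card hJK) (hJK.subset.trans hK)
        ((conjF_mono w hJK.subset).trans hK') (hw.mono hJK.subset) rfl]
  exact (smul_right_injective _ (mS_self_ne_zero hK)) h4

theorem eta_mul_X_of {cs : CoxeterSystem M W} {D J I : Finset W} (hD : D ⊆ Simples cs)
    (hJ : J ⊆ D) (hI : I ⊆ D) (hann : ∀ I, I ⊂ J → eta cs J * X cs J I = 0) :
    eta cs J * X cs D I =
      ∑ d ∈ univ.filter (fun d => d ∈ Par D ∧ RMin cs I d ∧ conjF d⁻¹ J ⊆ I),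
        eta cs J * of ℂ W d := by
  have hJS := hJ.trans hD
  rw [X_mackey hD hJ hI, mul_sum]
  have h0 : univ.filter (fun d => d ∈ Par D ∧ RMin cs I d ∧ conjF d⁻¹ J ⊆ I) =
      (DC cs D J I).filter fun d => conjF d⁻¹ J ⊆ I := by
    ext d
    simp only [DC, mem_filter, mem_univ, true_and]
    refine ⟨fun h => ⟨⟨h.1, ?_, h.2.1⟩, h.2.2⟩, fun h => ⟨h.1.1, h.1.2.2, h.2⟩⟩
    rw [LMin_iff hJS]
    intro s hs
    have h1 : d⁻¹ * s * d ∈ I := by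
      apply h.2.2
      rw [mem_conjF]
      convert hs using 1; group
    have h2 := refl01_inv cs d (d⁻¹ * s * d)
    have e : d * (d⁻¹ * s * d) * d⁻¹ = s := by group
    rw [e] at h2
    rw [h2]
    exact (RMin_iff (hI.trans hD)).1 h.2.1 _ h1
  rw [h0, sum_filter]
  refine sum_congr rfl fun d _ => ?_
  have h1 : ∀ s, s ∈ conjF d⁻¹ J ↔ d * s * d⁻¹ ∈ J := fun s => by rw [mem_conjF, inv_inv]
  split_ifs with h
  · have : (J.filter fun s => d⁻¹ * s * d ∈ I) = J := by
      rw [filter_eq_self]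
      intro s hs
      apply h
      rw [h1]
      convert hs using 1; group
    rw [this, X_self hJS, one_mul]
  · rw [← mul_assoc, hann, zero_mul]
    rw [filter_ssubset]
    by_contra! hcon
    apply h
    intro s hs
    rw [h1] at hs
    convert hcon _ hs using 1; group

theorem eta_mul_X {cs : CoxeterSystem M W} {K I : Finset W} (hK : K ⊆ Simples cs) (hI : I ⊂ K) :
    eta cs K * X cs K I = 0 := by
  induction hn : K.card using Nat.strong_induction_on generalizing K I with
  | _ n ih =>
  have hIS := hI.subset.trans hK
  have h1 : ∀ J ∈ K.ssubsets, mS cs J K • (X cs K J * eta cs J) * X cs K I =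
      ∑ d ∈ univ.filter (fun d => d ∈ Par K ∧ RMin cs I d ∧ conjF d⁻¹ J ⊆ I),
        mS cs J K • (X cs K (conjF d⁻¹ J) * eta cs (conjF d⁻¹ J)) := by
    intro J hJ
    have hJK := mem_ssubsets.1 hJ
    have hJS := hJK.subset.trans hK
    rw [smul_mul_assoc, mul_assoc, eta_mul_X_of hK hJK.subset hI.subset
      fun I' hI' => ih _ (hn ▸ card_lt_card hJK) hJS hI' rfl, mul_sum, smul_sum]
    refine sum_congr rfl fun d hd => ?_
    simp only [mem_filter, mem_univ, true_and] at hd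
    have hc : conjF d (conjF d⁻¹ J) = J := conjF_inv_conjF d J
    have h2 := of_mul_eta (w := d) (hd.2.2.trans hIS) (by rw [hc]; exact hJS)
      (hd.2.1.mono hd.2.2)
    rw [hc] at h2
    have h3 := X_mul_of (D := K) (w := d) hK (hd.2.2.trans hIS) (by rw [hc]; exact hJK.subset) hd.1
      (hd.2.1.mono hd.2.2)
    rw [hc] at h3
    rw [← h2, ← mul_assoc, h3]
  have h2 : (∑ J ∈ K.ssubsets, mS cs J K • (X cs K J * eta cs J)) * X cs K I = X cs K I := by
    have h3 : ∑ J ∈ I.powerset, mS cs J I • (X cs K J * eta cs J) = X cs K I := by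
      rw [← mul_one (X cs K I), ← sum_eta hIS, mul_sum]
      refine sum_congr rfl fun J hJ => ?_
      rw [mul_smul_comm, ← mul_assoc, X_mul hK hI.subset (mem_powerset.1 hJ)]
    rw [sum_mul, sum_congr rfl h1, ← h3,
      sum_congr (s₁ := I.powerset) rfl fun J hJ => by
        rw [mS_factor hK hI.subset (mem_powerset.1 hJ), sum_smul], sum_sigma', sum_sigma']
    refine sum_bij' (fun z _ => ⟨conjF z.2⁻¹ z.1, z.2⟩) (fun z _ => ⟨conjF z.2 z.1, z.2⟩)
      ?_ ?_ ?_ ?_ ?_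
    · rintro ⟨J, d⟩ h
      simp only [mem_sigma, mem_filter, mem_univ, true_and, mem_ssubsets, mem_powerset] at h ⊢
      refine ⟨h.2.2.2, h.2.1, h.2.2.1, fun s hs => h.1.subset ?_⟩
      rwa [mem_conjF, inv_inv] at hs
    · rintro ⟨J, d⟩ h
      simp only [mem_sigma, mem_filter, mem_univ, true_and, mem_ssubsets, mem_powerset] at h ⊢
      rw [conjF_conjF_inv]
      refine ⟨?_, h.2.1, h.2.2.1, h.1⟩
      rw [ssubset_iff_subset_ne]
      refine ⟨?_, fun hc => ?_⟩
      · intro s hs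
        obtain ⟨t, ht, rfl⟩ := mem_image.1 hs
        exact h.2.2.2 t ht
      · have := card_le_card h.1
        rw [← card_conjF d J, hc] at this
        exact absurd (card_lt_card hI) (by omega)
    · rintro ⟨J, d⟩ h
      simp [conjF_inv_conjF]
    · rintro ⟨J, d⟩ h
      simp [conjF_conjF_inv]
    · rintro ⟨J, d⟩ h
      simp [conjF_inv_conjF]
  have h3 : mS cs K K • (eta cs K * X cs K I) = 0 := by
    rw [← smul_mul_assoc, mS_smul_eta hK, sub_mul, h2, one_mul, sub_self]
  exact (smul_eq_zero.1 h3).resolve_left (mS_self_ne_zero hK)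

/-! ### The right ideal `E_λ` -/

theorem exists_RMin_of_ShapeEq {cs : CoxeterSystem M W} {L J : Finset W} (hL : L ⊆ Simples cs)
    (hJ : J ⊆ Simples cs) (h : ShapeEq L J) : ∃ w, RMin cs L w ∧ conjF w L = J := by
  obtain ⟨w, hw⟩ := h
  have h1 : ∀ v, w * v * w⁻¹ ∈ Par J ↔ v ∈ Par L := by
    intro v
    rw [Par, hw]
    simp [mul_assoc]
  obtain ⟨u, b, hb, rfl, hu⟩ := exists_RMin hL w
  obtain ⟨d, a, ha, rfl, hd⟩ := exists_LMin hJ u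
  have hdL := ((RMin_mackey hJ hL ha hd).1 hu).1
  have h2 : ∀ v, d * v * d⁻¹ ∈ Par J ↔ v ∈ Par L := by
    intro v
    have e : d * v * d⁻¹ = a⁻¹ * (a * d * b * (b⁻¹ * v * b) * (a * d * b)⁻¹) * a := by group
    rw [e, Subgroup.mul_mem_cancel_right _ ha, Subgroup.mul_mem_cancel_left _ (inv_mem ha), h1,
      Subgroup.mul_mem_cancel_right _ hb, Subgroup.mul_mem_cancel_left _ (inv_mem hb)]
  refine ⟨d, hdL, ?_⟩
  ext t
  rw [mem_conjF]
  have e : d * (d⁻¹ * t * d) * d⁻¹ = t := by group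
  constructor
  · intro h
    have := conj_mem_of_mem_Par hJ hd (hL h) ((h2 _).2 (mem_Par h))
    rwa [e] at this
  · intro h
    have h3 : LMin cs L d⁻¹ := by rw [LMin_iff_inv hL, inv_inv]; exact hdL
    have := conj_mem_of_mem_Par hL h3 (hJ h) (by
      rw [← h2, inv_inv, e]; exact mem_Par h)
    rwa [inv_inv] at this

theorem ShapeEq_conjF (w : W) (L : Finset W) : ShapeEq L (conjF w L) := by
  refine ⟨w, ?_⟩
  rw [MonoidHom.map_closure]
  congr 1
  ext x
  simp [conjF]

/-- The idempotent `ε_L ∈ ℂ W_L`. -/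
def eps (cs : CoxeterSystem M W) (L : Finset W) : MonoidAlgebra ℂ W := mS cs L L • eta cs L

/-- The minimal representatives normalizing `L`. -/
def NL (cs : CoxeterSystem M W) (L : Finset W) : Finset W :=
  univ.filter fun n => RMin cs L n ∧ conjF n L = L

theorem mem_NL {cs : CoxeterSystem M W} {L : Finset W} {n : W} :
    n ∈ NL cs L ↔ RMin cs L n ∧ conjF n L = L := by simp [NL]

theorem eps_mul_of_mem_span {cs : CoxeterSystem M W} {L : Finset W} (hL : L ⊆ Simples cs)
    {y : MonoidAlgebra ℂ W} (hy : y ∈ Submodule.span ℂ {x | ∃ I, I ⊂ L ∧ x = X cs L I}) :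
    eps cs L * y = 0 := by
  induction hy using Submodule.span_induction with
  | mem x hx =>
    obtain ⟨I, hI, rfl⟩ := hx
    rw [eps, smul_mul_assoc, eta_mul_X hL hI, smul_zero]
  | zero => rw [mul_zero]
  | add x y _ _ hx hy => rw [mul_add, hx, hy, add_zero]
  | smul a x _ hx => rw [mul_smul_comm, hx, smul_zero]

theorem eps_mul_eps {cs : CoxeterSystem M W} {L : Finset W} (hL : L ⊆ Simples cs) :
    eps cs L * eps cs L = eps cs L := by
  have := eps_mul_of_mem_span hL (eta_sub_mem_span hL)
  rw [← eps, mul_sub, mul_one, sub_eq_zero] at this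
  exact this

theorem of_mul_eps {cs : CoxeterSystem M W} {L : Finset W} (hL : L ⊆ Simples cs) {n : W}
    (hn : n ∈ NL cs L) : of ℂ W n * eps cs L = eps cs L * of ℂ W n := by
  rw [mem_NL] at hn
  have := of_mul_eta hL (by rw [hn.2]; exact hL) hn.1
  rw [hn.2] at this
  rw [eps, mul_smul_comm, this, smul_mul_assoc]

theorem X_mul_of_NL {cs : CoxeterSystem M W} {L : Finset W} (hL : L ⊆ Simples cs) {n : W}
    (hn : n ∈ NL cs L) : X cs (Simples cs) L * of ℂ W n = X cs (Simples cs) L := by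
  rw [mem_NL] at hn
  have := X_mul_of (D := Simples cs) (Subset.refl _) hL (by rw [hn.2]; exact hL)
    (Par_Simples cs n) hn.1
  rwa [hn.2] at this

theorem conjF_inv_eq_iff (d : W) (J L : Finset W) (h : J.card = L.card) :
    conjF d⁻¹ J ⊆ L ↔ conjF d L = J := by
  constructor
  · intro h1
    have h2 := eq_of_subset_of_card_le h1 (by rw [card_conjF, h])
    rw [← h2, conjF_inv_conjF]
  · rintro rfl
    rw [conjF_conjF_inv]

theorem eta_mul_X_shape {cs : CoxeterSystem M W} {L J : Finset W} (hL : L ⊆ Simples cs)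
    (hJ : J ⊆ Simples cs) (h : J.card = L.card) :
    eta cs J * X cs (Simples cs) L =
      ∑ d ∈ univ.filter (fun d => RMin cs L d ∧ conjF d L = J), eta cs J * of ℂ W d := by
  rw [eta_mul_X_of (Subset.refl _) hJ hL fun I hI => eta_mul_X hJ hI]
  congr 1
  ext d
  simp [conjF_inv_eq_iff d J L h, Par_Simples]

theorem eps_mul_X {cs : CoxeterSystem M W} {L : Finset W} (hL : L ⊆ Simples cs) :
    eps cs L * X cs (Simples cs) L = ∑ n ∈ NL cs L, eps cs L * of ℂ W n := by
  rw [eps, smul_mul_assoc, eta_mul_X_shape hL hL rfl, smul_sum]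
  exact sum_congr rfl fun d _ => by rw [smul_mul_assoc]

/-- The generator `x_L ε_L` of the right ideal `E_λ`. -/
def gen (cs : CoxeterSystem M W) (L : Finset W) : MonoidAlgebra ℂ W :=
  X cs (Simples cs) L * eps cs L

theorem gen_eq_elam_mul {cs : CoxeterSystem M W} {e : Finset W → MonoidAlgebra ℂ W}
    (he : IsBBHT cs Set.univ (Simples cs) (fun _ => (1 : ℝ)) e) {L : Finset W}
    (hL : L ⊆ Simples cs) :
    (∑ J ∈ (Simples cs).powerset.filter (fun J => ShapeEq L J), e J) * gen cs L = gen cs L := by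
  set S := Simples cs
  have hsh : ∀ J ∈ S.powerset.filter (fun J => ShapeEq L J), J ⊆ S ∧ J.card = L.card := by
    intro J hJ
    rw [mem_filter, mem_powerset] at hJ
    obtain ⟨w, -, rfl⟩ := exists_RMin_of_ShapeEq hL hJ.1 hJ.2
    exact ⟨hJ.1, card_conjF w L⟩
  have h1 : ∀ J ∈ S.powerset.filter (fun J => ShapeEq L J), e J * X cs S L =
      ∑ d ∈ univ.filter (fun d => RMin cs L d ∧ conjF d L = J), X cs S L * eta cs L := by
    intro J hJ
    have h2 := hsh J hJ
    rw [he.eq h2.1, mul_assoc, eta_mul_X_shape hL h2.1 h2.2, mul_sum]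
    refine sum_congr rfl fun d hd => ?_
    simp only [mem_filter, mem_univ, true_and] at hd
    obtain ⟨hd1, rfl⟩ := hd
    rw [← of_mul_eta hL h2.1 hd1, ← mul_assoc,
      X_mul_of (Subset.refl _) hL h2.1 (Par_Simples cs d) hd1]
  have h3 : (∑ J ∈ S.powerset.filter (fun J => ShapeEq L J), e J) * X cs S L =
      X cs S L * eps cs L := by
    rw [sum_mul, sum_congr rfl h1]
    simp only [sum_const, ← sum_smul]
    rw [eps, mul_smul_comm, ← Nat.cast_smul_eq_nsmul ℂ, mS, ← card_sigma]
    congr 2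
    refine card_bij (fun z _ => z.2) ?_ ?_ ?_
    · rintro ⟨J, d⟩ h
      simp only [mem_sigma, mem_filter, mem_univ, true_and] at h ⊢
      refine ⟨h.2.1, fun s hs => mem_powerset.1 h.1.1 ?_⟩
      rw [← h.2.2]
      exact mem_conjF_self.2 hs
    · rintro ⟨J, d⟩ h ⟨J', d'⟩ h' e
      simp only [mem_sigma, mem_filter, mem_univ, true_and] at h h' e
      subst e
      rw [← h.2.2, ← h'.2.2]
    · intro d h
      simp only [mem_filter, mem_univ, true_and] at h
      refine ⟨⟨conjF d L, d⟩, ?_, rfl⟩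
      simp only [mem_sigma, mem_filter, mem_univ, true_and, mem_powerset]
      exact ⟨⟨image_subset_iff.2 h.2, ShapeEq_conjF d L⟩, h.1, trivial⟩
  rw [gen, ← mul_assoc, h3, mul_assoc, eps_mul_eps hL]

theorem elam_eq_gen_mul {cs : CoxeterSystem M W} {e : Finset W → MonoidAlgebra ℂ W}
    (he : IsBBHT cs Set.univ (Simples cs) (fun _ => (1 : ℝ)) e) {L : Finset W}
    (hL : L ⊆ Simples cs) : ∃ u : MonoidAlgebra ℂ W,
    (∑ J ∈ (Simples cs).powerset.filter (fun J => ShapeEq L J), e J) = gen cs L * u := by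
  have h1 : ∀ J ∈ (Simples cs).powerset.filter (fun J => ShapeEq L J),
      ∃ u : MonoidAlgebra ℂ W, e J = gen cs L * u := by
    intro J hJ
    rw [mem_filter, mem_powerset] at hJ
    obtain ⟨hJ, hsh⟩ := hJ
    obtain ⟨w, hw, rfl⟩ := exists_RMin_of_ShapeEq hL hJ hsh
    refine ⟨(mS cs L L)⁻¹ • of ℂ W w⁻¹, ?_⟩
    rw [he.eq hJ, gen, eps, mul_smul_comm, mul_smul_comm, smul_mul_assoc,
      inv_smul_smul₀ (mS_self_ne_zero hL), ← X_mul_of (Subset.refl _) hL hJ (Par_Simples cs w) hw, mul_assoc (X _ _ _),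
      of_mul_eta hL hJ hw, mul_assoc, mul_assoc, ← map_mul, mul_inv_cancel, map_one, mul_one]
  choose! u hu using h1
  exact ⟨∑ J ∈ (Simples cs).powerset.filter (fun J => ShapeEq L J), u J, by
    rw [mul_sum]; exact sum_congr rfl hu⟩

theorem gen_mul_gen {cs : CoxeterSystem M W} {L : Finset W} (hL : L ⊆ Simples cs) :
    gen cs L * gen cs L = ((NL cs L).card : ℂ) • gen cs L := by
  have : gen cs L * gen cs L = X cs (Simples cs) L * (eps cs L * X cs (Simples cs) L) * eps cs L := by
    simp only [gen, mul_assoc]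
  rw [this, eps_mul_X hL, mul_sum, sum_mul, sum_congr rfl (g := fun _ => gen cs L), sum_const,
    Nat.cast_smul_eq_nsmul]
  intro n hn
  rw [← of_mul_eps hL hn, ← mul_assoc, X_mul_of_NL hL hn, mul_assoc, eps_mul_eps hL, gen]

/-! ### Chains of type `A` -/

theorem ne_one_of_mem {cs : CoxeterSystem M W} {s : W} (hs : s ∈ Simples cs) : s ≠ 1 := by
  rintro rfl
  simpa using length_of_mem hs

/-- `s 1, …, s l` is a connected component of type `A_l` of `R ∪ {s 1, …, s l}`. -/
structure Chain (cs : CoxeterSystem M W) (s : ℕ → W) (l : ℕ) (R : Finset W) : Prop where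
  one_le : 1 ≤ l
  mem : ∀ j, 1 ≤ j → j ≤ l → s j ∈ Simples cs
  subset : R ⊆ Simples cs
  inj : ∀ j k, 1 ≤ j → j ≤ l → 1 ≤ k → k ≤ l → s j = s k → j = k
  notMem : ∀ j, 1 ≤ j → j ≤ l → s j ∉ R
  braid : ∀ j, 1 ≤ j → j < l → s j * s (j + 1) * s j = s (j + 1) * s j * s (j + 1)
  comm : ∀ j k, 1 ≤ j → j + 1 < k → k ≤ l → s j * s k = s k * s j
  commR : ∀ j, 1 ≤ j → j ≤ l → ∀ r ∈ R, s j * r = r * s j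

/-- The simple reflections of a chain. -/
def comp (s : ℕ → W) (l : ℕ) : Finset W := (Icc 1 l).image s

/-- All simple reflections around a chain. -/
def CL (s : ℕ → W) (l : ℕ) (R : Finset W) : Finset W := R ∪ comp s l

/-- The product `s 1 ⋯ s k`. -/
def dd (s : ℕ → W) : ℕ → W
  | 0 => 1
  | k + 1 => dd s k * s (k + 1)

theorem mem_comp {s : ℕ → W} {l : ℕ} {t : W} : t ∈ comp s l ↔ ∃ j, 1 ≤ j ∧ j ≤ l ∧ s j = t := by
  simp [comp, and_assoc]

theorem mem_CL {s : ℕ → W} {l : ℕ} {R : Finset W} {t : W} :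
    t ∈ CL s l R ↔ t ∈ R ∨ ∃ j, 1 ≤ j ∧ j ≤ l ∧ s j = t := by
  rw [CL, mem_union, mem_comp]

theorem mem_CL_of {s : ℕ → W} {l : ℕ} {R : Finset W} {j : ℕ} (h1 : 1 ≤ j) (h2 : j ≤ l) :
    s j ∈ CL s l R := mem_CL.2 (Or.inr ⟨j, h1, h2, rfl⟩)

namespace Chain

variable {cs : CoxeterSystem M W} {s : ℕ → W} {l : ℕ} {R : Finset W}

theorem comp_subset (h : Chain cs s l R) : comp s l ⊆ Simples cs := by
  intro t ht
  obtain ⟨j, h1, h2, rfl⟩ := mem_comp.1 ht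
  exact h.mem j h1 h2

theorem CL_subset (h : Chain cs s l R) : CL s l R ⊆ Simples cs :=
  union_subset h.subset h.comp_subset

theorem J_subset (h : Chain cs s l R) : (CL s l R).erase (s 1) ⊆ Simples cs :=
  (erase_subset _ _).trans h.CL_subset

theorem mem_J (h : Chain cs s l R) {j : ℕ} (h1 : 2 ≤ j) (h2 : j ≤ l) :
    s j ∈ (CL s l R).erase (s 1) := by
  refine mem_erase.2 ⟨fun e => ?_, mem_CL_of (by omega) h2⟩
  have := h.inj j 1 (by omega) h2 le_rfl h.one_le e
  omega

theorem R_subset_J (h : Chain cs s l R) : R ⊆ (CL s l R).erase (s 1) := by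
  intro r hr
  refine mem_erase.2 ⟨?_, mem_CL.2 (Or.inl hr)⟩
  rintro rfl
  exact h.notMem 1 le_rfl h.one_le hr

theorem mul_self (h : Chain cs s l R) {j : ℕ} (h1 : 1 ≤ j) (h2 : j ≤ l) : s j * s j = 1 :=
  mul_self_of_mem (h.mem j h1 h2)

theorem ncomm (h : Chain cs s l R) {j : ℕ} (h1 : 1 ≤ j) (h2 : j < l) :
    s j * s (j + 1) ≠ s (j + 1) * s j := by
  intro e
  have h3 := h.braid j h1 h2
  rw [e, mul_assoc, h.mul_self h1 h2.le, mul_assoc, e, ← mul_assoc,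
    h.mul_self (by omega) (by omega)] at h3
  have := h.inj (j + 1) j (by omega) (by omega) h1 h2.le (by simpa using h3)
  omega

theorem ncomm_iff (h : Chain cs s l R) {j k : ℕ} (h1 : 1 ≤ j) (h2 : j ≤ l) (h3 : 1 ≤ k)
    (h4 : k ≤ l) : s j * s k ≠ s k * s j ↔ (k = j + 1 ∨ j = k + 1) := by
  constructor
  · intro hn
    by_contra hcon
    push Not at hcon
    rcases lt_trichotomy j k with hjk | rfl | hjk
    · exact hn (h.comm j k h1 (by omega) h4)
    · exact hn rfl
    · exact hn (h.comm k j h3 (by omega) h2).symm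
  · rintro (rfl | rfl)
    · exact h.ncomm h1 (by omega)
    · exact (h.ncomm h3 (by omega)).symm

theorem dd_comm (h : Chain cs s l R) {j k : ℕ} (h1 : k + 1 < j) (h2 : j ≤ l) :
    dd s k * s j = s j * dd s k := by
  induction k with
  | zero => simp [dd]
  | succ k ih =>
    rw [dd, mul_assoc, h.comm (k + 1) j (by omega) h1 h2, ← mul_assoc, ih (by omega), mul_assoc]

theorem dd_commR (h : Chain cs s l R) {k : ℕ} (hk : k ≤ l) {r : W} (hr : r ∈ R) :
    dd s k * r = r * dd s k := by
  induction k with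
  | zero => simp [dd]
  | succ k ih =>
    rw [dd, mul_assoc, h.commR (k + 1) (by omega) hk r hr, ← mul_assoc, ih (by omega), mul_assoc]

theorem dd_shift (h : Chain cs s l R) {j k : ℕ} (h1 : 1 ≤ j) (h2 : j < k) (hk : k ≤ l) :
    dd s k * s j = s (j + 1) * dd s k := by
  induction k with
  | zero => omega
  | succ k ih =>
    rcases Nat.lt_succ_iff_lt_or_eq.1 h2 with hjk | rfl
    · rw [dd, mul_assoc, ← h.comm j (k + 1) h1 (by omega) hk, ← mul_assoc,
        ih hjk (by omega), mul_assoc]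
    · obtain ⟨m, rfl⟩ : ∃ m, j = m + 1 := ⟨j - 1, by omega⟩
      rw [dd, dd, mul_assoc, mul_assoc, ← mul_assoc (s (m + 1)), h.braid (m + 1) h1 (by omega),
        mul_assoc, ← mul_assoc, h.dd_comm (by omega) hk]
      simp only [mul_assoc]

theorem dd_conj_mem (h : Chain cs s l R) {k : ℕ} (hk : k ≤ l) {t : W} (ht : t ∈ CL s l R)
    (h1 : 1 ≤ k → t ≠ s k) (h2 : k < l → t ≠ s (k + 1)) :
    dd s k * t * (dd s k)⁻¹ ∈ (CL s l R).erase (s 1) := by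
  rcases mem_CL.1 ht with ht | ⟨j, hj1, hj2, rfl⟩
  · rw [h.dd_commR hk ht, mul_inv_cancel_right]
    exact h.R_subset_J ht
  · rcases lt_trichotomy j k with hjk | rfl | hjk
    · rw [h.dd_shift hj1 hjk hk, mul_inv_cancel_right]
      exact h.mem_J (by omega) (by omega)
    · exact absurd rfl (h1 hj1)
    · have : j ≠ k + 1 := by
        rintro rfl
        exact h2 (by omega) rfl
      rw [h.dd_comm (by omega) hj2, mul_inv_cancel_right]
      exact h.mem_J (by omega) hj2

theorem dd_mem (s : ℕ → W) (k : ℕ) : dd s k ∈ Par (comp s k) := by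
  induction k with
  | zero => exact one_mem _
  | succ k ih =>
    refine mul_mem (Par_mono ?_ ih) (mem_Par (mem_comp.2 ⟨k + 1, by omega, le_rfl, rfl⟩))
    exact image_subset_image (Icc_subset_Icc_right (by omega))

theorem comp_mono {j k : ℕ} (h : j ≤ k) : comp s j ⊆ comp s k :=
  image_subset_image (Icc_subset_Icc_right h)

theorem refl01_dd_succ (h : Chain cs s l R) {j k : ℕ} (hj : k < j) (hk : j ≤ l) :
    refl01 cs (dd s k) (s j) = 0 := by
  have hS : comp s k ⊆ Simples cs := (comp_mono (by omega)).trans h.comp_subset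
  refine refl01_eq_zero_of_not_mem hS (dd_mem s k) fun hc => ?_
  obtain ⟨i, h1, h2, h3⟩ := mem_comp.1 (mem_of_mem_Par hS (h.mem j (by omega) hk) hc)
  have := h.inj i j h1 (by omega) (by omega) hk h3
  omega

theorem refl01_dd (h : Chain cs s l R) {k : ℕ} (h1 : 1 ≤ k) (hk : k ≤ l) :
    refl01 cs (dd s k) (s k) = 1 := by
  obtain ⟨m, rfl⟩ : ∃ m, k = m + 1 := ⟨k - 1, by omega⟩
  rw [dd, refl01_mul, refl01_mem_self (h.mem _ h1 hk), mul_inv_cancel_right,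
    h.refl01_dd_succ (by omega) hk, add_zero]

theorem length_dd (h : Chain cs s l R) {k : ℕ} (hk : k ≤ l) : cs.length (dd s k) = k := by
  induction k with
  | zero => simp [dd]
  | succ k ih =>
    have h1 := h.refl01_dd_succ (k := k) (j := k + 1) (by omega) hk
    rw [refl01_eq_zero_iff (isReflection_of_mem (h.mem _ (by omega) hk)), ih (by omega)] at h1
    have h2 := length_mul_mem (h.mem (k + 1) (by omega) hk) (dd s k)
    rw [ih (by omega)] at h2
    rw [dd]
    omega

theorem LMin_dd (h : Chain cs s l R) {k : ℕ} (hk : k ≤ l) :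
    LMin cs ((CL s l R).erase (s 1)) (dd s k) := by
  induction k with
  | zero =>
    intro t ht
    simp [dd, length_of_mem (h.J_subset ht)]
  | succ k ih =>
    have ih' := ih (by omega)
    rw [LMin_iff h.J_subset] at ih' ⊢
    intro t ht
    have hk' := h.mem (k + 1) (by omega) hk
    rw [dd, mul_inv_rev, refl01_mul, ih' t ht, zero_add, inv_of_mem hk']
    refine (zmod2_cases _).resolve_right fun h1 => ?_
    have h2 := eq_of_refl01_mem hk' h1
    rw [inv_inv] at h2
    have htS := h.J_subset ht
    have h3 : s (k + 1) ∈ Par (insert t (comp s k)) := by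
      rw [← h2]
      have h4 : dd s k ∈ Par (insert t (comp s k)) := Par_mono (subset_insert _ _) (dd_mem s k)
      exact mul_mem (mul_mem (inv_mem h4) (mem_Par (mem_insert_self _ _))) h4
    have hS : comp s k ⊆ Simples cs := (comp_mono (by omega)).trans h.comp_subset
    have h5 := mem_of_mem_Par (insert_subset htS hS) hk' h3
    rcases mem_insert.1 h5 with h6 | h6
    · subst h6
      rcases Nat.eq_zero_or_pos k with rfl | hk0
      · exact (mem_erase.1 ht).1 rfl
      · obtain ⟨m, rfl⟩ : ∃ m, k = m + 1 := ⟨k - 1, by omega⟩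
        have h7 : s (m + 1 + 1) * dd s (m + 1) = dd s (m + 1) * s (m + 1 + 1) := by
          have : s (m + 1 + 1) * dd s (m + 1) = dd s (m + 1) * ((dd s (m + 1))⁻¹ *
            s (m + 1 + 1) * dd s (m + 1)) := by group
          rw [this, h2]
        rw [dd, ← mul_assoc, ← h.dd_comm (by omega) hk, mul_assoc, mul_assoc] at h7
        exact h.ncomm (by omega) (by omega) (mul_left_cancel h7).symm
    · obtain ⟨i, h7, h8, h9⟩ := mem_comp.1 h6
      have := h.inj i (k + 1) h7 (by omega) (by omega) hk h9
      omega

theorem conj_not_mem (h : Chain cs s l R) {k : ℕ} (hk : k < l) :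
    dd s k * s (k + 1) * (dd s k)⁻¹ ∉ Par ((CL s l R).erase (s 1)) := by
  intro h1
  have h2 := (h.LMin_dd (k := k) hk.le).unique h.J_subset (h.LMin_dd (k := k + 1) hk) h1 (one_mem _)
    (by rw [dd]; group)
  have h3 : s (k + 1) = 1 := by
    have := h2.1
    simpa using this
  exact ne_one_of_mem (h.mem _ (by omega) hk) h3

theorem conj_not_mem' (h : Chain cs s l R) {k : ℕ} (h1 : 1 ≤ k) (hk : k ≤ l) :
    dd s k * s k * (dd s k)⁻¹ ∉ Par ((CL s l R).erase (s 1)) := by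
  obtain ⟨m, rfl⟩ : ∃ m, k = m + 1 := ⟨k - 1, by omega⟩
  have := h.conj_not_mem (k := m) (by omega)
  convert this using 2
  rw [dd]
  group

theorem exists_dd (h : Chain cs s l R) {w : W} (hw : w ∈ Par (CL s l R)) :
    ∃ k ≤ l, ∃ a ∈ Par ((CL s l R).erase (s 1)), w = a * dd s k := by
  have key : ∀ w t, (∃ k ≤ l, ∃ a ∈ Par ((CL s l R).erase (s 1)), w = a * dd s k) →
      t ∈ CL s l R → ∃ k ≤ l, ∃ a ∈ Par ((CL s l R).erase (s 1)), w * t = a * dd s k := by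
    rintro w t ⟨k, hk, a, ha, rfl⟩ ht
    by_cases h1 : 1 ≤ k ∧ t = s k
    · obtain ⟨h1, rfl⟩ := h1
      obtain ⟨m, rfl⟩ : ∃ m, k = m + 1 := ⟨k - 1, by omega⟩
      refine ⟨m, by omega, a, ha, ?_⟩
      rw [dd, mul_assoc, mul_assoc, h.mul_self h1 hk, mul_one]
    by_cases h2 : k < l ∧ t = s (k + 1)
    · obtain ⟨h2, rfl⟩ := h2
      exact ⟨k + 1, h2, a, ha, by rw [dd, mul_assoc]⟩
    refine ⟨k, hk, a * (dd s k * t * (dd s k)⁻¹), mul_mem ha (mem_Par (h.dd_conj_mem hk ht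
      (fun h3 h4 => h1 ⟨h3, h4⟩) fun h3 h4 => h2 ⟨h3, h4⟩)), by group⟩
  refine Subgroup.closure_induction_right (p := fun w _ => ∃ k ≤ l,
    ∃ a ∈ Par ((CL s l R).erase (s 1)), w = a * dd s k) ?_ ?_ ?_ hw
  · exact ⟨0, by omega, 1, one_mem _, by simp [dd]⟩
  · exact fun v _ t ht ih => key v t ih ht
  · intro v _ t ht ih
    rw [inv_of_mem (h.CL_subset ht)]
    exact key v t ih ht

theorem refl01_mul_dd_succ (h : Chain cs s l R) {k : ℕ} (hk : k < l) {a : W}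
    (ha : a ∈ Par ((CL s l R).erase (s 1))) : refl01 cs (a * dd s k) (s (k + 1)) = 0 := by
  rw [refl01_mul, h.refl01_dd_succ (by omega) hk,
    refl01_eq_zero_of_not_mem h.J_subset ha (h.conj_not_mem hk), add_zero]

theorem refl01_mul_dd (h : Chain cs s l R) {k : ℕ} (h1 : 1 ≤ k) (hk : k ≤ l) {a : W}
    (ha : a ∈ Par ((CL s l R).erase (s 1))) : refl01 cs (a * dd s k) (s k) = 1 := by
  rw [refl01_mul, h.refl01_dd h1 hk,
    refl01_eq_zero_of_not_mem h.J_subset ha (h.conj_not_mem' h1 hk), add_zero]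

/-! ### Reversal of a chain -/

theorem comp_rev (s : ℕ → W) (l : ℕ) : comp (fun j => s (l + 1 - j)) l = comp s l := by
  ext t
  simp only [mem_comp]
  constructor
  · rintro ⟨j, h1, h2, rfl⟩
    exact ⟨l + 1 - j, by omega, by omega, rfl⟩
  · rintro ⟨j, h1, h2, rfl⟩
    exact ⟨l + 1 - j, by omega, by omega, by congr 1; omega⟩

theorem CL_rev (s : ℕ → W) (l : ℕ) (R : Finset W) :
    CL (fun j => s (l + 1 - j)) l R = CL s l R := by rw [CL, comp_rev, CL]

theorem rev (h : Chain cs s l R) : Chain cs (fun j => s (l + 1 - j)) l R where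
  one_le := h.one_le
  mem j h1 h2 := h.mem _ (by omega) (by omega)
  subset := h.subset
  inj j k h1 h2 h3 h4 e := by
    have := h.inj _ _ (by omega) (by omega) (by omega) (by omega) e
    omega
  notMem j h1 h2 := h.notMem _ (by omega) (by omega)
  braid j h1 h2 := by
    have := h.braid (l + 1 - (j + 1)) (by omega) (by omega)
    rw [show l + 1 - (j + 1) + 1 = l + 1 - j by omega] at this
    exact this.symm
  comm j k h1 h2 h3 := (h.comm _ _ (by omega) (by omega) (by omega)).symm
  commR j h1 h2 := h.commR _ (by omega) (by omega)

theorem inv_dd_mul_dd (h : Chain cs s l R) {k : ℕ} (hk : k ≤ l) :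
    (dd s l)⁻¹ * dd s k = dd (fun j => s (l + 1 - j)) (l - k) := by
  have key : ∀ m ≤ l, dd s l * dd (fun j => s (l + 1 - j)) m = dd s (l - m) := by
    intro m hm
    induction m with
    | zero => simp [dd]
    | succ m ih =>
      obtain ⟨n, hn⟩ : ∃ n, l - m = n + 1 := ⟨l - m - 1, by omega⟩
      rw [dd, ← mul_assoc, ih (by omega), hn, show l + 1 - (m + 1) = n + 1 by omega, dd, mul_assoc,
        h.mul_self (by omega) (by omega), mul_one, show l - (m + 1) = n by omega]
  rw [inv_mul_eq_iff_eq_mul, key _ (by omega), show l - (l - k) = k by omega]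

theorem inv_dd_conj (h : Chain cs s l R) {t : W} (ht : t ∈ (CL s l R).erase (s 1)) :
    (dd s l)⁻¹ * t * (dd s l)⁻¹⁻¹ ∈ (CL s l R).erase (s l) := by
  obtain ⟨h1, h2⟩ := mem_erase.1 ht
  rw [inv_inv]
  rcases mem_CL.1 h2 with hr | ⟨j, hj1, hj2, rfl⟩
  · rw [mul_assoc, ← h.dd_commR le_rfl hr, inv_mul_cancel_left]
    refine mem_erase.2 ⟨?_, h2⟩
    rintro rfl
    exact h.notMem l h.one_le le_rfl hr
  · have hj : j ≠ 1 := by rintro rfl; exact h1 rfl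
    obtain ⟨m, rfl⟩ : ∃ m, j = m + 1 := ⟨j - 1, by omega⟩
    rw [mul_assoc, ← h.dd_shift (by omega) (by omega) le_rfl, inv_mul_cancel_left]
    refine mem_erase.2 ⟨fun e => ?_, mem_CL_of (by omega) (by omega)⟩
    have := h.inj _ _ (by omega) (by omega) h.one_le le_rfl e
    omega

/-- Effect of left multiplication by the Coxeter element on descents. -/
theorem refl01_cox_mul (h : Chain cs s l R) {k : ℕ} (hk : k ≤ l) {a : W}
    (ha : a ∈ Par ((CL s l R).erase (s 1))) :
    (1 ≤ k → refl01 cs (a * dd s k) (s k) = 1 ∧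
      refl01 cs ((dd s l)⁻¹ * (a * dd s k)) (s k) = 0) ∧
    (k < l → refl01 cs (a * dd s k) (s (k + 1)) = 0 ∧
      refl01 cs ((dd s l)⁻¹ * (a * dd s k)) (s (k + 1)) = 1) ∧
    ∀ t ∈ CL s l R, (1 ≤ k → t ≠ s k) → (k < l → t ≠ s (k + 1)) →
      refl01 cs ((dd s l)⁻¹ * (a * dd s k)) t = refl01 cs (a * dd s k) t := by
  have e : (dd s l)⁻¹ * (a * dd s k) = ((dd s l)⁻¹ * a * (dd s l)⁻¹⁻¹) *
      dd (fun j => s (l + 1 - j)) (l - k) := by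
    rw [← h.inv_dd_mul_dd hk]; group
  have ha' := conj_mem_Par (fun t ht => h.inv_dd_conj ht) ha
  have h3 : (CL (fun j => s (l + 1 - j)) l R).erase (s (l + 1 - 1)) = (CL s l R).erase (s l) := by
    rw [CL_rev, Nat.add_sub_cancel]
  rw [← h3] at ha'
  refine ⟨fun h1 => ⟨h.refl01_mul_dd h1 hk ha, ?_⟩,
    fun h1 => ⟨h.refl01_mul_dd_succ h1 ha, ?_⟩, fun t ht h1 h2 => ?_⟩
  · have := h.rev.refl01_mul_dd_succ (k := l - k) (by omega) ha'
    rwa [show l + 1 - (l - k + 1) = k by omega, ← e] at this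
  · have := h.rev.refl01_mul_dd (k := l - k) (by omega) (by omega) ha'
    rwa [show l + 1 - (l - k) = k + 1 by omega, ← e] at this
  · have h4 := mem_Par (h.dd_conj_mem hk ht h1 h2)
    have h5 : RMin cs ((CL s l R).erase (s 1)) (dd s l)⁻¹ :=
      (LMin_iff_inv h.J_subset).1 (h.LMin_dd le_rfl)
    rw [refl01_mul, h5.refl01_eq_zero h.J_subset
      (isReflection_conj (isReflection_of_mem (h.CL_subset ht)) _), add_zero]
    have e2 : a * dd s k * t * (a * dd s k)⁻¹ = a * (dd s k * t * (dd s k)⁻¹) * a⁻¹ := by group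
    rw [e2]
    exact mul_mem (mul_mem ha h4) (inv_mem ha)

end Chain

theorem comm_of_conj {n a b : W} (h : n * a * n⁻¹ * (n * b * n⁻¹) = n * b * n⁻¹ * (n * a * n⁻¹)) :
    a * b = b * a := by
  have := congrArg (fun x => n⁻¹ * x * n) h
  simpa [mul_assoc] using this

theorem path_cases {k : ℕ → ℕ} {l : ℕ} (h1 : 1 ≤ l)
    (hinj : ∀ i j, 1 ≤ i → i ≤ l → 1 ≤ j → j ≤ l → k i = k j → i = j)
    (hk : ∀ j, 1 ≤ j → j < l → k (j + 1) = k j + 1 ∨ k j = k (j + 1) + 1) :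
    (∀ j, 1 ≤ j → j ≤ l → k j + 1 = k 1 + j) ∨ (∀ j, 1 ≤ j → j ≤ l → k j + j = k 1 + 1) := by
  induction l, h1 using Nat.le_induction with
  | base =>
    left
    intro j h1 h2
    obtain rfl : j = 1 := by omega
    rfl
  | succ l hl ih =>
    have hlast := hk l hl (by omega)
    have ih' := ih (fun i j h1 h2 h3 h4 => hinj i j h1 (by omega) h3 (by omega))
      (fun j h1 h2 => hk j h1 (by omega))
    rcases Nat.eq_or_lt_of_le hl with rfl | hl'
    · rcases hlast with h | h
      · left
        intro j h1 h2
        rcases Nat.lt_or_ge j 2 with h3 | h3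
        · obtain rfl : j = 1 := by omega
          rfl
        · obtain rfl : j = 2 := by omega
          simp only [Nat.reduceAdd] at h
          omega
      · right
        intro j h1 h2
        rcases Nat.lt_or_ge j 2 with h3 | h3
        · obtain rfl : j = 1 := by omega
          rfl
        · obtain rfl : j = 2 := by omega
          simp only [Nat.reduceAdd] at h
          omega
    · have hne : k (l + 1) ≠ k (l - 1) := fun e => by
        have := hinj (l + 1) (l - 1) (by omega) le_rfl (by omega) (by omega) e
        omega
      rcases ih' with h | h
      · left
        intro j h1 h2
        rcases Nat.eq_or_lt_of_le h2 with rfl | h3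
        · have e1 := h l hl le_rfl
          have e2 := h (l - 1) (by omega) (by omega)
          omega
        · exact h j h1 (by omega)
      · right
        intro j h1 h2
        rcases Nat.eq_or_lt_of_le h2 with rfl | h3
        · have e1 := h l hl le_rfl
          have e2 := h (l - 1) (by omega) (by omega)
          omega
        · exact h j h1 (by omega)

/-- `x` maps the coset `(s 1 ⋯ s k)⁻¹ W_J` to `(s 1 ⋯ s m)⁻¹ W_J`, for `J` the complement
of `s 1`. -/
def Q (s : ℕ → W) (l : ℕ) (R : Finset W) (x : W) (k m : ℕ) : Prop :=
  dd s m * x * (dd s k)⁻¹ ∈ Par ((CL s l R).erase (s 1))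

/-- `x` acts as a full cycle on the cosets of `W_J`. -/
def Rot (s : ℕ → W) (l : ℕ) (R : Finset W) (x : W) : Prop :=
  Q s l R x 0 l ∧ ∀ k, k < l → Q s l R x (k + 1) k

section Q

variable {s : ℕ → W} {l : ℕ} {R : Finset W} {x y : W} {k m n : ℕ}

theorem Q.trans (h1 : Q s l R x k m) (h2 : Q s l R y m n) : Q s l R (y * x) k n := by
  have := mul_mem h2 h1
  unfold Q
  convert this using 1
  group

theorem Q.inv (h1 : Q s l R x k m) : Q s l R x⁻¹ m k := by
  have := inv_mem h1
  unfold Q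
  convert this using 1
  group

theorem Q_one (k : ℕ) : Q s l R 1 k k := by
  unfold Q
  simp

theorem Rot.pow (h : Rot s l R x) (hm : m ≤ l) : Q s l R (x ^ m) m 0 := by
  induction m with
  | zero => simpa using Q_one 0
  | succ m ih =>
    rw [pow_succ]
    exact (h.2 m hm).trans (ih (by omega))

end Q

/-- The weighted number of descents of `w` along a chain. -/
def majE (cs : CoxeterSystem M W) (s : ℕ → W) (l : ℕ) (w : W) : ℕ :=
  ∑ j ∈ Icc 1 l, if refl01 cs w (s j) = 1 then j else 0

theorem prod_reverse_eq_inv_dd {cs : CoxeterSystem M W} {s : ℕ → W} {l : ℕ}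
    (h : ∀ j, 1 ≤ j → j ≤ l → s j ∈ Simples cs) :
    (((List.range l).reverse).map (fun j => s (j + 1))).prod = (dd s l)⁻¹ := by
  induction l with
  | zero => simp [dd]
  | succ l ih =>
    rw [List.range_succ, List.reverse_append, List.reverse_singleton, List.map_append,
      List.prod_append, ih (fun j h1 h2 => h j h1 (by omega)), dd, mul_inv_rev,
      inv_of_mem (h (l + 1) (by omega) le_rfl)]
    simp

namespace Chain

variable {cs : CoxeterSystem M W} {s : ℕ → W} {l : ℕ} {R : Finset W}

theorem dd_mem_CL {k : ℕ} (hk : k ≤ l) : dd s k ∈ Par (CL s l R) :=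
  Par_mono ((comp_mono hk).trans subset_union_right) (dd_mem s k)

theorem Q_unique (h : Chain cs s l R) {x : W} {k m m' : ℕ} (hm : m ≤ l) (hm' : m' ≤ l)
    (h1 : Q s l R x k m) (h2 : Q s l R x k m') : m = m' := by
  have h3 := h1.inv.trans h2
  rw [mul_inv_cancel] at h3
  have := (h.LMin_dd hm').unique h.J_subset (h.LMin_dd hm) (one_mem _) h3
    (by rw [one_mul, mul_one, inv_mul_cancel_right])
  rw [← h.length_dd hm, ← h.length_dd hm', this.2]

theorem exists_Q (h : Chain cs s l R) {x : W} (hx : x ∈ Par (CL s l R)) {k : ℕ} (hk : k ≤ l) :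
    ∃ m ≤ l, Q s l R x k m := by
  obtain ⟨m, hm, a, ha, e⟩ := h.exists_dd (mul_mem (dd_mem_CL hk) (inv_mem hx))
  refine ⟨m, hm, ?_⟩
  have : dd s m * x * (dd s k)⁻¹ = a⁻¹ := by
    have e' : a = dd s k * x⁻¹ * (dd s m)⁻¹ := by rw [e, mul_inv_cancel_right]
    rw [e']
    group
  unfold Q
  rw [this]
  exact inv_mem ha

theorem Q_of_mem_R (h : Chain cs s l R) {b : W} (hb : b ∈ Par R) {k : ℕ} (hk : k ≤ l) :
    Q s l R b k k :=
  conj_mem_Par (fun r hr => by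
    rw [h.dd_commR hk hr, mul_inv_cancel_right]
    exact h.R_subset_J hr) hb

theorem Q_gen (h : Chain cs s l R) {t : W} (ht : t ∈ CL s l R) {k : ℕ} (hk : k ≤ l) :
    (1 ≤ k ∧ t = s k ∧ Q s l R t k (k - 1)) ∨ (k < l ∧ t = s (k + 1) ∧ Q s l R t k (k + 1)) ∨
      Q s l R t k k := by
  by_cases h1 : 1 ≤ k ∧ t = s k
  · obtain ⟨h1, rfl⟩ := h1
    obtain ⟨m, rfl⟩ : ∃ m, k = m + 1 := ⟨k - 1, by omega⟩
    refine Or.inl ⟨h1, rfl, ?_⟩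
    unfold Q
    rw [Nat.add_sub_cancel, dd, mul_inv_cancel]
    exact one_mem _
  by_cases h2 : k < l ∧ t = s (k + 1)
  · obtain ⟨h2, rfl⟩ := h2
    refine Or.inr (Or.inl ⟨h2, rfl, ?_⟩)
    unfold Q
    rw [dd, mul_assoc (dd s k) (s (k + 1)) (s (k + 1)), h.mul_self (by omega) (by omega), mul_one, mul_inv_cancel]
    exact one_mem _
  · exact Or.inr (Or.inr (mem_Par (h.dd_conj_mem hk ht (fun h3 h4 => h1 ⟨h3, h4⟩)
      fun h3 h4 => h2 ⟨h3, h4⟩)))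

theorem dd_succ_eq (h : Chain cs s l R) {m : ℕ} (hm : m < l) :
    dd s (m + 1) = s 1 * dd s l * dd s m * (dd s l)⁻¹ := by
  induction m with
  | zero => simp [dd]
  | succ m ih =>
    have := h.dd_shift (j := m + 1) (k := l) (by omega) hm le_rfl
    have e : (dd s l)⁻¹ * s (m + 1 + 1) = s (m + 1) * (dd s l)⁻¹ := by
      rw [inv_mul_eq_iff_eq_mul, ← mul_assoc, this, mul_inv_cancel_right]
    calc dd s (m + 1 + 1) = s 1 * dd s l * dd s m * ((dd s l)⁻¹ * s (m + 1 + 1)) := by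
          rw [← mul_assoc, ← ih (by omega)]; rfl
      _ = s 1 * dd s l * (dd s m * s (m + 1)) * (dd s l)⁻¹ := by rw [e]; simp only [mul_assoc]

theorem s_one_mul_dd_mem (h : Chain cs s l R) {k : ℕ} (h1 : 1 ≤ k) (hk : k ≤ l) :
    s 1 * dd s k ∈ Par ((CL s l R).erase (s 1)) := by
  induction k, h1 using Nat.le_induction with
  | base => simp [dd, h.mul_self le_rfl h.one_le]
  | succ k h1 ih =>
    rw [dd, ← mul_assoc]
    exact mul_mem (ih (by omega)) (mem_Par (h.mem_J (by omega) hk))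

theorem rot_cox (h : Chain cs s l R) : Rot s l R (dd s l)⁻¹ := by
  constructor
  · unfold Q
    rw [mul_inv_cancel, dd, inv_one, one_mul]
    exact one_mem _
  · intro k hk
    have := inv_mem (h.s_one_mul_dd_mem h.one_le le_rfl)
    unfold Q
    convert this using 1
    rw [h.dd_succ_eq hk]
    group

theorem rot_mul (h : Chain cs s l R) {x b : W} (hx : Rot s l R x) (hb : b ∈ Par R) :
    Rot s l R (x * b) :=
  ⟨(h.Q_of_mem_R hb (by omega)).trans hx.1,
    fun k hk => (h.Q_of_mem_R hb (by omega)).trans (hx.2 k hk)⟩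

theorem mem_Par_R_of_Q (h : Chain cs s l R) {u : W} (hu : u ∈ Par (CL s l R))
    (hQ : ∀ k ≤ l, Q s l R u k k) : u ∈ Par R := by
  have key : ∀ k ≤ l + 1, u ∈ Par (R ∪ (Icc (k + 1) l).image s) := by
    intro k hk
    induction k with
    | zero => exact hu
    | succ k ih =>
      have hKsub : R ∪ (Icc (k + 1) l).image s ⊆ CL s l R :=
        union_subset_union_right (image_subset_image (Icc_subset_Icc_left (by omega)))
      have hK := hKsub.trans h.CL_subset
      have hcomp : comp s k ⊆ Simples cs := (comp_mono (by omega)).trans h.comp_subset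
      have hR : RMin cs (R ∪ (Icc (k + 1) l).image s) (dd s k) := by
        rw [RMin_iff hK]
        intro t ht
        rcases mem_union.1 ht with ht' | ht'
        · refine refl01_eq_zero_of_not_mem hcomp (dd_mem s k) fun hc => ?_
          obtain ⟨j, h1, h2, rfl⟩ := mem_comp.1 (mem_of_mem_Par hcomp (hK ht) hc)
          exact h.notMem j h1 (by omega) ht'
        · obtain ⟨j, hj, rfl⟩ := mem_image.1 ht'
          rw [mem_Icc] at hj
          exact h.refl01_dd_succ (by omega) hj.2
      refine Par_mono ?_ (kilmoyer h.J_subset hK (h.LMin_dd (by omega)) hR (ih (by omega))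
        (hQ k (by omega)))
      intro t ht
      obtain ⟨h1, h2⟩ := mem_filter.1 ht
      rcases mem_union.1 h1 with h1 | h1
      · exact mem_union_left _ h1
      · obtain ⟨j, hj, rfl⟩ := mem_image.1 h1
        rw [mem_Icc] at hj
        refine mem_union_right _ (mem_image_of_mem _ (mem_Icc.2 ⟨?_, hj.2⟩))
        by_contra hc
        obtain rfl : j = k + 1 := by omega
        exact h.conj_not_mem (by omega) (mem_Par h2)
  have := key (l + 1) le_rfl
  rwa [Icc_eq_empty (by omega), image_empty, union_empty] at this

theorem mem_Par_R_of_commute (h : Chain cs s l R) {x u : W} (hx : Rot s l R x)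
    (hu : u ∈ Par (CL s l R)) (hc : u * x = x * u) (hQ : Q s l R u 0 0) : u ∈ Par R := by
  refine h.mem_Par_R_of_Q hu fun k hk => ?_
  have h1 := hx.pow hk
  have h2 := (h1.trans hQ).trans h1.inv
  have hc' : Commute u (x ^ k) := (show Commute u x from hc).pow_right k
  rwa [hc'.eq, inv_mul_cancel_left] at h2

theorem Q_lt_of_mem (h : Chain cs s l R) {j : ℕ} (hj1 : 1 ≤ j) (hj : j ≤ l) {b : W}
    (hb : b ∈ Par ((CL s l R).erase (s j))) {k : ℕ} (hk : k < j) :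
    ∃ m < j, Q s l R b k m := by
  have gen : ∀ t ∈ (CL s l R).erase (s j), ∀ k < j, ∃ m < j, Q s l R t k m := by
    intro t ht k hk
    obtain ⟨h1, h2⟩ := mem_erase.1 ht
    rcases h.Q_gen h2 (k := k) (by omega) with h3 | h3 | h3
    · exact ⟨k - 1, by omega, h3.2.2⟩
    · refine ⟨k + 1, ?_, h3.2.2⟩
      by_contra hc
      obtain rfl : j = k + 1 := by omega
      exact h1 h3.2.1
    · exact ⟨k, hk, h3⟩
  have key : ∀ v t, (∀ k < j, ∃ m < j, Q s l R v k m) → t ∈ (CL s l R).erase (s j) →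
      ∀ k < j, ∃ m < j, Q s l R (v * t) k m := by
    intro v t hv ht k hk
    obtain ⟨m, hm, h1⟩ := gen t ht k hk
    obtain ⟨n, hn, h2⟩ := hv m hm
    exact ⟨n, hn, h1.trans h2⟩
  refine Subgroup.closure_induction_right (p := fun b _ => ∀ k < j, ∃ m < j, Q s l R b k m)
    ?_ ?_ ?_ hb k hk
  · exact fun k hk => ⟨k, hk, Q_one k⟩
  · exact fun v _ t ht ih => key v t ih ht
  · intro v _ t ht ih
    rw [inv_of_mem (h.CL_subset (mem_of_mem_erase ht))]
    exact key v t ih ht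

/-- A full cycle is not conjugate into a proper parabolic subgroup. -/
theorem rot_conj_not_mem (h : Chain cs s l R) {x y : W} (hx : Rot s l R x)
    (hy : y ∈ Par (CL s l R)) {j : ℕ} (hj1 : 1 ≤ j) (hj : j ≤ l) :
    y⁻¹ * x * y ∉ Par ((CL s l R).erase (s j)) := by
  intro hb
  have step : ∀ m m', m ≤ l → m' ≤ l → Q s l R x m m' → (∃ k < j, Q s l R y k m) →
      ∃ k < j, Q s l R y k m' := by
    rintro m m' hm hm' h1 ⟨k, hk, h2⟩
    obtain ⟨k', hk', h3⟩ := h.Q_lt_of_mem hj1 hj hb hk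
    refine ⟨k', hk', ?_⟩
    have := h3.inv.trans (h2.trans h1)
    convert this using 1
    group
  have down : ∀ d m, m + d ≤ l → (∃ k < j, Q s l R y k (m + d)) → ∃ k < j, Q s l R y k m := by
    intro d
    induction d with
    | zero => exact fun m _ h => h
    | succ d ih =>
      intro m hm h1
      exact ih m (by omega) (step (m + d + 1) (m + d) (by omega) (by omega)
        (hx.2 _ (by omega)) h1)
  have all : ∀ m ≤ l, ∃ k < j, Q s l R y k m := by
    obtain ⟨m0, hm0, h0⟩ := h.exists_Q hy (k := 0) (by omega)
    have h1 := down m0 0 (by omega) ⟨0, hj1, by simpa using h0⟩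
    have h2 := step 0 l (by omega) le_rfl hx.1 h1
    intro m hm
    exact down (l - m) m (by omega) (by rwa [Nat.add_sub_cancel' hm])
  obtain ⟨m, hm, h1⟩ := h.exists_Q hy hj
  obtain ⟨k, hk, h2⟩ := all m hm
  have := h.Q_unique (x := y⁻¹) hj (by omega) h1.inv h2.inv
  omega

theorem majE_cox_mul_add (h : Chain cs s l R) {k : ℕ} (hk : k ≤ l) {a : W}
    (ha : a ∈ Par ((CL s l R).erase (s 1))) :
    majE cs s l ((dd s l)⁻¹ * (a * dd s k)) + k =
      majE cs s l (a * dd s k) + if k < l then k + 1 else 0 := by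
  obtain ⟨h1, h2, h3⟩ := h.refl01_cox_mul hk ha
  have e1 : k = ∑ j ∈ Icc 1 l, if j = k then k else 0 := by
    rw [sum_ite_eq']
    split_ifs with hc
    · rfl
    · rw [mem_Icc] at hc
      omega
  have e2 : (if k < l then k + 1 else 0) = ∑ j ∈ Icc 1 l, if j = k + 1 then k + 1 else 0 := by
    rw [sum_ite_eq']
    simp only [mem_Icc]
    congr 1
    exact propext (by omega)
  rw [e2]
  refine (congrArg (majE cs s l ((dd s l)⁻¹ * (a * dd s k)) + ·) e1).trans ?_
  rw [majE, majE, ← sum_add_distrib, ← sum_add_distrib]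
  refine sum_congr rfl fun j hj => ?_
  rw [mem_Icc] at hj
  by_cases hjk : j = k
  · subst hjk
    obtain ⟨h4, h5⟩ := h1 hj.1
    simp [h4, h5]
  by_cases hjk' : j = k + 1
  · subst hjk'
    obtain ⟨h4, h5⟩ := h2 (by omega)
    simp [h4, h5]
  · rw [h3 (s j) (mem_CL_of hj.1 hj.2)
      (fun h4 h5 => hjk (h.inj _ _ hj.1 hj.2 h4 hk h5))
      (fun h4 h5 => hjk' (h.inj _ _ hj.1 hj.2 (by omega) (by omega) h5))]
    simp [hjk, hjk']

theorem majE_cox_mul (h : Chain cs s l R) {w : W} (hw : w ∈ Par (CL s l R)) {ω : ℂ}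
    (hω : ω ^ (l + 1) = 1) :
    ω ^ majE cs s l ((dd s l)⁻¹ * w) = ω * ω ^ majE cs s l w := by
  obtain ⟨k, hk, a, ha, rfl⟩ := h.exists_dd hw
  have e := h.majE_cox_mul_add hk ha
  have hω0 : ω ≠ 0 := by
    rintro rfl
    simp at hω
  have e3 : ω ^ (if k < l then k + 1 else 0) = ω ^ (k + 1) := by
    split_ifs with hc
    · rfl
    · obtain rfl : k = l := by omega
      rw [hω, pow_zero]
  have e4 := congrArg (ω ^ ·) e
  simp only [pow_add] at e4
  rw [e3] at e4
  refine mul_right_cancel₀ (pow_ne_zero k hω0) (e4.trans ?_)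
  ring

theorem refl01_cox_mul_R (h : Chain cs s l R) {w r : W} (hw : w ∈ Par (CL s l R)) (hr : r ∈ R) :
    refl01 cs ((dd s l)⁻¹ * w) r = refl01 cs w r := by
  obtain ⟨k, hk, a, ha, rfl⟩ := h.exists_dd hw
  have h3 := (h.refl01_cox_mul hk ha).2.2
  refine h3 r (mem_CL.2 (Or.inl hr)) ?_ ?_
  · rintro h1 rfl
    exact h.notMem k h1 hk hr
  · rintro h1 rfl
    exact h.notMem (k + 1) (by omega) h1 hr

theorem comm_comp_R (h : Chain cs s l R) {x b : W} (hx : x ∈ Par (comp s l)) (hb : b ∈ Par R) :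
    x * b = b * x := by
  have h1 : Par R ≤ Subgroup.centralizer (comp s l : Set W) := by
    rw [Par, Subgroup.closure_le]
    intro r hr
    refine Subgroup.mem_centralizer_iff.2 fun t ht => ?_
    obtain ⟨j, h1, h2, rfl⟩ := mem_comp.1 (mem_coe.1 ht)
    exact h.commR j h1 h2 r hr
  have h2 : Par (comp s l) ≤ Subgroup.centralizer {b} := by
    rw [Par, Subgroup.closure_le]
    intro t ht
    refine Subgroup.mem_centralizer_iff.2 fun t' ht' => ?_
    rw [Set.mem_singleton_iff] at ht'
    subst ht'
    exact (Subgroup.mem_centralizer_iff.1 (h1 hb) t ht).symm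
  exact (Subgroup.mem_centralizer_iff.1 (h2 hx) b rfl).symm

/-- The longest element of the component reverses the chain. -/
theorem exists_flip (h : Chain cs s l R) : ∃ w ∈ Par (comp s l),
    (∀ j, 1 ≤ j → j ≤ l → refl01 cs w (s j) = 1 ∧ w * s j * w⁻¹ = s (l + 1 - j)) ∧
    ∀ r ∈ R, refl01 cs w r = 0 := by
  obtain ⟨w, hw, h1, h2⟩ := exists_longest h.comp_subset
  have hd : ∀ j, 1 ≤ j → j ≤ l → refl01 cs w (s j) = 1 := fun j hj1 hj =>
    h1 _ (mem_Par (mem_comp.2 ⟨j, hj1, hj, rfl⟩)) (isReflection_of_mem (h.mem j hj1 hj))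
  have hm : ∀ j, ∃ k, 1 ≤ j → j ≤ l → 1 ≤ k ∧ k ≤ l ∧ s k = w * s j * w⁻¹ := by
    intro j
    by_cases hj : 1 ≤ j ∧ j ≤ l
    · obtain ⟨k, h3⟩ := mem_comp.1 (conj_longest_mem h.comp_subset hw h1
        (mem_comp.2 ⟨j, hj.1, hj.2, rfl⟩))
      exact ⟨k, fun _ _ => h3⟩
    · exact ⟨0, fun h1 h2 => absurd ⟨h1, h2⟩ hj⟩
  choose k hk using hm
  have hinj : ∀ i j, 1 ≤ i → i ≤ l → 1 ≤ j → j ≤ l → k i = k j → i = j := by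
    intro i j hi1 hi hj1 hj e
    have e1 := (hk i hi1 hi).2.2
    rw [e, (hk j hj1 hj).2.2] at e1
    exact (h.inj _ _ hj1 hj hi1 hi (by simpa using e1)).symm
  have hpath : ∀ j, 1 ≤ j → j < l → k (j + 1) = k j + 1 ∨ k j = k (j + 1) + 1 := by
    intro j hj1 hj
    obtain ⟨a1, a2, a3⟩ := hk j hj1 hj.le
    obtain ⟨b1, b2, b3⟩ := hk (j + 1) (by omega) hj
    refine (h.ncomm_iff a1 a2 b1 b2).1 ?_
    rw [a3, b3]
    intro e
    refine h.ncomm hj1 hj ?_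
    exact comm_of_conj e
  have hlast : k l = 1 := by
    obtain ⟨a1, a2, a3⟩ := hk l h.one_le le_rfl
    obtain ⟨m, hm, a, ha, e⟩ := h.exists_dd (Par_mono (subset_union_right (s₁ := R)) hw)
    obtain rfl : m = l := by
      by_contra hc
      have := h.refl01_mul_dd_succ (k := m) (by omega) ha
      rw [← e, hd _ (by omega) (by omega)] at this
      exact one_ne_zero this
    by_contra hc
    have h3 : s (k m) ∈ Par ((CL s m R).erase (s 1)) := mem_Par (h.mem_J (by omega) a2)
    rw [a3, e] at h3
    refine h.conj_not_mem' h.one_le le_rfl ?_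
    have := mul_mem (mul_mem (inv_mem ha) h3) ha
    convert this using 1
    group
  refine ⟨w, hw, fun j hj1 hj => ⟨hd j hj1 hj, ?_⟩, fun r hr => h2 r fun hc => ?_⟩
  · rw [← (hk j hj1 hj).2.2]
    congr 1
    have := (hk 1 le_rfl h.one_le).1
    rcases path_cases h.one_le hinj hpath with h3 | h3
    · have e1 := h3 l h.one_le le_rfl
      have e2 := h3 j hj1 hj
      omega
    · have e1 := h3 l h.one_le le_rfl
      have e2 := h3 j hj1 hj
      omega
  · obtain ⟨j, h3, h4, rfl⟩ := mem_comp.1 (mem_of_mem_Par h.comp_subset (h.subset hr) hc)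
    exact h.notMem j h3 h4 hr

variable {s' : ℕ → W} {l' : ℕ} {R' : Finset W}

theorem conj_mem_comp (h : Chain cs s l R) (h' : Chain cs s' l' R') {n : W}
    (hn : ∀ t ∈ comp s l, n * t * n⁻¹ ∈ CL s' l' R') {i : ℕ} (hi1 : 1 ≤ i) (hi : i ≤ l)
    (hs : n * s i * n⁻¹ ∈ comp s' l') {j : ℕ} (hj1 : 1 ≤ j) (hj : j ≤ l) :
    n * s j * n⁻¹ ∈ comp s' l' := by
  have step : ∀ a b, 1 ≤ a → a ≤ l → 1 ≤ b → b ≤ l → s a * s b ≠ s b * s a →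
      n * s a * n⁻¹ ∈ comp s' l' → n * s b * n⁻¹ ∈ comp s' l' := by
    intro a b ha1 ha hb1 hb hab h1
    refine (mem_union.1 (hn (s b) (mem_comp.2 ⟨b, hb1, hb, rfl⟩))).resolve_left fun h2 => hab ?_
    have := h'.comm_comp_R (mem_Par h1) (mem_Par h2)
    exact comm_of_conj this
  have down : ∀ a, 1 ≤ a → a ≤ l → n * s a * n⁻¹ ∈ comp s' l' → n * s 1 * n⁻¹ ∈ comp s' l' := by
    intro a ha1
    induction a, ha1 using Nat.le_induction with
    | base => exact fun _ h => h
    | succ a ha1 ih =>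
      exact fun ha h1 => ih (by omega) (step _ _ (by omega) ha ha1 (by omega)
        (h.ncomm ha1 (by omega)).symm h1)
  induction j, hj1 using Nat.le_induction with
  | base => exact down i hi1 hi hs
  | succ j hj1 ih =>
    exact step _ _ hj1 (by omega) (by omega) hj (h.ncomm hj1 (by omega)) (ih (by omega))

theorem exists_path (h : Chain cs s l R) (h' : Chain cs s' l' R') {n : W}
    (hs : ∀ j, 1 ≤ j → j ≤ l → n * s j * n⁻¹ ∈ comp s' l') :
    ∃ k : ℕ → ℕ, (∀ j, 1 ≤ j → j ≤ l → 1 ≤ k j ∧ k j ≤ l' ∧ s' (k j) = n * s j * n⁻¹) ∧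
      ((∀ j, 1 ≤ j → j ≤ l → k j + 1 = k 1 + j) ∨ (∀ j, 1 ≤ j → j ≤ l → k j + j = k 1 + 1)) := by
  have hm : ∀ j, ∃ k, 1 ≤ j → j ≤ l → 1 ≤ k ∧ k ≤ l' ∧ s' k = n * s j * n⁻¹ := by
    intro j
    by_cases hj : 1 ≤ j ∧ j ≤ l
    · obtain ⟨k, h3⟩ := mem_comp.1 (hs j hj.1 hj.2)
      exact ⟨k, fun _ _ => h3⟩
    · exact ⟨0, fun h1 h2 => absurd ⟨h1, h2⟩ hj⟩
  choose k hk using hm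
  refine ⟨k, hk, path_cases h.one_le ?_ ?_⟩
  · intro i j hi1 hi hj1 hj e
    have e1 := (hk i hi1 hi).2.2
    rw [e, (hk j hj1 hj).2.2] at e1
    exact (h.inj _ _ hj1 hj hi1 hi (by simpa using e1)).symm
  · intro j hj1 hj
    obtain ⟨a1, a2, a3⟩ := hk j hj1 hj.le
    obtain ⟨b1, b2, b3⟩ := hk (j + 1) (by omega) hj
    refine (h'.ncomm_iff a1 a2 b1 b2).1 ?_
    rw [a3, b3]
    intro e
    refine h.ncomm hj1 hj ?_
    exact comm_of_conj e

theorem le_of_path (h : Chain cs s l R) (h' : Chain cs s' l' R') {n : W}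
    (hs : ∀ j, 1 ≤ j → j ≤ l → n * s j * n⁻¹ ∈ comp s' l') : l ≤ l' := by
  obtain ⟨k, hk, h1⟩ := h.exists_path h' hs
  have a := hk 1 le_rfl h.one_le
  have b := hk l h.one_le le_rfl
  rcases h1 with h1 | h1
  · have := h1 l h.one_le le_rfl
    omega
  · have := h1 l h.one_le le_rfl
    omega

/-- An element permuting the simple reflections maps chains to chains, up to reversal. -/
theorem conj_cases (h : Chain cs s l R) (h' : Chain cs s' l' R') {n : W}
    (hn : ∀ t ∈ comp s l, n * t * n⁻¹ ∈ CL s' l' R')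
    (hn' : ∀ t ∈ comp s' l', n⁻¹ * t * n ∈ CL s l R)
    (hs : n * s 1 * n⁻¹ ∈ comp s' l') :
    l = l' ∧ ((∀ j, 1 ≤ j → j ≤ l → n * s j * n⁻¹ = s' j) ∨
      (∀ j, 1 ≤ j → j ≤ l → n * s j * n⁻¹ = s' (l + 1 - j))) := by
  have hs1 : ∀ j, 1 ≤ j → j ≤ l → n * s j * n⁻¹ ∈ comp s' l' :=
    fun j h1 h2 => h.conj_mem_comp h' hn le_rfl h.one_le hs h1 h2
  obtain ⟨k0, a1, a2, a3⟩ := mem_comp.1 hs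
  have hs2 : ∀ j, 1 ≤ j → j ≤ l' → n⁻¹ * s' j * n⁻¹⁻¹ ∈ comp s l := by
    refine fun j h1 h2 => h'.conj_mem_comp h (by simpa using hn') a1 a2 ?_ h1 h2
    rw [a3]
    refine mem_comp.2 ⟨1, le_rfl, h.one_le, by group⟩
  have e : l = l' := le_antisymm (h.le_of_path h' hs1) (h'.le_of_path h hs2)
  subst e
  refine ⟨rfl, ?_⟩
  obtain ⟨k, hk, h1⟩ := h.exists_path h' hs1
  have a := hk 1 le_rfl h.one_le
  have b := hk l h.one_le le_rfl
  rcases h1 with h1 | h1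
  · left
    intro j hj1 hj
    rw [← (hk j hj1 hj).2.2]
    congr 1
    have c1 := h1 l h.one_le le_rfl
    have c2 := h1 j hj1 hj
    omega
  · right
    intro j hj1 hj
    rw [← (hk j hj1 hj).2.2]
    congr 1
    have c1 := h1 l h.one_le le_rfl
    have c2 := h1 j hj1 hj
    omega

end Chain

/-! ### Parabolic subgroups with all components of type `A` -/

/-- The union of the chains. -/
def LL (p : ℕ) (l : ℕ → ℕ) (sg : ℕ → ℕ → W) : Finset W :=
  (range p).biUnion fun i => comp (sg i) (l i)

/-- The union of the chains other than the `i`-th one. -/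
def RR (p : ℕ) (l : ℕ → ℕ) (sg : ℕ → ℕ → W) (i : ℕ) : Finset W :=
  ((range p).erase i).biUnion fun k => comp (sg k) (l k)

/-- The sets `{sg i 1, …, sg i (l i)}` are the components of their union. -/
def TypeA (cs : CoxeterSystem M W) (p : ℕ) (l : ℕ → ℕ) (sg : ℕ → ℕ → W) : Prop :=
  ∀ i < p, Chain cs (sg i) (l i) (RR p l sg i)

/-- The ordered product `f 0 * ⋯ * f (p - 1)`. -/
def PP (p : ℕ) (f : ℕ → W) : W := ((List.range p).map f).prod

theorem mul_comm_of_orderOf {x y : W} (hx : x * x = 1) (hy : y * y = 1)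
    (h : orderOf (x * y) = 2) : x * y = y * x ∧ x ≠ y := by
  constructor
  · have h1 := pow_orderOf_eq_one (x * y)
    rw [h, sq] at h1
    rw [eq_inv_of_mul_eq_one_left h1, mul_inv_rev, inv_eq_of_mul_eq_one_left hx,
      inv_eq_of_mul_eq_one_left hy]
  · rintro rfl
    rw [hx, orderOf_one] at h
    omega

theorem braid_of_orderOf {x y : W} (hx : x * x = 1) (hy : y * y = 1)
    (h : orderOf (x * y) = 3) : x * y * x = y * x * y ∧ x ≠ y := by
  constructor
  · have h1 := pow_orderOf_eq_one (x * y)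
    rw [h, pow_succ, sq] at h1
    have h2 : x * y * x * (y * x * y) = 1 := by simpa only [mul_assoc] using h1
    rw [eq_inv_of_mul_eq_one_left h2, mul_inv_rev, mul_inv_rev, inv_eq_of_mul_eq_one_left hx,
      inv_eq_of_mul_eq_one_left hy, mul_assoc]
  · rintro rfl
    rw [hx, orderOf_one] at h
    omega

theorem typeA_of_orderOf {cs : CoxeterSystem M W} {p : ℕ} {l : ℕ → ℕ} (hl : ∀ i < p, 1 ≤ l i)
    {sg : ℕ → ℕ → W} (hsgS : ∀ i < p, ∀ j, 1 ≤ j → j ≤ l i → sg i j ∈ Simples cs)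
    (horder3 : ∀ i < p, ∀ j, 1 ≤ j → j < l i → orderOf (sg i j * sg i (j + 1)) = 3)
    (horder2 : ∀ i < p, ∀ i' < p, ∀ j j', 1 ≤ j → j ≤ l i → 1 ≤ j' → j' ≤ l i' →
      ¬(i = i' ∧ (j' = j + 1 ∨ j = j' + 1)) → (i ≠ i' ∨ j ≠ j') →
      orderOf (sg i j * sg i' j') = 2) : TypeA cs p l sg := by
  have hinv : ∀ i < p, ∀ j, 1 ≤ j → j ≤ l i → sg i j * sg i j = 1 :=
    fun i hi j h1 h2 => mul_self_of_mem (hsgS i hi j h1 h2)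
  have h2 : ∀ i < p, ∀ i' < p, ∀ j j', 1 ≤ j → j ≤ l i → 1 ≤ j' → j' ≤ l i' →
      ¬(i = i' ∧ (j' = j + 1 ∨ j = j' + 1)) → (i ≠ i' ∨ j ≠ j') →
      sg i j * sg i' j' = sg i' j' * sg i j ∧ sg i j ≠ sg i' j' :=
    fun i hi i' hi' j j' a1 a2 a3 a4 a5 a6 => mul_comm_of_orderOf (hinv i hi j a1 a2)
      (hinv i' hi' j' a3 a4) (horder2 i hi i' hi' j j' a1 a2 a3 a4 a5 a6)
  have h3 : ∀ i < p, ∀ j, 1 ≤ j → j < l i → sg i j * sg i (j + 1) * sg i j =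
      sg i (j + 1) * sg i j * sg i (j + 1) ∧ sg i j ≠ sg i (j + 1) :=
    fun i hi j a1 a2 => braid_of_orderOf (hinv i hi j a1 a2.le)
      (hinv i hi (j + 1) (by omega) a2) (horder3 i hi j a1 a2)
  have hR : ∀ i t, t ∈ RR p l sg i → ∃ i' < p, i' ≠ i ∧ ∃ j, 1 ≤ j ∧ j ≤ l i' ∧ sg i' j = t := by
    intro i t ht
    obtain ⟨i', hi', h⟩ := mem_biUnion.1 ht
    exact ⟨i', mem_range.1 (mem_of_mem_erase hi'), ne_of_mem_erase hi', mem_comp.1 h⟩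
  intro i hi
  refine ⟨hl i hi, hsgS i hi, ?_, ?_, ?_, fun j a1 a2 => (h3 i hi j a1 a2).1, ?_, ?_⟩
  · intro t ht
    obtain ⟨i', hi', -, j, a1, a2, rfl⟩ := hR i t ht
    exact hsgS i' hi' j a1 a2
  · intro j k a1 a2 a3 a4 e
    by_contra hne
    by_cases c1 : k = j + 1
    · subst c1
      exact (h3 i hi j a1 (by omega)).2 e
    by_cases c2 : j = k + 1
    · subst c2
      exact (h3 i hi k a3 (by omega)).2 e.symm
    · exact (h2 i hi i hi j k a1 a2 a3 a4 (by tauto) (Or.inr hne)).2 e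
  · intro j a1 a2 ht
    obtain ⟨i', hi', hne, j', a3, a4, e⟩ := hR i _ ht
    exact (h2 i' hi' i hi j' j a3 a4 a1 a2 (by tauto) (Or.inl hne)).2 e
  · exact fun j k a1 a2 a3 => (h2 i hi i hi j k a1 (by omega) (by omega) a3 (by omega)
      (by omega)).1
  · intro j a1 a2 r hr
    obtain ⟨i', hi', hne, j', a3, a4, rfl⟩ := hR i _ hr
    exact (h2 i hi i' hi' j j' a1 a2 a3 a4 (fun h => hne h.1.symm) (Or.inl hne.symm)).1

theorem mem_LL {p : ℕ} {l : ℕ → ℕ} {sg : ℕ → ℕ → W} {t : W} :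
    t ∈ LL p l sg ↔ ∃ i < p, ∃ j, 1 ≤ j ∧ j ≤ l i ∧ sg i j = t := by
  simp [LL, mem_comp]

theorem comp_subset_RR {p : ℕ} {l : ℕ → ℕ} {sg : ℕ → ℕ → W} {i i' : ℕ} (hi' : i' < p)
    (h : i' ≠ i) : comp (sg i') (l i') ⊆ RR p l sg i :=
  subset_biUnion_of_mem (fun i' => comp (sg i') (l i')) (mem_erase.2 ⟨h, mem_range.2 hi'⟩)

theorem comp_subset_LL {p : ℕ} {l : ℕ → ℕ} {sg : ℕ → ℕ → W} {i : ℕ} (hi : i < p) :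
    comp (sg i) (l i) ⊆ LL p l sg :=
  subset_biUnion_of_mem (fun i' => comp (sg i') (l i')) (mem_range.2 hi)

theorem RR_subset_LL {p : ℕ} {l : ℕ → ℕ} {sg : ℕ → ℕ → W} {i : ℕ} :
    RR p l sg i ⊆ LL p l sg := biUnion_subset_biUnion_of_subset_left _ (erase_subset _ _)

theorem CL_eq_LL {p : ℕ} {l : ℕ → ℕ} {sg : ℕ → ℕ → W} {i : ℕ} (hi : i < p) :
    CL (sg i) (l i) (RR p l sg i) = LL p l sg := by
  refine subset_antisymm (union_subset RR_subset_LL (comp_subset_LL hi)) fun t ht => ?_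
  obtain ⟨i', hi', h⟩ := mem_biUnion.1 ht
  by_cases e : i' = i
  · subst e
    exact mem_union_right _ h
  · exact mem_union_left _ (comp_subset_RR (mem_range.1 hi') e h)

theorem PP_mem {p : ℕ} {f : ℕ → W} {H : Subgroup W} (h : ∀ i < p, f i ∈ H) : PP p f ∈ H := by
  refine H.list_prod_mem fun x hx => ?_
  obtain ⟨i, hi, rfl⟩ := List.mem_map.1 hx
  exact h i (List.mem_range.1 hi)

theorem PP_succ (p : ℕ) (f : ℕ → W) : PP (p + 1) f = PP p f * f p := by
  simp [PP, List.range_succ]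

namespace TypeA

variable {cs : CoxeterSystem M W} {p : ℕ} {l : ℕ → ℕ} {sg : ℕ → ℕ → W}

theorem subset (h : TypeA cs p l sg) : LL p l sg ⊆ Simples cs := by
  intro t ht
  obtain ⟨i, hi, j, h1, h2, rfl⟩ := mem_LL.1 ht
  exact (h i hi).mem j h1 h2

theorem sg_notMem_RR (h : TypeA cs p l sg) {i : ℕ} (hi : i < p) {j : ℕ} (h1 : 1 ≤ j)
    (h2 : j ≤ l i) : sg i j ∉ Par (RR p l sg i) := fun hc =>
  (h i hi).notMem j h1 h2 (mem_of_mem_Par (h i hi).subset ((h i hi).mem j h1 h2) hc)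

theorem comm_of_ne (h : TypeA cs p l sg) {i i' : ℕ} (hi : i < p) (hi' : i' < p) (hne : i ≠ i')
    {x y : W} (hx : x ∈ Par (comp (sg i) (l i))) (hy : y ∈ Par (comp (sg i') (l i'))) :
    x * y = y * x :=
  (h i hi).comm_comp_R hx (Par_mono (comp_subset_RR hi' hne.symm) hy)

theorem PP_split (h : TypeA cs p l sg) {f : ℕ → W} (hf : ∀ i < p, f i ∈ Par (comp (sg i) (l i)))
    {i : ℕ} (hi : i < p) : ∃ b ∈ Par (RR p l sg i), PP p f = f i * b := by
  have key : ∀ q ≤ p, ∃ b ∈ Par (RR p l sg i), PP q f = (if i < q then f i else 1) * b := by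
    intro q hq
    induction q with
    | zero => exact ⟨1, one_mem _, by simp [PP]⟩
    | succ q ih =>
      obtain ⟨b, hb, e⟩ := ih (by omega)
      rcases eq_or_ne q i with rfl | hne
      · refine ⟨b, hb, ?_⟩
        rw [PP_succ, e, if_neg (by omega), if_pos (by omega), one_mul,
          (h q hi).comm_comp_R (hf q hi) hb]
      · refine ⟨b * f q, mul_mem hb (Par_mono (comp_subset_RR (by omega) hne) (hf q (by omega))), ?_⟩
        rw [PP_succ, e, mul_assoc]
        congr 2
        exact propext (by omega)
  obtain ⟨b, hb, e⟩ := key p le_rfl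
  exact ⟨b, hb, by rw [e, if_pos hi]⟩

/-- The Coxeter element of the `i`-th component. -/
def ci (l : ℕ → ℕ) (sg : ℕ → ℕ → W) (i : ℕ) : W := (dd (sg i) (l i))⁻¹

theorem ci_mem (l : ℕ → ℕ) (sg : ℕ → ℕ → W) (i : ℕ) : ci l sg i ∈ Par (comp (sg i) (l i)) :=
  inv_mem (Chain.dd_mem _ _)

theorem rot_PP_ci (h : TypeA cs p l sg) {i : ℕ} (hi : i < p) :
    Rot (sg i) (l i) (RR p l sg i) (PP p (ci l sg)) := by
  obtain ⟨b, hb, e⟩ := h.PP_split (fun i _ => ci_mem l sg i) hi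
  rw [e]
  exact (h i hi).rot_mul (h i hi).rot_cox hb

theorem PP_mem_LL {f : ℕ → W} (hf : ∀ i < p, f i ∈ Par (comp (sg i) (l i))) :
    PP p f ∈ Par (LL p l sg) :=
  PP_mem fun i hi => Par_mono (comp_subset_LL hi) (hf i hi)

theorem PP_comm (h : TypeA cs p l sg) {f g : ℕ → W} (hf : ∀ i < p, f i ∈ Par (comp (sg i) (l i)))
    (hg : ∀ i < p, g i ∈ Par (comp (sg i) (l i))) (hfg : ∀ i < p, f i * g i = g i * f i) :
    PP p f * PP p g = PP p g * PP p f := by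
  have h1 : ∀ i < p, Commute (f i) (PP p g) := by
    intro i hi
    obtain ⟨b, hb, e⟩ := h.PP_split hg hi
    rw [e]
    exact Commute.mul_right (hfg i hi) ((h i hi).comm_comp_R (hf i hi) hb)
  have : PP p f ∈ Subgroup.centralizer {PP p g} := PP_mem fun i hi =>
    Subgroup.mem_centralizer_iff.2 fun x hx => by
      rw [Set.mem_singleton_iff.1 hx]; exact (h1 i hi).eq.symm
  exact (Subgroup.mem_centralizer_iff.1 this _ rfl).symm

/-- The products of powers of the `c_i`. -/
def yy (p : ℕ) (l : ℕ → ℕ) (sg : ℕ → ℕ → W) (m : ℕ → ℕ) : W :=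
  PP p fun i => (ci l sg i ^ m i)⁻¹

theorem yy_mem (p : ℕ) (l : ℕ → ℕ) (sg : ℕ → ℕ → W) (m : ℕ → ℕ) :
    yy p l sg m ∈ Par (LL p l sg) :=
  PP_mem_LL fun i _ => inv_mem (pow_mem (ci_mem l sg i) _)

theorem yy_comm (h : TypeA cs p l sg) (m : ℕ → ℕ) :
    yy p l sg m * PP p (ci l sg) = PP p (ci l sg) * yy p l sg m :=
  h.PP_comm (fun i _ => inv_mem (pow_mem (ci_mem l sg i) _)) (fun i _ => ci_mem l sg i)
    fun i _ => ((Commute.refl (ci l sg i)).pow_left (m i)).inv_left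

theorem Q_yy (h : TypeA cs p l sg) {m : ℕ → ℕ} {i : ℕ} (hi : i < p) (hm : m i ≤ l i) :
    Q (sg i) (l i) (RR p l sg i) (yy p l sg m) 0 (m i) := by
  obtain ⟨b, hb, e⟩ := h.PP_split (fun i _ => inv_mem (pow_mem (ci_mem l sg i) (m i))) hi
  rw [yy, e]
  exact ((h i hi).Q_of_mem_R hb (by omega)).trans ((h i hi).rot_cox.pow hm).inv

theorem yy_injective (h : TypeA cs p l sg) {m m' : ℕ → ℕ} (hm : ∀ i < p, m i ≤ l i)
    (hm' : ∀ i < p, m' i ≤ l i) (e : yy p l sg m = yy p l sg m') {i : ℕ} (hi : i < p) :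
    m i = m' i :=
  (h i hi).Q_unique (hm i hi) (hm' i hi) (h.Q_yy hi (hm i hi)) (e ▸ h.Q_yy hi (hm' i hi))

theorem eq_one_of_mem (h : TypeA cs p l sg) {u : W} (hu : u ∈ Par (LL p l sg))
    (hR : ∀ i < p, u ∈ Par (RR p l sg i)) : u = 1 := by
  refine RMin.eq_one h.subset ((RMin_iff h.subset).2 fun s hs => ?_) hu
  obtain ⟨i, hi, j, h1, h2, rfl⟩ := mem_LL.1 hs
  exact refl01_eq_zero_of_not_mem (h i hi).subset (hR i hi) (h.sg_notMem_RR hi h1 h2)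

/-- The centralizer of the Coxeter element inside the parabolic subgroup. -/
theorem exists_yy (h : TypeA cs p l sg) {x : W} (hx : x ∈ Par (LL p l sg))
    (hc : x * PP p (ci l sg) = PP p (ci l sg) * x) :
    ∃ m : ℕ → ℕ, (∀ i < p, m i ≤ l i) ∧ x = yy p l sg m := by
  have h1 : ∀ i, ∃ k, i < p → k ≤ l i ∧ Q (sg i) (l i) (RR p l sg i) x 0 k := by
    intro i
    by_cases hi : i < p
    · obtain ⟨k, hk⟩ := (h i hi).exists_Q (x := x) (by rwa [CL_eq_LL hi]) (Nat.zero_le _)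
      exact ⟨k, fun _ => hk⟩
    · exact ⟨0, fun h => absurd h hi⟩
  choose m hm using h1
  refine ⟨m, fun i hi => (hm i hi).1, ?_⟩
  have hu := mul_mem (inv_mem (yy_mem p l sg m)) hx
  have hcu : (yy p l sg m)⁻¹ * x * PP p (ci l sg) = PP p (ci l sg) * ((yy p l sg m)⁻¹ * x) :=
    (Commute.mul_left (Commute.inv_left (h.yy_comm m)) hc).eq
  have : (yy p l sg m)⁻¹ * x = 1 := h.eq_one_of_mem hu fun i hi =>
    (h i hi).mem_Par_R_of_commute (h.rot_PP_ci hi) (by rwa [CL_eq_LL hi]) hcu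
      ((hm i hi).2.trans (h.Q_yy hi (hm i hi).1).inv)
  exact (inv_mul_eq_one.1 this).symm

/-- The centralizer of the Coxeter element normalizes the parabolic subgroup. -/
theorem exists_NL_mul (h : TypeA cs p l sg) {z : W}
    (hz : z * PP p (ci l sg) = PP p (ci l sg) * z) :
    ∃ n ∈ NL cs (LL p l sg), ∃ u ∈ Par (LL p l sg), z = n * u := by
  have hL := h.subset
  obtain ⟨u, b, hb, rfl, hu⟩ := exists_RMin hL z
  obtain ⟨d, a, ha, rfl, hd⟩ := exists_LMin hL u
  have hd' := ((RMin_mackey hL hL ha hd).1 hu).1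
  have hcm : PP p (ci l sg) ∈ Par (LL p l sg) := PP_mem_LL fun i _ => ci_mem l sg i
  have h1 : d * (b * PP p (ci l sg) * b⁻¹) * d⁻¹ ∈ Par (LL p l sg) := by
    have : d * (b * PP p (ci l sg) * b⁻¹) * d⁻¹ = a⁻¹ * PP p (ci l sg) * a := by
      have : d * (b * PP p (ci l sg) * b⁻¹) * d⁻¹ =
        a⁻¹ * (a * d * b * PP p (ci l sg)) * b⁻¹ * d⁻¹ := by group
      rw [this, hz]
      group
    rw [this]
    exact mul_mem (mul_mem (inv_mem ha) hcm) ha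
  have h2 := kilmoyer hL hL hd hd' (mul_mem (mul_mem hb hcm) (inv_mem hb)) h1
  have h3 : ∀ t ∈ LL p l sg, d * t * d⁻¹ ∈ LL p l sg := by
    intro t ht
    by_contra hc
    obtain ⟨i, hi, j, h4, h5, rfl⟩ := mem_LL.1 ht
    refine (h i hi).rot_conj_not_mem (y := b⁻¹) (h.rot_PP_ci hi)
      (by rw [CL_eq_LL hi]; exact inv_mem hb) h4 h5 ?_
    rw [CL_eq_LL hi, inv_inv]
    refine Par_mono (fun s hs => ?_) h2
    obtain ⟨h6, h7⟩ := mem_filter.1 hs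
    exact mem_erase.2 ⟨by rintro rfl; exact hc h7, h6⟩
  have h4 : conjF d (LL p l sg) = LL p l sg := by
    refine eq_of_subset_of_card_le ?_ (card_conjF _ _).ge
    intro t ht
    obtain ⟨s, hs, rfl⟩ := mem_image.1 ht
    exact h3 s hs
  refine ⟨d, mem_NL.2 ⟨hd', h4⟩, d⁻¹ * a * d * b, mul_mem ?_ hb, by group⟩
  rw [← conj_mem_Par_iff (w := d), h4]
  convert ha using 1
  group

end TypeA

/-! ### The normalizer and the Coxeter element -/

/-- `z` permutes the chains, preserving their order, via `π`. -/
def Equivariant (p : ℕ) (l : ℕ → ℕ) (sg : ℕ → ℕ → W) (π : ℕ → ℕ) (z : W) : Prop :=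
  ∀ i < p, π i < p ∧ l (π i) = l i ∧ ∀ j, 1 ≤ j → j ≤ l i → z * sg i j * z⁻¹ = sg (π i) j

namespace TypeA

variable {cs : CoxeterSystem M W} {p : ℕ} {l : ℕ → ℕ} {sg : ℕ → ℕ → W}

theorem exists_equivariant (h : TypeA cs p l sg) {fl : ℕ → W}
    (hfl : ∀ i < p, fl i ∈ Par (comp (sg i) (l i)) ∧
      ∀ j, 1 ≤ j → j ≤ l i → fl i * sg i j * (fl i)⁻¹ = sg i (l i + 1 - j))
    {n : W} (hn : n ∈ NL cs (LL p l sg)) :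
    ∃ (T : ℕ → Prop) (π : ℕ → ℕ),
      Equivariant p l sg π (n * PP p fun i => if T i then fl i else 1) := by
  have hn2 := (mem_NL.1 hn).2
  have h1 : ∀ t ∈ LL p l sg, n * t * n⁻¹ ∈ LL p l sg := fun t ht => by
    have := mem_image_of_mem (fun s => n * s * n⁻¹) ht
    rwa [← conjF, hn2] at this
  have h2 : ∀ t ∈ LL p l sg, n⁻¹ * t * n ∈ LL p l sg := fun t ht => by
    rw [← hn2] at ht
    obtain ⟨s, hs, rfl⟩ := mem_image.1 ht
    convert hs using 1
    group
  have h3 : ∀ i, ∃ k, i < p → k < p ∧ l k = l i ∧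
      ((∀ j, 1 ≤ j → j ≤ l i → n * sg i j * n⁻¹ = sg k j) ∨
      (∀ j, 1 ≤ j → j ≤ l i → n * sg i j * n⁻¹ = sg k (l i + 1 - j))) := by
    intro i
    by_cases hi : i < p
    · obtain ⟨k, hk, hk2⟩ := mem_biUnion.1 (h1 _ (mem_LL.2 ⟨i, hi, 1, le_rfl, (h i hi).one_le, rfl⟩))
      rw [mem_range] at hk
      obtain ⟨e, h4⟩ := (h i hi).conj_cases (h k hk)
        (fun t ht => by rw [CL_eq_LL hk]; exact h1 t (comp_subset_LL hi ht))
        (fun t ht => by rw [CL_eq_LL hi]; exact h2 t (comp_subset_LL hk ht)) hk2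
      exact ⟨k, fun _ => ⟨hk, e.symm, h4⟩⟩
    · exact ⟨0, fun h => absurd h hi⟩
  choose π hπ using h3
  obtain ⟨T, hT⟩ : ∃ T : ℕ → Prop, ∀ i, T i ↔
    ¬ ∀ j, 1 ≤ j → j ≤ l i → n * sg i j * n⁻¹ = sg (π i) j := ⟨_, fun _ => Iff.rfl⟩
  refine ⟨T, π, fun i hi => ?_⟩
  obtain ⟨a1, a2, a3⟩ := hπ i hi
  refine ⟨a1, a2, fun j hj1 hj => ?_⟩
  obtain ⟨b, hb, e⟩ := h.PP_split (f := fun i => if T i then fl i else 1) (fun i hi => by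
      split_ifs
      · exact (hfl i hi).1
      · exact one_mem _) hi
  have e2 : b * sg i j * b⁻¹ = sg i j := by
    rw [← (h i hi).comm_comp_R (mem_Par (mem_comp.2 ⟨j, hj1, hj, rfl⟩)) hb, mul_inv_cancel_right]
  have e3 : ∀ x : W, n * (x * b) * sg i j * (n * (x * b))⁻¹ =
      n * (x * (b * sg i j * b⁻¹) * x⁻¹) * n⁻¹ := fun x => by group
  rw [e, e3, e2]
  by_cases hTi : T i
  · rw [if_pos hTi, (hfl i hi).2 j hj1 hj, (a3.resolve_left ((hT i).1 hTi)) _ (by omega) (by omega)]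
    congr 1
    omega
  · rw [if_neg hTi]
    rw [hT, not_not] at hTi
    simpa using hTi j hj1 hj

theorem equivariant_injOn (h : TypeA cs p l sg) {π : ℕ → ℕ} {z : W}
    (hz : Equivariant p l sg π z) : Set.InjOn π (range p : Finset ℕ) := by
  intro i hi i' hi' e
  rw [mem_coe, mem_range] at hi hi'
  by_contra hne
  have h1 := (hz i hi).2.2 1 le_rfl (h i hi).one_le
  rw [e, ← (hz i' hi').2.2 1 le_rfl (h i' hi').one_le] at h1
  have h2 : sg i 1 = sg i' 1 := by simpa using h1
  refine (h i hi).notMem 1 le_rfl (h i hi).one_le (h2 ▸ ?_)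
  exact comp_subset_RR hi' (Ne.symm hne) (mem_comp.2 ⟨1, le_rfl, (h i' hi').one_le, rfl⟩)

theorem conj_dd {s s' : ℕ → W} {z : W} {k : ℕ} (h : ∀ j, 1 ≤ j → j ≤ k → z * s j * z⁻¹ = s' j) :
    z * dd s k * z⁻¹ = dd s' k := by
  induction k with
  | zero => simp [dd]
  | succ k ih =>
    rw [dd, dd, ← ih fun j h1 h2 => h j h1 (by omega), ← h (k + 1) (by omega) le_rfl]
    group

theorem equivariant_comm (h : TypeA cs p l sg) {π : ℕ → ℕ} {z : W}
    (hz : Equivariant p l sg π z) : z * PP p (ci l sg) = PP p (ci l sg) * z := by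
  have h1 : z * PP p (ci l sg) * z⁻¹ = PP p (fun i => ci l sg (π i)) := by
    rw [← MulAut.conj_apply, PP, PP, map_list_prod, List.map_map]
    congr 1
    refine List.map_congr_left fun i hi => ?_
    obtain ⟨-, h2, h3⟩ := hz i (List.mem_range.1 hi)
    rw [Function.comp_apply, MulAut.conj_apply, ci, ci, h2, ← conj_dd h3]
    group
  have h2 : PP p (fun i => ci l sg (π i)) = PP p (ci l sg) := by
    have h3 : ((List.range p).map π).Perm (List.range p) := by
      refine ((List.subperm_of_subset ?_ ?_).perm_of_length_le (by simp))
      · refine List.Nodup.map_on ?_ List.nodup_range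
        intro i hi i' hi' e
        exact h.equivariant_injOn hz (by simpa using hi) (by simpa using hi') e
      · intro k hk
        obtain ⟨i, hi, rfl⟩ := List.mem_map.1 hk
        exact List.mem_range.2 (hz i (List.mem_range.1 hi)).1
    have h4 := h3.map (ci l sg)
    rw [List.map_map] at h4
    refine h4.prod_eq' ?_
    rw [← List.map_map]
    refine List.Pairwise.map _ (R := fun i i' => i < p ∧ i' < p ∧ i ≠ i') ?_ ?_
    · exact fun i i' ⟨a, b, c⟩ => h.comm_of_ne a b c (ci_mem _ _ _) (ci_mem _ _ _)
    · have h5 : ((List.range p).map π).Nodup := h3.nodup_iff.2 List.nodup_range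
      refine List.Pairwise.imp_of_mem ?_ h5
      intro a b ha hb hne
      exact ⟨List.mem_range.1 (h3.subset ha), List.mem_range.1 (h3.subset hb), hne⟩
  exact mul_inv_eq_iff_eq_mul.1 (h1.trans h2)

end TypeA

/-! ### Descent elements of a parabolic subgroup -/

theorem X_coeff (cs : CoxeterSystem M W) (K J : Finset W) (w : W) :
    (X cs K J).coeff w = if w ∈ Par K ∧ RMin cs J w then 1 else 0 := by
  simp [X, coeff_sum, Finsupp.single_apply]

/-- The descent algebra of the parabolic subgroup `W_K`. -/
def SX (cs : CoxeterSystem M W) (K : Finset W) : Submodule ℂ (MonoidAlgebra ℂ W) :=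
  Submodule.span ℂ {x | ∃ I, I ⊆ K ∧ x = X cs K I}

/-- `y` is supported on `W_K` and its coefficients only depend on descent sets. -/
def Desc (cs : CoxeterSystem M W) (K : Finset W) (y : MonoidAlgebra ℂ W) : Prop :=
  (∀ w, w ∉ Par K → y.coeff w = 0) ∧
    ∀ w ∈ Par K, ∀ w' ∈ Par K, (∀ s ∈ K, refl01 cs w s = refl01 cs w' s) → y.coeff w = y.coeff w'

theorem desc_of_mem_SX {cs : CoxeterSystem M W} {K : Finset W} (hK : K ⊆ Simples cs)
    {y : MonoidAlgebra ℂ W} (hy : y ∈ SX cs K) : Desc cs K y := by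
  induction hy using Submodule.span_induction with
  | mem x hx =>
    obtain ⟨I, hI, rfl⟩ := hx
    refine ⟨fun w hw => by rw [X_coeff, if_neg fun h => hw h.1], fun w hw w' hw' h => ?_⟩
    rw [X_coeff, X_coeff, RMin_iff (hI.trans hK), RMin_iff (hI.trans hK)]
    congr 1
    refine propext (and_congr (by simp [hw, hw']) (forall₂_congr fun s hs => ?_))
    rw [h s (hI hs)]
  | zero => exact ⟨fun _ _ => rfl, fun _ _ _ _ _ => rfl⟩
  | add x y _ _ hx hy =>
    refine ⟨fun w hw => ?_, fun w hw w' hw' h => ?_⟩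
    · rw [coeff_add, Finsupp.add_apply, hx.1 w hw, hy.1 w hw, add_zero]
    · rw [coeff_add, Finsupp.add_apply, Finsupp.add_apply, hx.2 w hw w' hw' h, hy.2 w hw w' hw' h]
  | smul a x _ hx =>
    refine ⟨fun w hw => ?_, fun w hw w' hw' h => ?_⟩
    · rw [coeff_smul_apply, hx.1 w hw, smul_zero]
    · rw [coeff_smul_apply, coeff_smul_apply, hx.2 w hw w' hw' h]

theorem mul_mem_SX {cs : CoxeterSystem M W} {K : Finset W} (hK : K ⊆ Simples cs)
    {x y : MonoidAlgebra ℂ W} (hx : x ∈ SX cs K) (hy : y ∈ SX cs K) : x * y ∈ SX cs K := by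
  induction hx using Submodule.span_induction with
  | mem x hx =>
    obtain ⟨I, hI, rfl⟩ := hx
    induction hy using Submodule.span_induction with
    | mem y hy =>
      obtain ⟨J, hJ, rfl⟩ := hy
      rw [X_mul_X hK hI hJ]
      exact sum_mem fun d _ => Submodule.subset_span ⟨_, (filter_subset _ _).trans hJ, rfl⟩
    | zero => rw [mul_zero]; exact zero_mem _
    | add y z _ _ h1 h2 => rw [mul_add]; exact add_mem h1 h2
    | smul a y _ h => rw [mul_smul_comm]; exact Submodule.smul_mem _ _ h
  | zero => rw [zero_mul]; exact zero_mem _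
  | add y z _ _ h1 h2 => rw [add_mul]; exact add_mem h1 h2
  | smul a y _ h => rw [smul_mul_assoc]; exact Submodule.smul_mem _ _ h

theorem span_ssubset_le (cs : CoxeterSystem M W) (K : Finset W) :
    Submodule.span ℂ {x | ∃ I, I ⊂ K ∧ x = X cs K I} ≤ SX cs K :=
  Submodule.span_mono fun _ ⟨I, hI, e⟩ => ⟨I, hI.subset, e⟩

theorem one_mem_SX {cs : CoxeterSystem M W} {K : Finset W} (hK : K ⊆ Simples cs) :
    1 ∈ SX cs K := Submodule.subset_span ⟨K, Subset.rfl, (X_self hK).symm⟩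

theorem eps_mem_SX {cs : CoxeterSystem M W} {K : Finset W} (hK : K ⊆ Simples cs) :
    eps cs K ∈ SX cs K := by
  have := add_mem (span_ssubset_le cs K (eta_sub_mem_span hK)) (one_mem_SX hK)
  rwa [sub_add_cancel] at this

/-- An element whose coefficients are multiplicative in the descents. -/
theorem sum_prod_smul_sub_mem_span {cs : CoxeterSystem M W} {K : Finset W} (hK : K ⊆ Simples cs)
    (a : W → ℂ) :
    ∑ w ∈ univ.filter (· ∈ Par K), (∏ s ∈ K, if refl01 cs w s = 1 then a s else 1) • of ℂ W w -
      (∏ s ∈ K, (1 - a s)) • 1 ∈ Submodule.span ℂ {x | ∃ I, I ⊂ K ∧ x = X cs K I} := by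
  have h1 : ∀ w, (∏ s ∈ K, if refl01 cs w s = 1 then a s else 1) =
      ∑ I ∈ K.powerset, if RMin cs I w then (∏ s ∈ I, (1 - a s)) * ∏ s ∈ K \ I, a s else 0 := by
    intro w
    have h2 : ∀ s ∈ K, (if refl01 cs w s = 1 then a s else 1) =
        (if refl01 cs w s = 0 then 1 - a s else 0) + a s := by
      intro s _
      rcases zmod2_cases (refl01 cs w s) with h | h <;> simp [h]
    rw [prod_congr rfl h2, prod_add]
    refine sum_congr rfl fun I hI => ?_
    rw [RMin_iff ((mem_powerset.1 hI).trans hK)]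
    split_ifs with hc
    · rw [prod_congr rfl fun s hs => if_pos (hc s hs)]
    · push Not at hc
      obtain ⟨s, hs, hs2⟩ := hc
      rw [prod_eq_zero hs (if_neg hs2), zero_mul]
  have h2 : ∑ w ∈ univ.filter (· ∈ Par K),
      (∏ s ∈ K, if refl01 cs w s = 1 then a s else 1) • of ℂ W w =
      ∑ I ∈ K.powerset, ((∏ s ∈ I, (1 - a s)) * ∏ s ∈ K \ I, a s) • X cs K I := by
    simp only [h1, sum_smul]
    rw [sum_comm]
    refine sum_congr rfl fun I _ => ?_
    rw [X, smul_sum, ← filter_filter, sum_filter (fun w => RMin cs I w)]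
    refine sum_congr rfl fun w _ => ?_
    split_ifs <;> simp
  rw [h2, ← sum_erase_add _ _ (mem_powerset_self K), sdiff_self, X_self hK]
  simp only [bot_eq_empty, prod_empty, mul_one, add_sub_cancel_right]
  refine sum_mem fun I hI => Submodule.smul_mem _ _ (Submodule.subset_span ⟨I, ?_, rfl⟩)
  exact Finset.ssubset_iff_subset_ne.2 ⟨mem_powerset.1 (mem_of_mem_erase hI), ne_of_mem_erase hI⟩

/-- The alternating sum of the coefficients at longest elements detects the unit. -/
theorem eps_ne_zero {cs : CoxeterSystem M W} {K : Finset W} (hK : K ⊆ Simples cs) :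
    eps cs K ≠ 0 := by
  intro h0
  have h1 : -1 ∈ Submodule.span ℂ {x | ∃ I, I ⊂ K ∧ x = X cs K I} := by
    have := eta_sub_mem_span hK
    rwa [← eps, h0, zero_sub] at this
  have h2 : ∀ D, ∃ w, D ⊆ K → w ∈ Par K ∧ ∀ s ∈ K, refl01 cs w s = 1 ↔ s ∈ D := by
    intro D
    by_cases hD : D ⊆ K
    · obtain ⟨w, hw, hw1, hw2⟩ := exists_longest (hD.trans hK)
      refine ⟨w, fun _ => ⟨Par_mono hD hw, fun s hs => ⟨fun h => ?_, fun h => ?_⟩⟩⟩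
      · by_contra hc
        have := hw2 s fun hc2 => hc (mem_of_mem_Par (hD.trans hK) (hK hs) hc2)
        rw [this] at h
        exact zero_ne_one h
      · exact hw1 s (mem_Par h) (isReflection_of_mem (hK hs))
    · exact ⟨1, fun h => absurd h hD⟩
  choose v hv using h2
  have h3 : ∀ I ⊆ K, ∑ D ∈ K.powerset, (-1 : ℂ) ^ D.card * (X cs K I).coeff (v D) =
      ∑ D ∈ (K \ I).powerset, (-1 : ℂ) ^ D.card := by
    intro I hI
    rw [← sum_filter_add_sum_filter_not K.powerset (fun D => D ⊆ K \ I)]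
    have e1 : K.powerset.filter (fun D => D ⊆ K \ I) = (K \ I).powerset := by
      ext D
      simp only [mem_filter, mem_powerset, and_iff_right_iff_imp]
      exact fun h => h.trans sdiff_subset
    rw [e1, sum_eq_zero (s := K.powerset.filter _), add_zero]
    · refine sum_congr rfl fun D hD => ?_
      have hD1 := mem_powerset.1 hD
      have hD2 := hD1.trans sdiff_subset
      rw [X_coeff, if_pos, mul_one]
      refine ⟨(hv D hD2).1, (RMin_iff (hI.trans hK)).2 fun s hs => ?_⟩
      refine (zmod2_cases _).resolve_right fun hc => ?_
      exact (mem_sdiff.1 (hD1 (((hv D hD2).2 s (hI hs)).1 hc))).2 hs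
    · intro D hD
      obtain ⟨hD1, hD2⟩ := mem_filter.1 hD
      rw [mem_powerset] at hD1
      rw [X_coeff, if_neg, mul_zero]
      rintro ⟨-, hc⟩
      refine hD2 fun s hs => mem_sdiff.2 ⟨hD1 hs, fun hsI => ?_⟩
      have := (RMin_iff (hI.trans hK)).1 hc s hsI
      rw [((hv D hD1).2 s (hD1 hs)).2 hs] at this
      exact one_ne_zero this
  have h4 : ∀ y ∈ Submodule.span ℂ {x | ∃ I, I ⊂ K ∧ x = X cs K I},
      ∑ D ∈ K.powerset, (-1 : ℂ) ^ D.card * y.coeff (v D) = 0 := by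
    intro y hy
    induction hy using Submodule.span_induction with
    | mem x hx =>
      obtain ⟨I, hI, rfl⟩ := hx
      rw [h3 I hI.subset]
      have := sum_powerset_neg_one_pow_card_of_nonempty (sdiff_nonempty.2 hI.not_subset)
      exact_mod_cast this
    | zero => simp
    | add x y _ _ hx hy =>
      simp only [coeff_add, Finsupp.add_apply, mul_add, sum_add_distrib, hx, hy, add_zero]
    | smul a x _ hx =>
      simp only [coeff_smul_apply, smul_eq_mul, mul_left_comm _ a, ← mul_sum, hx, mul_zero]
  have h5 := h4 _ h1
  have h6 := h3 K Subset.rfl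
  rw [X_self hK, sdiff_self] at h6
  simp only [coeff_neg, Finsupp.neg_apply, mul_neg, sum_neg_distrib, h6] at h5
  simp at h5

/-! ### The Klyachko idempotent -/

/-- The standard primitive root of unity. -/
def om (n : ℕ) : ℂ := Complex.exp (2 * Real.pi * Complex.I / n)

theorem om_primitive (n : ℕ) : IsPrimitiveRoot (om (n + 1)) (n + 1) :=
  Complex.isPrimitiveRoot_exp (n + 1) n.succ_ne_zero

theorem om_ne_zero (n : ℕ) : om (n + 1) ≠ 0 := (om_primitive n).ne_zero n.succ_ne_zero

/-- The weight of `w`, a product over all chains. -/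
def gw (cs : CoxeterSystem M W) (p : ℕ) (l : ℕ → ℕ) (sg : ℕ → ℕ → W) (w : W) : ℂ :=
  ∏ i ∈ range p, om (l i + 1) ^ majE cs (sg i) (l i) w

/-- The Klyachko element of the parabolic subgroup. -/
def kap (cs : CoxeterSystem M W) (p : ℕ) (l : ℕ → ℕ) (sg : ℕ → ℕ → W) : MonoidAlgebra ℂ W :=
  (∏ i ∈ range p, ((l i : ℂ) + 1))⁻¹ •
    ∑ w ∈ univ.filter (· ∈ Par (LL p l sg)), gw cs p l sg w • of ℂ W w

/-- The elements acting by a nonzero scalar on `κ` from the left. -/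
def eigenL (κ : MonoidAlgebra ℂ W) : Subgroup W where
  carrier := {w | ∃ χ : ℂ, χ ≠ 0 ∧ of ℂ W w * κ = χ • κ}
  one_mem' := ⟨1, one_ne_zero, by rw [map_one, one_mul, one_smul]⟩
  mul_mem' := by
    rintro x y ⟨χ, h1, h2⟩ ⟨ψ, h3, h4⟩
    exact ⟨ψ * χ, mul_ne_zero h3 h1, by rw [map_mul, mul_assoc, h4, mul_smul_comm, h2, smul_smul]⟩
  inv_mem' := by
    rintro x ⟨χ, h1, h2⟩
    refine ⟨χ⁻¹, inv_ne_zero h1, ?_⟩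
    have : of ℂ W x⁻¹ * (of ℂ W x * κ) = κ := by rw [← mul_assoc, ← map_mul]; simp [-of_apply]
    rw [h2, mul_smul_comm] at this
    rw [eq_inv_smul_iff₀ h1, this]

/-- The elements acting by a nonzero scalar on `κ` from the right. -/
def eigenR (κ : MonoidAlgebra ℂ W) : Subgroup W where
  carrier := {w | ∃ χ : ℂ, χ ≠ 0 ∧ κ * of ℂ W w = χ • κ}
  one_mem' := ⟨1, one_ne_zero, by rw [map_one, mul_one, one_smul]⟩
  mul_mem' := by
    rintro x y ⟨χ, h1, h2⟩ ⟨ψ, h3, h4⟩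
    exact ⟨χ * ψ, mul_ne_zero h1 h3, by
      rw [map_mul, ← mul_assoc, h2, smul_mul_assoc, h4, smul_smul]⟩
  inv_mem' := by
    rintro x ⟨χ, h1, h2⟩
    refine ⟨χ⁻¹, inv_ne_zero h1, ?_⟩
    have : κ * of ℂ W x * of ℂ W x⁻¹ = κ := by rw [mul_assoc, ← map_mul]; simp [-of_apply]
    rw [h2, smul_mul_assoc] at this
    rw [eq_inv_smul_iff₀ h1, this]

theorem of_mul_coeff (y : MonoidAlgebra ℂ W) (w h : W) :
    (of ℂ W w * y).coeff h = y.coeff (w⁻¹ * h) := by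
  rw [of_apply, coeff_single_mul_apply, one_mul]

theorem mul_of_coeff (y : MonoidAlgebra ℂ W) (w h : W) :
    (y * of ℂ W w).coeff h = y.coeff (h * w⁻¹) := by
  rw [of_apply, coeff_mul_single_apply, mul_one]

theorem kap_coeff (cs : CoxeterSystem M W) (p : ℕ) (l : ℕ → ℕ) (sg : ℕ → ℕ → W) (w : W) :
    (kap cs p l sg).coeff w = if w ∈ Par (LL p l sg) then
      (∏ i ∈ range p, ((l i : ℂ) + 1))⁻¹ * gw cs p l sg w else 0 := by
  simp [kap, coeff_sum, Finsupp.single_apply]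

theorem prod_add_one_ne_zero (p : ℕ) (l : ℕ → ℕ) : ∏ i ∈ range p, ((l i : ℂ) + 1) ≠ 0 :=
  prod_ne_zero_iff.2 fun _ _ => Nat.cast_add_one_ne_zero _

theorem of_mul_kap {cs : CoxeterSystem M W} {p : ℕ} {l : ℕ → ℕ} {sg : ℕ → ℕ → W} {u : W} {χ : ℂ}
    (hχ : χ ≠ 0) (hu : u ∈ Par (LL p l sg))
    (h : ∀ w ∈ Par (LL p l sg), gw cs p l sg (u * w) = χ * gw cs p l sg w) :
    of ℂ W u * kap cs p l sg = χ⁻¹ • kap cs p l sg := by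
  refine coeff_injective (Finsupp.ext fun w => ?_)
  rw [of_mul_coeff, coeff_smul_apply, kap_coeff, kap_coeff,
    Subgroup.mul_mem_cancel_left _ (inv_mem hu)]
  split_ifs with hw
  · have := h (u⁻¹ * w) (mul_mem (inv_mem hu) hw)
    rw [mul_inv_cancel_left] at this
    rw [this, smul_eq_mul, mul_left_comm χ⁻¹, inv_mul_cancel_left₀ hχ]
  · simp

theorem kap_mul_of {cs : CoxeterSystem M W} {p : ℕ} {l : ℕ → ℕ} {sg : ℕ → ℕ → W} {u : W} {χ : ℂ}
    (hχ : χ ≠ 0) (hu : u ∈ Par (LL p l sg))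
    (h : ∀ w ∈ Par (LL p l sg), gw cs p l sg (w * u) = χ * gw cs p l sg w) :
    kap cs p l sg * of ℂ W u = χ⁻¹ • kap cs p l sg := by
  refine coeff_injective (Finsupp.ext fun w => ?_)
  rw [mul_of_coeff, coeff_smul_apply, kap_coeff, kap_coeff,
    Subgroup.mul_mem_cancel_right _ (inv_mem hu)]
  split_ifs with hw
  · have := h (w * u⁻¹) (mul_mem hw (inv_mem hu))
    rw [inv_mul_cancel_right] at this
    rw [this, smul_eq_mul, mul_left_comm χ⁻¹, inv_mul_cancel_left₀ hχ]
  · simp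

theorem majE_congr {cs : CoxeterSystem M W} {s s' : ℕ → W} {l : ℕ} {w w' : W}
    (h : ∀ j, 1 ≤ j → j ≤ l → refl01 cs w (s j) = refl01 cs w' (s' j)) :
    majE cs s l w = majE cs s' l w' :=
  sum_congr rfl fun j hj => by rw [h j (mem_Icc.1 hj).1 (mem_Icc.1 hj).2]

theorem pow_majE (cs : CoxeterSystem M W) (s : ℕ → W) (l : ℕ) (w : W) (ω : ℂ) :
    ω ^ majE cs s l w = ∏ j ∈ Icc 1 l, if refl01 cs w (s j) = 1 then ω ^ j else 1 := by
  rw [majE, ← prod_pow_eq_pow_sum]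
  refine prod_congr rfl fun j _ => ?_
  split_ifs <;> simp

theorem gw_one (cs : CoxeterSystem M W) (p : ℕ) (l : ℕ → ℕ) (sg : ℕ → ℕ → W) :
    gw cs p l sg 1 = 1 :=
  prod_eq_one fun i _ => by simp [majE, refl01_one]

namespace TypeA

variable {cs : CoxeterSystem M W} {p : ℕ} {l : ℕ → ℕ} {sg : ℕ → ℕ → W}

theorem gw_mul_single {u u' : W} {i : ℕ} (hi : i < p) {χ : ℂ}
    (h1 : om (l i + 1) ^ majE cs (sg i) (l i) u = χ * om (l i + 1) ^ majE cs (sg i) (l i) u')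
    (h2 : ∀ t ∈ RR p l sg i, refl01 cs u t = refl01 cs u' t) :
    gw cs p l sg u = χ * gw cs p l sg u' := by
  rw [gw, gw, ← mul_prod_erase _ _ (mem_range.2 hi), ← mul_prod_erase _ _ (mem_range.2 hi), h1,
    mul_assoc]
  congr 2
  refine prod_congr rfl fun i' hi' => ?_
  rw [majE_congr (w' := u') (s' := sg i')]
  exact fun j hj1 hj => h2 _ (comp_subset_RR (mem_range.1 (mem_of_mem_erase hi'))
    (ne_of_mem_erase hi') (mem_comp.2 ⟨j, hj1, hj, rfl⟩))

theorem gw_cox_mul (h : TypeA cs p l sg) {i : ℕ} (hi : i < p) {w : W} (hw : w ∈ Par (LL p l sg)) :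
    gw cs p l sg (ci l sg i * w) = om (l i + 1) * gw cs p l sg w := by
  rw [← CL_eq_LL hi] at hw
  exact gw_mul_single hi ((h i hi).majE_cox_mul hw (om_primitive _).pow_eq_one)
    fun t ht => (h i hi).refl01_cox_mul_R hw ht

theorem of_ci_mul_kap (h : TypeA cs p l sg) {i : ℕ} (hi : i < p) :
    of ℂ W (ci l sg i) * kap cs p l sg = (om (l i + 1))⁻¹ • kap cs p l sg :=
  of_mul_kap (om_ne_zero _) (Par_mono (comp_subset_LL hi) (ci_mem l sg i))
    fun _ hw => h.gw_cox_mul hi hw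

theorem yy_mem_eigenL (h : TypeA cs p l sg) (m : ℕ → ℕ) : yy p l sg m ∈ eigenL (kap cs p l sg) :=
  PP_mem fun i hi => inv_mem (pow_mem (show ci l sg i ∈ eigenL (kap cs p l sg) from
    ⟨_, inv_ne_zero (om_ne_zero _), h.of_ci_mul_kap hi⟩) _)

theorem flip_mem_eigenR (h : TypeA cs p l sg) {i : ℕ} (hi : i < p) {v : W}
    (hv : v ∈ Par (comp (sg i) (l i)))
    (hv1 : ∀ j, 1 ≤ j → j ≤ l i → refl01 cs v (sg i j) = 1 ∧
      v * sg i j * v⁻¹ = sg i (l i + 1 - j))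
    (hv2 : ∀ r ∈ RR p l sg i, refl01 cs v r = 0) : v ∈ eigenR (kap cs p l sg) := by
  have h0 : om (l i + 1) ^ (∑ j ∈ Icc 1 (l i), (l i + 1 - j)) ≠ 0 :=
    pow_ne_zero _ (om_ne_zero _)
  refine ⟨_, inv_ne_zero h0, kap_mul_of h0 (Par_mono (comp_subset_LL hi) hv) fun w hw => ?_⟩
  refine gw_mul_single hi ?_ fun t ht => ?_
  · rw [pow_majE, pow_majE, ← prod_pow_eq_pow_sum, ← prod_mul_distrib]
    refine prod_nbij' (fun j => l i + 1 - j) (fun j => l i + 1 - j)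
      (fun j hj => by rw [mem_Icc] at *; omega) (fun j hj => by rw [mem_Icc] at *; omega)
      (fun j hj => by rw [mem_Icc] at hj; omega) (fun j hj => by rw [mem_Icc] at hj; omega)
      fun j hj => ?_
    rw [mem_Icc] at hj
    have e : l i + 1 - (l i + 1 - j) = j := by omega
    rw [refl01_mul, (hv1 j hj.1 hj.2).1, (hv1 j hj.1 hj.2).2, e]
    rcases zmod2_cases (refl01 cs w (sg i (l i + 1 - j))) with h1 | h1
    · simp [h1]
    · rw [h1, if_neg (by decide), if_pos rfl, ← pow_add,
        show j + (l i + 1 - j) = l i + 1 by omega, (om_primitive _).pow_eq_one]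
  · rw [refl01_mul, hv2 t ht, (h i hi).comm_comp_R hv (mem_Par ht), mul_inv_cancel_right, zero_add]

theorem gw_conj (h : TypeA cs p l sg) {π : ℕ → ℕ} {z : W} (hz : Equivariant p l sg π z) {w : W}
    (hw : w ∈ Par (LL p l sg)) : gw cs p l sg (z * w * z⁻¹) = gw cs p l sg w := by
  have h1 : ∀ s ∈ LL p l sg, z * s * z⁻¹ ∈ Simples cs := by
    intro s hs
    obtain ⟨i, hi, j, hj1, hj, rfl⟩ := mem_LL.1 hs
    obtain ⟨h1, h2, h3⟩ := hz i hi
    rw [h3 j hj1 hj]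
    exact (h _ h1).mem j hj1 (h2 ▸ hj)
  have hmaps : Set.MapsTo π (range p : Finset ℕ) (range p : Finset ℕ) := fun i hi => by
    rw [mem_coe, mem_range] at *
    exact (hz i hi).1
  symm
  refine prod_nbij π hmaps (h.equivariant_injOn hz)
    (surjOn_of_injOn_of_card_le π hmaps (h.equivariant_injOn hz) le_rfl) fun i hi => ?_
  obtain ⟨-, h3, h4⟩ := hz i (mem_range.1 hi)
  rw [h3]
  congr 1
  refine majE_congr fun j hj1 hj => ?_
  rw [← h4 j hj1 hj, refl01_conj h.subset h1 hw (mem_LL.2 ⟨i, mem_range.1 hi, j, hj1, hj, rfl⟩)]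

theorem of_mul_kap_equivariant (h : TypeA cs p l sg) {π : ℕ → ℕ} {z : W}
    (hz : Equivariant p l sg π z) :
    of ℂ W z * kap cs p l sg = kap cs p l sg * of ℂ W z := by
  have h1 : conjF z (LL p l sg) = LL p l sg := by
    refine eq_of_subset_of_card_le (fun t ht => ?_) (card_conjF _ _).ge
    obtain ⟨s, hs, rfl⟩ := mem_image.1 ht
    obtain ⟨i, hi, j, hj1, hj, rfl⟩ := mem_LL.1 hs
    obtain ⟨h1, h2, h3⟩ := hz i hi
    exact mem_LL.2 ⟨_, h1, j, hj1, h2 ▸ hj, (h3 j hj1 hj).symm⟩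
  refine coeff_injective (Finsupp.ext fun w => ?_)
  have e : w * z⁻¹ = z * (z⁻¹ * w) * z⁻¹ := by group
  have h2 : w * z⁻¹ ∈ Par (LL p l sg) ↔ z⁻¹ * w ∈ Par (LL p l sg) := by
    rw [e, ← conj_mem_Par_iff (w := z) (v := z⁻¹ * w), h1]
  rw [of_mul_coeff, mul_of_coeff, kap_coeff, kap_coeff, h2]
  split_ifs with hw
  · rw [e, h.gw_conj hz hw]
  · rfl

theorem kap_sub_one_mem (h : TypeA cs p l sg) :
    kap cs p l sg - 1 ∈ Submodule.span ℂ {x | ∃ I, I ⊂ LL p l sg ∧ x = X cs (LL p l sg) I} := by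
  have hinj : ∀ i < p, ∀ j, 1 ≤ j → j ≤ l i → ∀ i' < p, ∀ j', 1 ≤ j' → j' ≤ l i' →
      sg i j = sg i' j' → i = i' ∧ j = j' := by
    intro i hi j hj1 hj i' hi' j' hj1' hj' e
    by_cases hne : i = i'
    · subst hne
      exact ⟨rfl, (h i hi).inj _ _ hj1 hj hj1' hj' e⟩
    · refine absurd (comp_subset_RR (sg := sg) (l := l) hi' (Ne.symm hne) (mem_comp.2 ⟨j', hj1', hj', rfl⟩)) ?_
      rw [← e]
      exact (h i hi).notMem j hj1 hj
  obtain ⟨a, ha⟩ : ∃ a : W → ℂ, ∀ i < p, ∀ j, 1 ≤ j → j ≤ l i → a (sg i j) = om (l i + 1) ^ j := by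
    have : ∀ t : W, ∃ x : ℂ, ∀ i < p, ∀ j, 1 ≤ j → j ≤ l i → sg i j = t → x = om (l i + 1) ^ j := by
      intro t
      by_cases ht : t ∈ LL p l sg
      · obtain ⟨i, hi, j, hj1, hj, rfl⟩ := mem_LL.1 ht
        refine ⟨om (l i + 1) ^ j, fun i' hi' j' hj1' hj' e => ?_⟩
        obtain ⟨rfl, rfl⟩ := hinj i' hi' j' hj1' hj' i hi j hj1 hj e
        rfl
      · exact ⟨0, fun i hi j hj1 hj e => absurd (mem_LL.2 ⟨i, hi, j, hj1, hj, e⟩) ht⟩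
    choose a ha using this
    exact ⟨a, fun i hi j hj1 hj => ha _ i hi j hj1 hj rfl⟩
  have hprod : ∀ f : W → ℂ, ∏ s ∈ LL p l sg, f s =
      ∏ i ∈ range p, ∏ j ∈ Icc 1 (l i), f (sg i j) := by
    intro f
    rw [LL, prod_biUnion]
    · refine prod_congr rfl fun i hi => ?_
      rw [comp, prod_image]
      intro j hj k hk e
      rw [mem_coe, mem_Icc] at hj hk
      exact (h i (mem_range.1 hi)).inj _ _ hj.1 hj.2 hk.1 hk.2 e
    · intro i hi i' hi' hne
      refine disjoint_left.2 fun t ht ht' => hne ?_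
      obtain ⟨j, hj1, hj, rfl⟩ := mem_comp.1 ht
      obtain ⟨j', hj1', hj', e⟩ := mem_comp.1 ht'
      exact (hinj i (by simpa using hi) j hj1 hj i' (by simpa using hi') j' hj1' hj' e.symm).1
  have h1 := sum_prod_smul_sub_mem_span h.subset a
  have h2 : ∀ w, (∏ s ∈ LL p l sg, if refl01 cs w s = 1 then a s else 1) = gw cs p l sg w := by
    intro w
    rw [hprod]
    refine prod_congr rfl fun i hi => ?_
    rw [pow_majE]
    refine prod_congr rfl fun j hj => ?_
    rw [ha i (mem_range.1 hi) j (mem_Icc.1 hj).1 (mem_Icc.1 hj).2]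
  have h3 : ∏ s ∈ LL p l sg, (1 - a s) = ∏ i ∈ range p, ((l i : ℂ) + 1) := by
    rw [hprod]
    refine prod_congr rfl fun i hi => ?_
    rw [← (om_primitive (l i)).prod_one_sub_pow_eq_order, range_eq_Ico,
      prod_Ico_add' (fun k => 1 - om (l i + 1) ^ k)]
    refine prod_congr (by ext; simp) fun j hj => ?_
    rw [ha i (mem_range.1 hi) j (mem_Icc.1 hj).1 (mem_Icc.1 hj).2]
  simp only [h2, h3] at h1
  have h4 := Submodule.smul_mem _ (∏ i ∈ range p, ((l i : ℂ) + 1))⁻¹ h1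
  rwa [smul_sub, inv_smul_smul₀ (prod_add_one_ne_zero p l)] at h4

end TypeA

/-! ### Comparison of the Klyachko idempotent and the quasi-idempotent -/

namespace TypeA

variable {cs : CoxeterSystem M W} {p : ℕ} {l : ℕ → ℕ} {sg : ℕ → ℕ → W}

theorem gw_congr {w w' : W} (h : ∀ s ∈ LL p l sg, refl01 cs w s = refl01 cs w' s) :
    gw cs p l sg w = gw cs p l sg w' :=
  prod_congr rfl fun i hi => by
    rw [majE_congr fun j hj1 hj => h _ (mem_LL.2 ⟨i, mem_range.1 hi, j, hj1, hj, rfl⟩)]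

/-- An element with given descents, of the form `c * (a * dd k)`. -/
theorem exists_descents {s : ℕ → W} {l : ℕ} {R : Finset W} (h : Chain cs s l R) {k : ℕ}
    (hk : k < l) {w : W} (hw : refl01 cs w (s (k + 1)) = 1)
    (hw' : 1 ≤ k → refl01 cs w (s k) = 0) :
    ∃ a ∈ Par ((CL s l R).erase (s 1)), ∀ t ∈ CL s l R,
      refl01 cs ((dd s l)⁻¹ * (a * dd s k)) t = refl01 cs w t := by
  set J := (CL s l R).erase (s 1)
  set E := J.filter fun r => refl01 cs w ((dd s k)⁻¹ * r * dd s k) = 1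
  have hJ : J ⊆ Simples cs := h.J_subset
  have hE : E ⊆ Simples cs := (filter_subset _ _).trans hJ
  obtain ⟨a, ha, ha1, ha2⟩ := exists_longest hE
  have haJ : a ∈ Par J := Par_mono (filter_subset _ _) ha
  refine ⟨a, haJ, fun t ht => ?_⟩
  obtain ⟨h1, h2, h3⟩ := h.refl01_cox_mul hk.le haJ
  by_cases c1 : 1 ≤ k ∧ t = s k
  · rw [c1.2, (h1 c1.1).2, hw' c1.1]
  by_cases c2 : t = s (k + 1)
  · rw [c2, (h2 hk).2, hw]
  have c1' : 1 ≤ k → t ≠ s k := fun h e => c1 ⟨h, e⟩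
  rw [h3 t ht c1' fun _ => c2]
  have hm := h.dd_conj_mem hk.le ht c1' fun _ => c2
  rw [refl01_mul, ← refl01_inv, (LMin_iff hJ).1 (h.LMin_dd hk.le) _ hm, zero_add]
  have e : (dd s k)⁻¹ * (dd s k * t * (dd s k)⁻¹) * dd s k = t := by group
  rcases zmod2_cases (refl01 cs w t) with hc | hc
  · rw [hc]
    refine ha2 _ fun hc2 => ?_
    have := (mem_filter.1 (mem_of_mem_Par hE (hJ hm) hc2)).2
    rw [e, hc] at this
    exact zero_ne_one this
  · rw [hc]
    refine ha1 _ (mem_Par (mem_filter.2 ⟨hm, ?_⟩)) (isReflection_of_mem (hJ hm))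
    rw [e, hc]

/-- A descent element which is an eigenvector of all `c_i` is determined by one coefficient. -/
theorem coeff_of_desc (h : TypeA cs p l sg) {y : MonoidAlgebra ℂ W} (hy : Desc cs (LL p l sg) y)
    (hc : ∀ i < p, of ℂ W (ci l sg i) * y = (om (l i + 1))⁻¹ • y) {w : W}
    (hw : w ∈ Par (LL p l sg)) : y.coeff w = gw cs p l sg w * y.coeff 1 := by
  induction hn : ∑ i ∈ range p, majE cs (sg i) (l i) w using Nat.strong_induction_on
    generalizing w with
  | _ n ih =>
  by_cases h0 : ∀ s ∈ LL p l sg, refl01 cs w s = 0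
  · rw [RMin.eq_one h.subset ((RMin_iff h.subset).2 h0) hw, gw_one, one_mul]
  push Not at h0
  obtain ⟨t, ht, h1⟩ := h0
  obtain ⟨i, hi, j, hj1, hj, rfl⟩ := mem_LL.1 ht
  have hex : ∃ k, k < l i ∧ refl01 cs w (sg i (k + 1)) = 1 :=
    ⟨j - 1, by omega, by
      rw [Nat.sub_add_cancel hj1]; exact (zmod2_cases _).resolve_left h1⟩
  obtain ⟨k, ⟨hk, hk1⟩, hmin⟩ : ∃ k, (k < l i ∧ refl01 cs w (sg i (k + 1)) = 1) ∧
      ∀ m < k, ¬ (m < l i ∧ refl01 cs w (sg i (m + 1)) = 1) :=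
    ⟨Nat.find hex, Nat.find_spec hex, fun m hm => Nat.find_min hex hm⟩
  obtain ⟨a, ha, hd⟩ := exists_descents (h i hi) hk hk1 fun h1k => by
    refine (zmod2_cases _).resolve_right fun hc1 => hmin (k - 1) (by omega) ⟨by omega, ?_⟩
    rwa [Nat.sub_add_cancel h1k]
  rw [CL_eq_LL hi] at hd
  set v := a * dd (sg i) k
  have hvL : v ∈ Par (CL (sg i) (l i) (RR p l sg i)) :=
    mul_mem (Par_mono (erase_subset _ _) ha) (Chain.dd_mem_CL hk.le)
  have hv : v ∈ Par (LL p l sg) := by rwa [CL_eq_LL hi] at hvL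
  have hcv : (dd (sg i) (l i))⁻¹ * v ∈ Par (LL p l sg) :=
    mul_mem (Par_mono (comp_subset_LL hi) (ci_mem l sg i)) hv
  have e1 : ∀ i' < p, majE cs (sg i') (l i') w = majE cs (sg i') (l i') ((dd (sg i) (l i))⁻¹ * v) :=
    fun i' hi' => majE_congr fun j hj1 hj => (hd _ (mem_LL.2 ⟨i', hi', j, hj1, hj, rfl⟩)).symm
  have e2 := (h i hi).majE_cox_mul_add hk.le ha
  rw [if_pos hk] at e2
  change majE cs (sg i) (l i) (_ * v) + k = majE cs (sg i) (l i) v + _ at e2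
  rw [← e1 i hi] at e2
  have hlt : ∑ i ∈ range p, majE cs (sg i) (l i) v < n := by
    rw [← hn]
    refine sum_lt_sum (fun i' hi' => ?_) ⟨i, mem_range.2 hi, by omega⟩
    rw [mem_range] at hi'
    rcases eq_or_ne i' i with rfl | hne
    · omega
    · rw [e1 i' hi']
      refine (majE_congr fun j hj1 hj => ?_).le
      exact ((h i hi).refl01_cox_mul_R hvL
        (comp_subset_RR hi' hne (mem_comp.2 ⟨j, hj1, hj, rfl⟩))).symm
  have e3 := congrArg (fun x => x.coeff (ci l sg i * v)) (hc i hi)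
  simp only [of_mul_coeff, coeff_smul_apply, inv_mul_cancel_left, smul_eq_mul] at e3
  rw [eq_inv_mul_iff_mul_eq₀ (om_ne_zero _), ih _ hlt hv rfl] at e3
  rw [hy.2 w hw _ hcv fun s hs => (hd s hs).symm, gw_congr fun s hs => (hd s hs).symm]
  change y.coeff (ci l sg i * v) = gw cs p l sg (ci l sg i * v) * _
  rw [← e3, h.gw_cox_mul hi hv, mul_assoc]

theorem eps_mul_kap (h : TypeA cs p l sg) :
    eps cs (LL p l sg) * kap cs p l sg = eps cs (LL p l sg) := by
  have := eps_mul_of_mem_span h.subset h.kap_sub_one_mem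
  rwa [mul_sub, mul_one, sub_eq_zero] at this

theorem kap_mul_eps (h : TypeA cs p l sg) :
    kap cs p l sg * eps cs (LL p l sg) = kap cs p l sg := by
  set κ := kap cs p l sg
  set ε := eps cs (LL p l sg)
  have hκ : κ ∈ SX cs (LL p l sg) := by
    have := add_mem (span_ssubset_le cs _ h.kap_sub_one_mem) (one_mem_SX h.subset)
    rwa [sub_add_cancel] at this
  have hD := desc_of_mem_SX h.subset (mul_mem_SX h.subset hκ (eps_mem_SX h.subset))
  have h1 : ∀ w ∈ Par (LL p l sg), _ := fun w => h.coeff_of_desc hD (fun i hi => by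
    rw [← mul_assoc, h.of_ci_mul_kap hi, smul_mul_assoc])
  obtain ⟨t, ht⟩ : ∃ t : ℂ, κ * ε = t • κ := by
    refine ⟨(∏ i ∈ range p, ((l i : ℂ) + 1)) * (κ * ε).coeff 1,
      coeff_injective (Finsupp.ext fun w => ?_)⟩
    rw [coeff_smul_apply, kap_coeff]
    split_ifs with hw
    · rw [h1 w hw, smul_eq_mul, mul_mul_mul_comm, mul_inv_cancel₀ (prod_add_one_ne_zero p l),
        one_mul, mul_comm]
    · rw [hD.1 w hw, smul_zero]
  have h2 : ε = t • ε := by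
    calc ε = ε * κ * ε := by rw [h.eps_mul_kap, eps_mul_eps h.subset]
      _ = t • ε := by rw [mul_assoc, ht, mul_smul_comm, h.eps_mul_kap]
  have h3 : (1 - t) • ε = 0 := by rw [sub_smul, one_smul, ← h2, sub_self]
  rcases smul_eq_zero.1 h3 with h4 | h4
  · rw [ht, ← sub_eq_zero.1 h4, one_smul]
  · exact absurd h4 (eps_ne_zero h.subset)

end TypeA

theorem coeff_one_mul_comm (x y : MonoidAlgebra ℂ W) : (x * y).coeff 1 = (y * x).coeff 1 := by
  have h : ∀ x y : MonoidAlgebra ℂ W, (x * y).coeff 1 = ∑ w, x.coeff w * y.coeff w⁻¹ := by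
    intro x y
    induction x using MonoidAlgebra.induction_linear with
    | zero => simp
    | add f g hf hg =>
      simp only [add_mul, coeff_add, Finsupp.add_apply, sum_add_distrib, hf, hg]
    | single w r =>
      rw [coeff_single_mul_apply, sum_eq_single w]
      · simp
      · intro b _ hb
        simp [hb.symm]
      · simp
  rw [h, h, ← Equiv.sum_comp (Equiv.inv W)]
  exact sum_congr rfl fun w _ => by simp [mul_comm]

/-- The trace of left multiplication by `h` is `|W| h(1)`. -/
theorem eq_zero_of_idempotent {h : MonoidAlgebra ℂ W} (hh : h * h = h) {r : ℝ}
    (hr : h.coeff 1 = (r : ℂ)) (hr0 : r ≤ 0) : h = 0 := by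
  have hid : IsIdempotentElem (LinearMap.mulLeft ℂ h) := by
    change LinearMap.mulLeft ℂ h ∘ₗ LinearMap.mulLeft ℂ h = _
    rw [← LinearMap.mulLeft_mul, hh]
  have h1 : LinearMap.trace ℂ _ (LinearMap.mulLeft ℂ h) = Fintype.card W * h.coeff 1 := by
    rw [LinearMap.trace_eq_matrix_trace ℂ (MonoidAlgebra.basis W ℂ), Matrix.trace]
    rw [sum_congr rfl (g := fun _ => h.coeff 1), sum_const, card_univ, nsmul_eq_mul]
    intro w _
    rw [Matrix.diag_apply, LinearMap.toMatrix_apply, MonoidAlgebra.basis_apply,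
      LinearMap.mulLeft_apply]
    change (h * single w 1).coeff w = _
    simp [coeff_mul_single_apply]
  have h2 := (LinearMap.IsIdempotentElem.isProj_range _ hid).trace
  rw [h1, hr] at h2
  have h3 : ((Fintype.card W * r : ℝ) : ℂ) = 0 := by
    have h4 : (Fintype.card W * r : ℝ) = Module.finrank ℂ (LinearMap.range (LinearMap.mulLeft ℂ h)) := by
      exact_mod_cast h2
    have h5 : (Fintype.card W * r : ℝ) ≤ 0 := mul_nonpos_of_nonneg_of_nonpos (by positivity) hr0
    have h6 : (0 : ℝ) ≤ Fintype.card W * r := h4 ▸ Nat.cast_nonneg _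
    rw [le_antisymm h5 h6, Complex.ofReal_zero]
  have h7 : LinearMap.mulLeft ℂ h = 0 := by
    rw [← LinearMap.IsIdempotentElem.trace_eq_zero_iff hid, h1, hr]
    exact_mod_cast h3
  simpa using LinearMap.congr_fun h7 1

/-- The quasi-idempotent attached to a linear character of a subgroup. -/
def charIdem (Z : Finset W) (φ : W → ℂ) : MonoidAlgebra ℂ W :=
  ((Z.card : ℂ))⁻¹ • ∑ z ∈ Z, φ z • of ℂ W z⁻¹

section charIdem

variable {H : Subgroup W} {Z : Finset W} {φ : W → ℂ}

theorem charIdem_mul_self (hZ : ∀ z, z ∈ Z ↔ z ∈ H)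
    (hφ : ∀ x ∈ H, ∀ y ∈ H, φ (x * y) = φ x * φ y) :
    charIdem Z φ * charIdem Z φ = charIdem Z φ := by
  have hc : (Z.card : ℂ) ≠ 0 :=
    Nat.cast_ne_zero.2 (card_ne_zero_of_mem ((hZ 1).2 H.one_mem))
  have h1 : ∀ x ∈ Z, (φ x • of ℂ W x⁻¹) * (∑ z ∈ Z, φ z • of ℂ W z⁻¹) =
      ∑ z ∈ Z, φ z • of ℂ W z⁻¹ := by
    intro x hx
    rw [mul_sum]
    refine sum_nbij' (fun z => z * x) (fun z => z * x⁻¹) ?_ ?_ ?_ ?_ ?_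
    · exact fun z hz => (hZ _).2 (mul_mem ((hZ _).1 hz) ((hZ _).1 hx))
    · exact fun z hz => (hZ _).2 (mul_mem ((hZ _).1 hz) (inv_mem ((hZ _).1 hx)))
    · intro z _; group
    · intro z _; group
    · intro z hz
      rw [hφ z ((hZ _).1 hz) x ((hZ _).1 hx), mul_inv_rev, map_mul, smul_mul_smul_comm,
        mul_comm (φ x)]
  rw [charIdem, smul_mul_smul_comm, sum_mul, sum_congr rfl h1, sum_const, ← Nat.cast_smul_eq_nsmul ℂ,
    smul_smul, mul_assoc, inv_mul_cancel₀ hc, mul_one]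

theorem charIdem_coeff_one (hZ : ∀ z, z ∈ Z ↔ z ∈ H) (h1 : φ 1 = 1) :
    (charIdem Z φ).coeff 1 = (Z.card : ℂ)⁻¹ := by
  rw [charIdem, coeff_smul_apply, coeff_sum, Finsupp.finsetSum_apply, sum_eq_single 1]
  · simp [h1]
  · intro z _ hz
    simp [hz]
  · exact fun h => absurd ((hZ 1).2 H.one_mem) h

theorem mul_charIdem_mul (hZ : ∀ z, z ∈ Z ↔ z ∈ H)
    (hφ : ∀ x ∈ H, ∀ y ∈ H, φ (x * y) = φ x * φ y) (h1 : φ 1 = 1) {a κ : MonoidAlgebra ℂ W}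
    (ha : ∀ z ∈ H, a * of ℂ W z * κ = φ z • a) : a * charIdem Z φ * κ = a := by
  have hc : (Z.card : ℂ) ≠ 0 :=
    Nat.cast_ne_zero.2 (card_ne_zero_of_mem ((hZ 1).2 H.one_mem))
  rw [charIdem, mul_smul_comm, smul_mul_assoc, mul_sum, sum_mul, sum_congr rfl (g := fun _ => a),
    sum_const, ← Nat.cast_smul_eq_nsmul ℂ, smul_smul, inv_mul_cancel₀ hc, one_smul]
  intro z hz
  have hz' := (hZ z).1 hz
  rw [mul_smul_comm, smul_mul_assoc, ha _ (inv_mem hz'), smul_smul, ← hφ z hz' _ (inv_mem hz'),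
    mul_inv_cancel, h1, one_smul]

/-- Comparison of the right ideals generated by `charIdem Z φ` and by a quasi-idempotent `a`:
the trace bounds the rank of the former by that of the latter. -/
theorem bijOn_charIdem (hZ : ∀ z, z ∈ Z ↔ z ∈ H)
    (hφ : ∀ x ∈ H, ∀ y ∈ H, φ (x * y) = φ x * φ y) (h1 : φ 1 = 1) {a κ b u : MonoidAlgebra ℂ W}
    (ha : ∀ z ∈ H, a * of ℂ W z * κ = φ z • a) {ν N : ℕ} (hν : 0 < ν) (hN : 0 < N)
    (haa : a * a = (ν : ℂ) • a) (ha1 : a.coeff 1 = (N : ℂ)⁻¹) (hcard : ν * N ≤ Z.card)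
    (hb : b * a = a) (hu : b = a * u) :
    Set.BijOn (fun x => a * x) {y | ∃ x, y = charIdem Z φ * x} {y | ∃ x, y = b * x} := by
  set f := charIdem Z φ
  have hff : f * f = f := charIdem_mul_self hZ hφ
  have hafκ : a * f * κ = a := mul_charIdem_mul hZ hφ h1 ha
  have hν' : (ν : ℂ) ≠ 0 := Nat.cast_ne_zero.2 hν.ne'
  have hN' : (N : ℂ) ≠ 0 := Nat.cast_ne_zero.2 hN.ne'
  set v := (ν : ℂ)⁻¹ • (f * κ * a * f) with hv
  have hfv : f * v = v := by
    rw [hv, mul_smul_comm]; simp only [← mul_assoc, hff]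
  have hvf : v * f = v := by
    rw [hv, smul_mul_assoc]; simp only [mul_assoc, hff]
  have hvv : v * v = v := by
    rw [hv, smul_mul_smul_comm]
    have : f * κ * a * f * (f * κ * a * f) = (ν : ℂ) • (f * κ * a * f) := by
      calc f * κ * a * f * (f * κ * a * f) = f * κ * (a * (f * f) * κ) * a * f := by
            simp only [mul_assoc]
        _ = _ := by
          rw [hff, hafκ, mul_assoc (f * κ), haa, mul_smul_comm, smul_mul_assoc]
    rw [this, smul_smul, mul_assoc, inv_mul_cancel₀ hν', mul_one]
  have hv1 : v.coeff 1 = (ν : ℂ)⁻¹ * (N : ℂ)⁻¹ := by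
    have : (f * κ * a * f).coeff 1 = (N : ℂ)⁻¹ := by
      rw [mul_assoc (f * κ), coeff_one_mul_comm, ← mul_assoc, mul_assoc a, hff, hafκ, ha1]
    rw [hv, coeff_smul_apply, this, smul_eq_mul]
  have hfeq : f = v := by
    rw [← sub_eq_zero]
    refine eq_zero_of_idempotent (r := (Z.card : ℝ)⁻¹ - ((ν * N : ℕ) : ℝ)⁻¹) ?_ ?_ ?_
    · rw [sub_mul, mul_sub, mul_sub, hff, hfv, hvf, hvv, sub_self, sub_zero]
    · rw [coeff_sub, Finsupp.sub_apply, charIdem_coeff_one hZ h1, hv1]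
      push_cast
      rw [mul_inv]
    · rw [sub_nonpos]
      exact inv_anti₀ (by exact_mod_cast Nat.mul_pos hν hN) (by exact_mod_cast hcard)
  refine ⟨?_, ?_, ?_⟩
  · rintro _ ⟨x, rfl⟩
    exact ⟨a * (f * x), by rw [← mul_assoc, hb]⟩
  · have key : ∀ x, f * x = (ν : ℂ)⁻¹ • (f * κ * (a * (f * x))) := by
      intro x
      conv_lhs => rw [hfeq, hv]
      rw [smul_mul_assoc]; simp only [mul_assoc]
    rintro _ ⟨x, rfl⟩ _ ⟨y, rfl⟩ hxy
    change a * (f * x) = a * (f * y) at hxy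
    rw [key x, key y, hxy]
  · rintro _ ⟨x, rfl⟩
    refine ⟨f * (κ * (u * x)), ⟨_, rfl⟩, ?_⟩
    change a * _ = _
    rw [← mul_assoc, ← mul_assoc, hafκ, hu, mul_assoc]

end charIdem

theorem gen_coeff_one {cs : CoxeterSystem M W} {L : Finset W} (hL : L ⊆ Simples cs) :
    (gen cs L).coeff 1 = (eps cs L).coeff 1 := by
  rw [gen, X, sum_mul, coeff_sum, Finsupp.finsetSum_apply, sum_eq_single 1]
  · rw [of_mul_coeff, inv_one, one_mul]
  · intro w hw hne
    rw [mem_filter] at hw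
    rw [of_mul_coeff, mul_one]
    refine (desc_of_mem_SX hL (eps_mem_SX hL)).1 _ fun h => hne ?_
    exact hw.2.2.eq_one hL (by simpa using inv_mem h)
  · refine fun h => absurd ?_ h
    rw [mem_filter]
    exact ⟨mem_univ _, one_mem _, (RMin_iff hL).2 fun s _ => refl01_one cs s⟩

theorem gen_mul_of_NL {cs : CoxeterSystem M W} {L : Finset W} (hL : L ⊆ Simples cs) {n : W}
    (hn : n ∈ NL cs L) : gen cs L * of ℂ W n = gen cs L := by
  rw [gen, mul_assoc, ← of_mul_eps hL hn, ← mul_assoc, X_mul_of_NL hL hn]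

theorem one_mem_NL {cs : CoxeterSystem M W} {L : Finset W} (hL : L ⊆ Simples cs) :
    1 ∈ NL cs L :=
  mem_NL.2 ⟨(RMin_iff hL).2 fun s _ => refl01_one cs s, by simp [conjF]⟩

namespace TypeA

variable {cs : CoxeterSystem M W} {p : ℕ} {l : ℕ → ℕ} {sg : ℕ → ℕ → W}

theorem gen_mul_kap (h : TypeA cs p l sg) :
    gen cs (LL p l sg) * kap cs p l sg = gen cs (LL p l sg) := by
  rw [gen, mul_assoc, h.eps_mul_kap]

theorem gen_coeff_one_eq (h : TypeA cs p l sg) :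
    (gen cs (LL p l sg)).coeff 1 = (((∏ i ∈ range p, (l i + 1) : ℕ) : ℂ))⁻¹ := by
  rw [gen_coeff_one h.subset, ← h.eps_mul_kap, coeff_one_mul_comm, h.kap_mul_eps, kap_coeff,
    if_pos (one_mem _), gw_one, mul_one]
  push_cast
  rfl

theorem gen_ne_zero (h : TypeA cs p l sg) : gen cs (LL p l sg) ≠ 0 := by
  intro e
  have := h.gen_coeff_one_eq
  rw [e, coeff_zero, Finsupp.zero_apply] at this
  refine inv_ne_zero ?_ this.symm
  exact_mod_cast (prod_pos fun i _ => Nat.succ_pos (l i)).ne'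

theorem ci_comm (h : TypeA cs p l sg) {i : ℕ} (hi : i < p) :
    ci l sg i * PP p (ci l sg) = PP p (ci l sg) * ci l sg i := by
  refine Commute.list_prod_right _ _ fun x hx => ?_
  obtain ⟨i', hi', rfl⟩ := List.mem_map.1 hx
  rcases eq_or_ne i i' with rfl | hne
  · exact Commute.refl _
  · exact h.comm_of_ne hi (List.mem_range.1 hi') hne (ci_mem l sg i) (ci_mem l sg i')

theorem exists_correction (h : TypeA cs p l sg) :
    ∃ u₀ : W → W, ∀ n ∈ NL cs (LL p l sg), u₀ n ∈ Par (LL p l sg) ∧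
      u₀ n ∈ eigenR (kap cs p l sg) ∧ ∃ π, Equivariant p l sg π (n * u₀ n) := by
  have h1 : ∀ i, ∃ w, i < p → w ∈ Par (comp (sg i) (l i)) ∧
      (∀ j, 1 ≤ j → j ≤ l i → refl01 cs w (sg i j) = 1 ∧ w * sg i j * w⁻¹ = sg i (l i + 1 - j)) ∧
      ∀ r ∈ RR p l sg i, refl01 cs w r = 0 := by
    intro i
    by_cases hi : i < p
    · obtain ⟨w, hw⟩ := (h i hi).exists_flip
      exact ⟨w, fun _ => hw⟩
    · exact ⟨1, fun h => absurd h hi⟩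
  choose fl hfl using h1
  have h2 : ∀ n, ∃ u, n ∈ NL cs (LL p l sg) → u ∈ Par (LL p l sg) ∧
      u ∈ eigenR (kap cs p l sg) ∧ ∃ π, Equivariant p l sg π (n * u) := by
    intro n
    by_cases hn : n ∈ NL cs (LL p l sg)
    · obtain ⟨T, π, hT⟩ := h.exists_equivariant
        (fun i hi => ⟨(hfl i hi).1, fun j h1 h2 => ((hfl i hi).2.1 j h1 h2).2⟩) hn
      refine ⟨_, fun _ => ⟨PP_mem fun i hi => ?_, PP_mem fun i hi => ?_, π, hT⟩⟩
      · split_ifs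
        · exact Par_mono (comp_subset_LL hi) (hfl i hi).1
        · exact one_mem _
      · split_ifs
        · exact h.flip_mem_eigenR hi (hfl i hi).1 (hfl i hi).2.1 (hfl i hi).2.2
        · exact one_mem _
    · exact ⟨1, fun h => absurd h hn⟩
  choose u₀ hu₀ using h2
  exact ⟨u₀, hu₀⟩

theorem exists_factor (h : TypeA cs p l sg) {z : W}
    (hz : z * PP p (ci l sg) = PP p (ci l sg) * z) :
    ∃ (x : W) (χ ψ : ℂ), χ ≠ 0 ∧ ψ ≠ 0 ∧
      of ℂ W z * kap cs p l sg = χ • (kap cs p l sg * of ℂ W x) ∧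
      gen cs (LL p l sg) * of ℂ W x = ψ • gen cs (LL p l sg) := by
  obtain ⟨u₀, hu₀⟩ := h.exists_correction
  obtain ⟨n, hn, u, hu, rfl⟩ := h.exists_NL_mul hz
  obtain ⟨h1, ⟨ψ, hψ, h2⟩, π, h3⟩ := hu₀ n hn
  have hx := h.equivariant_comm h3
  obtain ⟨m, -, hm⟩ := h.exists_yy (x := (u₀ n)⁻¹ * u) (mul_mem (inv_mem h1) hu) (by
    have e : (u₀ n)⁻¹ * u = (n * u₀ n)⁻¹ * (n * u) := by group
    rw [e]
    exact Commute.mul_left (Commute.inv_left hx) hz)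
  obtain ⟨χ, hχ, h4⟩ := h.yy_mem_eigenL m
  refine ⟨n * u₀ n, χ, ψ, hχ, hψ, ?_, ?_⟩
  · rw [show n * u = n * u₀ n * ((u₀ n)⁻¹ * u) by group, map_mul, mul_assoc, hm, h4, mul_smul_comm,
      h.of_mul_kap_equivariant h3]
  · rw [map_mul, ← mul_assoc, gen_mul_of_NL h.subset hn, ← h.gen_mul_kap, mul_assoc, h2,
      mul_smul_comm]

theorem exists_character (h : TypeA cs p l sg) {H : Subgroup W}
    (hH : ∀ z, z ∈ H ↔ z * PP p (ci l sg) = PP p (ci l sg) * z) :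
    ∃ φ : W → ℂ, (∀ z ∈ H, φ z ≠ 0) ∧
      (∀ z ∈ H, gen cs (LL p l sg) * of ℂ W z * kap cs p l sg = φ z • gen cs (LL p l sg)) ∧
      ∀ x ∈ H, ∀ y ∈ H, φ (x * y) = φ x * φ y := by
  have h1 : ∀ z, ∃ r : ℂ, z ∈ H → r ≠ 0 ∧
      gen cs (LL p l sg) * of ℂ W z * kap cs p l sg = r • gen cs (LL p l sg) := by
    intro z
    by_cases hz : z ∈ H
    · obtain ⟨x, χ, ψ, hχ, hψ, e1, e2⟩ := h.exists_factor ((hH z).1 hz)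
      refine ⟨χ * ψ, fun _ => ⟨mul_ne_zero hχ hψ, ?_⟩⟩
      rw [mul_assoc, e1, mul_smul_comm, ← mul_assoc, h.gen_mul_kap, e2, smul_smul]
    · exact ⟨1, fun h => absurd h hz⟩
  choose φ hφ using h1
  refine ⟨φ, fun z hz => (hφ z hz).1, fun z hz => (hφ z hz).2, fun z hz w hw => ?_⟩
  obtain ⟨x, χ, ψ, hχ, hψ, e1, e2⟩ := h.exists_factor ((hH w).1 hw)
  have e3 : φ w = χ * ψ := by
    refine smul_left_injective ℂ h.gen_ne_zero ?_
    change φ w • gen cs (LL p l sg) = (χ * ψ) • gen cs (LL p l sg)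
    rw [← (hφ w hw).2, mul_assoc, e1, mul_smul_comm, ← mul_assoc, h.gen_mul_kap, e2, smul_smul]
  refine smul_left_injective ℂ h.gen_ne_zero ?_
  change φ (z * w) • gen cs (LL p l sg) = (φ z * φ w) • gen cs (LL p l sg)
  rw [← (hφ _ (mul_mem hz hw)).2, map_mul, ← mul_assoc, mul_assoc _ _ (kap cs p l sg), e1,
    mul_smul_comm, ← mul_assoc, (hφ z hz).2, smul_mul_assoc, e2, e3, smul_smul, smul_smul]
  congr 1
  ring

theorem card_NL_mul_le (h : TypeA cs p l sg) {Z : Finset W}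
    (hZ : ∀ z, z ∈ Z ↔ z * PP p (ci l sg) = PP p (ci l sg) * z) :
    (NL cs (LL p l sg)).card * ∏ i ∈ range p, (l i + 1) ≤ Z.card := by
  obtain ⟨u₀, hu₀⟩ := h.exists_correction
  set E : (Fin p → ℕ) → ℕ → ℕ := fun m i => if hi : i < p then m ⟨i, hi⟩ else 0
  have hE : ∀ m ∈ Fintype.piFinset (fun i : Fin p => range (l i + 1)), ∀ i < p, E m i ≤ l i := by
    intro m hm i hi
    have := Fintype.mem_piFinset.1 hm ⟨i, hi⟩
    rw [mem_range] at this
    simp only [E, dif_pos hi]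
    exact Nat.lt_succ_iff.1 this
  have hcard : (NL cs (LL p l sg) ×ˢ Fintype.piFinset (fun i : Fin p => range (l i + 1))).card =
      (NL cs (LL p l sg)).card * ∏ i ∈ range p, (l i + 1) := by
    rw [card_product, Fintype.card_piFinset, prod_range]
    simp only [card_range]
  rw [← hcard]
  refine card_le_card_of_injOn (fun x => x.1 * u₀ x.1 * yy p l sg (E x.2)) ?_ ?_
  · rintro ⟨n, m⟩ hnm
    rw [mem_coe, mem_product] at hnm
    obtain ⟨-, -, π, h3⟩ := hu₀ n hnm.1
    refine (hZ _).2 ?_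
    exact Commute.mul_left (h.equivariant_comm h3) (h.yy_comm _)
  · rintro ⟨n, m⟩ hnm ⟨n', m'⟩ hnm' e
    rw [mem_coe, mem_product] at hnm hnm'
    dsimp only at hnm hnm' e
    rw [mul_assoc, mul_assoc] at e
    obtain ⟨rfl, e'⟩ := (mem_NL.1 hnm.1).1.unique h.subset (mem_NL.1 hnm'.1).1
      (mul_mem (hu₀ n hnm.1).1 (yy_mem p l sg _)) (mul_mem (hu₀ n' hnm'.1).1 (yy_mem p l sg _)) e
    rw [mul_right_inj] at e'
    refine Prod.ext rfl (funext fun i => ?_)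
    have := h.yy_injective (hE m hnm.2) (hE m' hnm'.2) e' i.2
    simpa [E] using this

end TypeA

/-- Theorem 7.1 (group algebra half): let `W_L` be a standard parabolic subgroup
all of whose irreducible components `L_1, …, L_p` are of type `A` (encoded by the
orders of products of the generators `s_{i,j}`), let `c = c_1 ⋯ c_p` with
`c_i = s_{i,l_i} ⋯ s_{i,1}`, and let `λ` be the shape of `W_L`.  Then the character
`φ_c` of `Z_{W_L}(c)` (with `φ_c(c_i) = e^{-2πi/n_i}`, `n_i = l_i + 1`) extends to
a linear character `φ̃_c` of `Z_W(c)` such that `E_λ ≅ Ind_{Z_W(c)}^W(φ̃_c)` as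
right `ℂW`-modules. -/
theorem stmt19 (cs : CoxeterSystem M W)
    (e : Finset W → MonoidAlgebra ℂ W)
    (he : IsBBHT cs Set.univ (Simples cs) (fun _ => (1 : ℝ)) e)
    (p : ℕ) (hp : 0 < p) (l : ℕ → ℕ) (hl : ∀ i < p, 1 ≤ l i)
    (sg : ℕ → ℕ → W)
    (hsgS : ∀ i < p, ∀ j, 1 ≤ j → j ≤ l i → sg i j ∈ Simples cs)
    (horder3 : ∀ i < p, ∀ j, 1 ≤ j → j < l i → orderOf (sg i j * sg i (j + 1)) = 3)
    (horder2 : ∀ i < p, ∀ i' < p, ∀ j j', 1 ≤ j → j ≤ l i → 1 ≤ j' → j' ≤ l i' →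
      ¬(i = i' ∧ (j' = j + 1 ∨ j = j' + 1)) → (i ≠ i' ∨ j ≠ j') →
      orderOf (sg i j * sg i' j') = 2) :
    let L : Finset W := (Finset.range p).biUnion (fun i => (Finset.Icc 1 (l i)).image (sg i))
    let ci : ℕ → W := fun i => (((List.range (l i)).reverse).map (fun j => sg i (j + 1))).prod
    let c : W := ((List.range p).map ci).prod
    let Z : Subgroup W := Subgroup.centralizer {c}
    let Zfin : Finset W := Finset.univ.filter (fun z => z ∈ Z)
    let elam : MonoidAlgebra ℂ W :=
      ∑ J ∈ (Simples cs).powerset.filter (fun J => ShapeEq L J), e J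
    ∃ φ : W → ℂ,
      (∀ x ∈ Z, ∀ y ∈ Z, φ (x * y) = φ x * φ y) ∧ φ 1 = 1 ∧ (∀ z ∈ Z, φ z ≠ 0) ∧
      (∀ i < p, φ (ci i) = Complex.exp (-(2 * (Real.pi : ℂ) * Complex.I) / ((l i : ℂ) + 1))) ∧
      ∃ a : MonoidAlgebra ℂ W,
        Set.BijOn (fun x => a * x)
          {y | ∃ x : MonoidAlgebra ℂ W,
            y = (((Zfin.card : ℂ))⁻¹ • ∑ z ∈ Zfin, φ z • of ℂ W z⁻¹) * x}
          {y | ∃ x : MonoidAlgebra ℂ W, y = elam * x} := by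
  intro L ci c Z Zfin elam
  have hA : TypeA cs p l sg := typeA_of_orderOf hl hsgS horder3 horder2
  have hci : ∀ i < p, ci i = TypeA.ci l sg i := fun i hi => prod_reverse_eq_inv_dd (hsgS i hi)
  have hc : c = PP p (TypeA.ci l sg) :=
    congrArg List.prod (List.map_congr_left fun i hi => hci i (List.mem_range.1 hi))
  have hZ : ∀ z, z ∈ Z ↔ z * PP p (TypeA.ci l sg) = PP p (TypeA.ci l sg) * z := by
    intro z
    rw [← hc, Subgroup.mem_centralizer_singleton_iff]
  have hZfin : ∀ z, z ∈ Zfin ↔ z ∈ Z := fun z => by simp [Zfin]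
  obtain ⟨φ, h0, hφ, hmul⟩ := hA.exists_character hZ
  have h1 : φ 1 = 1 := by
    have := hmul 1 Z.one_mem 1 Z.one_mem
    rw [mul_one] at this
    exact (mul_eq_left₀ (h0 1 Z.one_mem)).1 this.symm
  refine ⟨φ, hmul, h1, h0, fun i hi => ?_, gen cs L, ?_⟩
  · have hciZ : ci i ∈ Z := by
      rw [hci i hi, hZ]
      exact hA.ci_comm hi
    refine smul_left_injective ℂ hA.gen_ne_zero ?_
    change φ (ci i) • gen cs (LL p l sg) = _ • gen cs (LL p l sg)
    rw [← hφ _ hciZ, hci i hi, mul_assoc, hA.of_ci_mul_kap hi, mul_smul_comm, hA.gen_mul_kap, om,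
      ← Complex.exp_neg, neg_div]
    push_cast
    rfl
  · obtain ⟨u, hu⟩ := elam_eq_gen_mul he hA.subset
    have hν : 0 < (NL cs (LL p l sg)).card :=
      card_pos.2 ⟨1, one_mem_NL hA.subset⟩
    exact bijOn_charIdem hZfin hmul h1 hφ hν (prod_pos fun i _ => Nat.succ_pos (l i))
      (gen_mul_gen hA.subset) hA.gen_coeff_one_eq
      (hA.card_NL_mul_le fun z => (hZfin z).trans (hZ z)) (gen_eq_elam_mul he hA.subset) hu

end DPR
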